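/- Blow-down asymptotics (Lemma 3.1): assume {U₀ > 0} is connected. If V is a global minimizer of J with V(x) ≥ U₀(x) for all x, then V(t x)/t → U₀(x) as t → ∞, uniformly for x in compact subsets of ℝⁿ. The same conclusion holds if instead 0 ≤ V(x) ≤ U₀(x) for all x and V is not identically zero. -/

import Mathlib

open MeasureTheory Metric Set Filter ENNReal NNReal

/-- The Alt–Caffarelli energy `J_D(u) = ∫_D (‖∇u‖² + 𝟙_{u>0})`, valued in `[0,∞]`. -/
noncomputable def JE {n : ℕ} (D : Set (EuclideanSpace ℝ (Fin n)))
    (u : EuclideanSpace ℝ (Fin n) → ℝ) : ℝ≥0∞ :=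
  ∫⁻ x in D, ((‖gradient u x‖₊ : ℝ≥0∞) ^ 2 + if 0 < u x then 1 else 0)

/-- `u` is a (nonnegative, locally Lipschitz) minimizer of `J` in the open set `Ω`:
for every nonnegative locally Lipschitz competitor `v` with `{v ≠ u}` a bounded subset
of `Ω`, one has `J_{Ω ∩ B}(u) ≤ J_{Ω ∩ B}(v)` for every open ball `B ⊇ {v ≠ u}`. -/
def IsMinimizer {n : ℕ} (Ω : Set (EuclideanSpace ℝ (Fin n)))
    (u : EuclideanSpace ℝ (Fin n) → ℝ) : Prop :=
  (∀ x, 0 ≤ u x) ∧ LocallyLipschitz u ∧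
  ∀ v : EuclideanSpace ℝ (Fin n) → ℝ, (∀ x, 0 ≤ v x) → LocallyLipschitz v →
    Bornology.IsBounded {x | v x ≠ u x} → {x | v x ≠ u x} ⊆ Ω →
    ∀ (c : EuclideanSpace ℝ (Fin n)) (r : ℝ), {x | v x ≠ u x} ⊆ Metric.ball c r →
      JE (Ω ∩ Metric.ball c r) u ≤ JE (Ω ∩ Metric.ball c r) v

open MeasureTheory Metric Set Filter ENNReal NNReal

set_option linter.all false
namespace AC
open scoped Gradient Topology InnerProductSpace

section
variable {E : Type*} [NormedAddCommGroup E] [InnerProductSpace ℝ E] [FiniteDimensional ℝ E]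

theorem ll_mul {f g : E → ℝ} (hf : LocallyLipschitz f) (hg : LocallyLipschitz g) :
    LocallyLipschitz (fun x => f x * g x) := by
  have h : LocallyLipschitz (fun p : ℝ × ℝ => p.1 * p.2) :=
    ContDiff.locallyLipschitz (𝕂 := ℝ) (by fun_prop)
  exact h.comp (hf.prodMk hg)

theorem ll_add {f g : E → ℝ} (hf : LocallyLipschitz f) (hg : LocallyLipschitz g) :
    LocallyLipschitz (fun x => f x + g x) := by
  have h : LocallyLipschitz (fun p : ℝ × ℝ => p.1 + p.2) :=
    ContDiff.locallyLipschitz (𝕂 := ℝ) (by fun_prop)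
  exact h.comp (hf.prodMk hg)

theorem ll_sub {f g : E → ℝ} (hf : LocallyLipschitz f) (hg : LocallyLipschitz g) :
    LocallyLipschitz (fun x => f x - g x) := by
  have h : LocallyLipschitz (fun p : ℝ × ℝ => p.1 - p.2) :=
    ContDiff.locallyLipschitz (𝕂 := ℝ) (by fun_prop)
  exact h.comp (hf.prodMk hg)

theorem ll_cmul {f : E → ℝ} (c : ℝ) (hf : LocallyLipschitz f) :
    LocallyLipschitz (fun x => c * f x) := ll_mul (LocallyLipschitz.const c) hf

theorem ll_max {f g : E → ℝ} (hf : LocallyLipschitz f) (hg : LocallyLipschitz g) :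
    LocallyLipschitz (fun x => max (f x) (g x)) := hf.max hg

theorem ll_min {f g : E → ℝ} (hf : LocallyLipschitz f) (hg : LocallyLipschitz g) :
    LocallyLipschitz (fun x => min (f x) (g x)) := hf.min hg

theorem ll_cd {f : E → ℝ} (hf : ContDiff ℝ 1 f) : LocallyLipschitz f := hf.locallyLipschitz

theorem ll_inv {f : E → ℝ} (hf : LocallyLipschitz f) (h0 : ∀ x, f x ≠ 0) :
    LocallyLipschitz (fun x => (f x)⁻¹) := by
  intro x
  obtain ⟨K, s, hs, hK⟩ := ((contDiffAt_inv ℝ (h0 x) : ContDiffAt ℝ 1 _ _)).exists_lipschitzOnWith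
  obtain ⟨K', t, ht, hK'⟩ := hf x
  refine ⟨K * K', t ∩ f ⁻¹' s, inter_mem ht (hf.continuous.continuousAt hs), ?_⟩
  exact hK.comp (hK'.mono inter_subset_left) (fun y hy => hy.2)

theorem ll_lip {f : E → ℝ} (hf : LocallyLipschitz f) (c : E) (R : ℝ) :
    ∃ L : ℝ≥0, LipschitzOnWith L f (closedBall c R) :=
  (hf.locallyLipschitzOn (s := closedBall c R)).exists_lipschitzOnWith_of_compact
    (isCompact_closedBall c R)

theorem grad_norm_le {f : E → ℝ} {L : ℝ≥0} {s : Set E} {x : E} (hf : LipschitzOnWith L f s)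
    (hs : s ∈ 𝓝 x) : ‖∇ f x‖ ≤ L := by
  have : ‖∇ f x‖ = ‖fderiv ℝ f x‖ := by
    rw [gradient, LinearIsometryEquiv.norm_map]
  rw [this]
  exact norm_fderiv_le_of_lipschitzOn ℝ hs hf

theorem grad_bdd {f : E → ℝ} (hf : LocallyLipschitz f) (c : E) (R : ℝ) :
    ∃ L : ℝ, 0 ≤ L ∧ ∀ x ∈ ball c R, ‖∇ f x‖ ≤ L := by
  obtain ⟨L, hL⟩ := ll_lip hf c R
  exact ⟨L, L.2, fun x hx => grad_norm_le hL (mem_of_superset (isOpen_ball.mem_nhds hx)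
    ball_subset_closedBall)⟩

theorem grad_zero_of_min {f : E → ℝ} (hf : ∀ x, 0 ≤ f x) {x : E} (hx : f x = 0) : ∇ f x = 0 := by
  have : IsLocalMin f x := Eventually.of_forall (fun y => by rw [hx]; exact hf y)
  rw [gradient, this.fderiv_eq_zero]; simp

theorem grad_congr_open {f g : E → ℝ} {s : Set E} (hs : IsOpen s) (h : ∀ x ∈ s, f x = g x) {x : E}
    (hx : x ∈ s) : ∇ f x = ∇ g x := by
  apply Filter.EventuallyEq.gradient_eq
  filter_upwards [hs.mem_nhds hx] with y hy using h y hy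

theorem hg_of {f : E → ℝ} {A : E →L[ℝ] ℝ} {f' : E} {x : E} (h : HasFDerivAt f A x)
    (hA : ∀ y, A y = ⟪f', y⟫_ℝ) : HasGradientAt f f' x := by
  have : A = InnerProductSpace.toDual ℝ E f' := by ext y; rw [hA y]; rfl
  rw [this] at h
  exact hasGradientAt_iff_hasFDerivAt.2 h

theorem of_hg {f : E → ℝ} {f' : E} {x : E} (h : HasGradientAt f f' x) :
    HasFDerivAt f (innerSL ℝ f' : E →L[ℝ] ℝ) x := hasGradientAt_iff_hasFDerivAt.1 h

theorem hg_add {f g : E → ℝ} {f' g' : E} {x : E} (hf : HasGradientAt f f' x)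
    (hg : HasGradientAt g g' x) : HasGradientAt (fun y => f y + g y) (f' + g') x :=
  hg_of ((of_hg hf).add (of_hg hg)) (fun y => by simp [inner_add_left])

theorem hg_sub {f g : E → ℝ} {f' g' : E} {x : E} (hf : HasGradientAt f f' x)
    (hg : HasGradientAt g g' x) : HasGradientAt (fun y => f y - g y) (f' - g') x :=
  hg_of ((of_hg hf).sub (of_hg hg)) (fun y => by simp [inner_sub_left])

theorem hg_mul {f g : E → ℝ} {f' g' : E} {x : E} (hf : HasGradientAt f f' x)
    (hg : HasGradientAt g g' x) :
    HasGradientAt (fun y => f y * g y) (f x • g' + g x • f') x :=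
  hg_of ((of_hg hf).mul (of_hg hg)) (fun y => by simp [inner_add_left, inner_smul_left])

theorem hg_cmul {f : E → ℝ} {f' : E} {x : E} (c : ℝ) (hf : HasGradientAt f f' x) :
    HasGradientAt (fun y => c * f y) (c • f') x :=
  hg_of ((of_hg hf).const_mul c) (fun y => by simp [inner_smul_left])

theorem hg_comp {f : E → ℝ} {f' : E} {x : E} {φ : ℝ → ℝ} {φ' : ℝ} (hφ : HasDerivAt φ φ' (f x))
    (hf : HasGradientAt f f' x) : HasGradientAt (fun y => φ (f y)) (φ' • f') x :=
  hg_of (hφ.comp_hasFDerivAt x (of_hg hf)) (fun y => by simp [inner_smul_left])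

theorem hg_normsq' (c x : E) : HasGradientAt (fun y : E => ‖y - c‖ ^ 2) ((2 : ℝ) • (x - c)) x := by
  have h1 : HasFDerivAt (fun y : E => y - c) (ContinuousLinearMap.id ℝ E) x :=
    (hasFDerivAt_id x).sub_const c
  exact hg_of h1.norm_sq
    (fun y => by simp [inner_smul_left, inner_sub_left])

theorem hg_normsq (x : E) : HasGradientAt (fun y : E => ‖y‖ ^ 2) ((2 : ℝ) • x) x := by
  simpa using hg_normsq' 0 x

/-- gradient of a composition with an affine dilation -/
theorem hg_scale {f : E → ℝ} {f' : E} {p : E} {r : ℝ} {x : E} (hf : HasGradientAt f f' (p + r • x)) :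
    HasGradientAt (fun y => f (p + r • y)) (r • f') x := by
  have h1 : HasFDerivAt (fun y : E => p + r • y) (r • ContinuousLinearMap.id ℝ E) x :=
    ((hasFDerivAt_id x).const_smul r).const_add p
  exact hg_of ((of_hg hf).comp x h1) (fun y => by simp [inner_smul_left, inner_smul_right])

variable [MeasureSpace E] [BorelSpace E] [(volume : Measure E).IsAddHaarMeasure]

theorem ae_diff {f : E → ℝ} (hf : LocallyLipschitz f) : ∀ᵐ x : E, DifferentiableAt ℝ f x := by
  have h : ∀ k : ℕ, ∀ᵐ x : E, x ∈ ball (0 : E) k → DifferentiableAt ℝ f x := by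
    intro k
    obtain ⟨L, hL⟩ := ll_lip hf (0 : E) k
    filter_upwards [(hL.mono ball_subset_closedBall).ae_differentiableWithinAt_of_mem
      (μ := (volume : Measure E))] with x hx hxk
    exact (hx hxk).differentiableAt (isOpen_ball.mem_nhds hxk)
  rw [← ae_all_iff] at h
  filter_upwards [h] with x hx
  obtain ⟨k, hk⟩ := exists_nat_gt ‖x‖
  exact hx k (by simpa using hk)

theorem ae_hg {f : E → ℝ} (hf : LocallyLipschitz f) : ∀ᵐ x : E, HasGradientAt f (∇ f x) x := by
  filter_upwards [ae_diff hf] with x hx using hx.hasGradientAt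

theorem meas_grad (f : E → ℝ) : Measurable (∇ f) := by
  have : Measurable (fun x => fderiv ℝ f x) := measurable_fderiv ℝ f
  exact (InnerProductSpace.toDual ℝ E).symm.continuous.measurable.comp this

theorem intB {f : E → ℝ} (hf : Measurable f) {c : E} {R C : ℝ} (h : ∀ x ∈ ball c R, ‖f x‖ ≤ C) :
    IntegrableOn f (ball c R) := by
  refine Measure.integrableOn_of_bounded (M := C) measure_ball_lt_top.ne hf.aestronglyMeasurable ?_
  exact (ae_restrict_iff' measurableSet_ball).2 (Eventually.of_forall h)

theorem ll_bdd {f : E → ℝ} (hf : LocallyLipschitz f) (c : E) (R : ℝ) :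
    ∃ C : ℝ, 0 ≤ C ∧ ∀ x ∈ ball c R, |f x| ≤ C := by
  obtain ⟨C, hC⟩ := (isCompact_closedBall c R).exists_bound_of_continuousOn hf.continuous.continuousOn
  refine ⟨max C 0, le_max_right _ _, fun x hx => (hC x (ball_subset_closedBall hx)).trans (le_max_left _ _)⟩

/-- A general tool: `f` is bounded-measurable on every ball. -/
def LB (f : E → ℝ) : Prop := Measurable f ∧ ∀ (c : E) (R : ℝ), ∃ C : ℝ, ∀ x ∈ ball c R, |f x| ≤ C

theorem LB.int {f : E → ℝ} (hf : LB f) (c : E) (R : ℝ) : IntegrableOn f (ball c R) := by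
  obtain ⟨C, hC⟩ := hf.2 c R
  exact intB hf.1 hC

theorem LB.mul {f g : E → ℝ} (hf : LB f) (hg : LB g) : LB (fun x => f x * g x) := by
  refine ⟨hf.1.mul hg.1, fun c R => ?_⟩
  obtain ⟨C, hC⟩ := hf.2 c R
  obtain ⟨D, hD⟩ := hg.2 c R
  refine ⟨C * D, fun x hx => ?_⟩
  rw [abs_mul]
  exact mul_le_mul (hC x hx) (hD x hx) (abs_nonneg _) ((abs_nonneg _).trans (hC x hx))

theorem LB.add {f g : E → ℝ} (hf : LB f) (hg : LB g) : LB (fun x => f x + g x) := by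
  refine ⟨hf.1.add hg.1, fun c R => ?_⟩
  obtain ⟨C, hC⟩ := hf.2 c R
  obtain ⟨D, hD⟩ := hg.2 c R
  exact ⟨C + D, fun x hx => (abs_add_le _ _).trans (add_le_add (hC x hx) (hD x hx))⟩

theorem LB.sub {f g : E → ℝ} (hf : LB f) (hg : LB g) : LB (fun x => f x - g x) := by
  refine ⟨hf.1.sub hg.1, fun c R => ?_⟩
  obtain ⟨C, hC⟩ := hf.2 c R
  obtain ⟨D, hD⟩ := hg.2 c R
  exact ⟨C + D, fun x hx => (abs_sub _ _).trans (add_le_add (hC x hx) (hD x hx))⟩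

theorem LB.pow {f : E → ℝ} (hf : LB f) (k : ℕ) : LB (fun x => f x ^ k) := by
  refine ⟨hf.1.pow_const k, fun c R => ?_⟩
  obtain ⟨C, hC⟩ := hf.2 c R
  refine ⟨C ^ k, fun x hx => ?_⟩
  rw [abs_pow]; exact pow_le_pow_left₀ (abs_nonneg _) (hC x hx) k

theorem LB.const (a : ℝ) : LB (fun _ : E => a) := ⟨measurable_const, fun _ _ => ⟨|a|, fun _ _ => le_rfl⟩⟩

theorem LB.cont {f : E → ℝ} (hf : Continuous f) : LB f := by
  refine ⟨hf.measurable, fun c R => ?_⟩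
  obtain ⟨C, hC⟩ := (isCompact_closedBall c R).exists_bound_of_continuousOn hf.continuousOn
  exact ⟨C, fun x hx => hC x (ball_subset_closedBall hx)⟩

theorem LB.inner {f g : E → ℝ} (hf : LocallyLipschitz f) (hg : LocallyLipschitz g) :
    LB (fun x => ⟪∇ f x, ∇ g x⟫_ℝ) := by
  refine ⟨(meas_grad f).inner (meas_grad g), fun c R => ?_⟩
  obtain ⟨C, hC0, hC⟩ := grad_bdd hf c R
  obtain ⟨D, hD0, hD⟩ := grad_bdd hg c R
  exact ⟨C * D, fun x hx => (abs_real_inner_le_norm _ _).trans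
    (mul_le_mul (hC x hx) (hD x hx) (norm_nonneg _) hC0)⟩

theorem LB.nsq {f : E → ℝ} (hf : LocallyLipschitz f) : LB (fun x => ‖∇ f x‖ ^ 2) := by
  simpa using LB.inner hf hf

theorem LB.innerx {f : E → ℝ} (hf : LocallyLipschitz f) (p : E) : LB (fun x => ⟪∇ f x, x - p⟫_ℝ) := by
  refine ⟨(meas_grad f).inner (by fun_prop), fun c R => ?_⟩
  obtain ⟨C, hC0, hC⟩ := grad_bdd hf c R
  obtain ⟨D, hD⟩ := (isCompact_closedBall c R).exists_bound_of_continuousOn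
    (f := fun x => x - p) (by fun_prop)
  exact ⟨C * D, fun x hx => (abs_real_inner_le_norm _ _).trans
    (mul_le_mul (hC x hx) (hD x (ball_subset_closedBall hx)) (norm_nonneg _) hC0)⟩

theorem LB.ind {f : E → ℝ} (hf : Continuous f) : LB (fun x => if 0 < f x then (1:ℝ) else 0) := by
  refine ⟨Measurable.ite (isOpen_lt continuous_const hf).measurableSet measurable_const
    measurable_const, fun c R => ⟨1, fun x _ => ?_⟩⟩
  show |if 0 < f x then (1:ℝ) else 0| ≤ 1
  split_ifs <;> simp

/-- energy density -/
noncomputable def q (u : E → ℝ) (x : E) : ℝ := ‖∇ u x‖ ^ 2 + if 0 < u x then 1 else 0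

theorem LB.q {u : E → ℝ} (hu : LocallyLipschitz u) : LB (q u) :=
  (LB.nsq hu).add (LB.ind hu.continuous)

theorem q_nonneg (u : E → ℝ) (x : E) : 0 ≤ q u x := by
  unfold q; split_ifs <;> positivity

/-- real-integral version of minimality -/
def Mz (u : E → ℝ) : Prop :=
  (∀ x, 0 ≤ u x) ∧ LocallyLipschitz u ∧ ∀ v : E → ℝ, (∀ x, 0 ≤ v x) → LocallyLipschitz v →
    ∀ (c : E) (R : ℝ), (∀ x, x ∉ ball c R → v x = u x) →
      ∫ x in ball c R, q u x ≤ ∫ x in ball c R, q v x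

end
end AC

open MeasureTheory Metric Set Filter ENNReal NNReal

set_option linter.all false
namespace AC
open scoped Gradient Topology InnerProductSpace

section
variable {E : Type*} [NormedAddCommGroup E] [InnerProductSpace ℝ E] [FiniteDimensional ℝ E]
variable [MeasureSpace E] [BorelSpace E] [(volume : Measure E).IsAddHaarMeasure]

theorem LB.iadd {f g : E → ℝ} (hf : LB f) (hg : LB g) (c : E) (R : ℝ) :
    ∫ x in ball c R, (f x + g x) = (∫ x in ball c R, f x) + ∫ x in ball c R, g x :=
  integral_add (hf.int c R) (hg.int c R)

theorem LB.isub {f g : E → ℝ} (hf : LB f) (hg : LB g) (c : E) (R : ℝ) :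
    ∫ x in ball c R, (f x - g x) = (∫ x in ball c R, f x) - ∫ x in ball c R, g x :=
  integral_sub (hf.int c R) (hg.int c R)

theorem LB.cmul {f : E → ℝ} (a : ℝ) (hf : LB f) : LB (fun x => a * f x) := (LB.const a).mul hf

theorem LB.mono_ae {f g : E → ℝ} (hf : LB f) (hg : LB g) (c : E) (R : ℝ)
    (h : ∀ᵐ x : E, x ∈ ball c R → f x ≤ g x) :
    (∫ x in ball c R, f x) ≤ ∫ x in ball c R, g x :=
  setIntegral_mono_on_ae (hf.int c R) (hg.int c R) measurableSet_ball h

theorem int_congr {f g : E → ℝ} (c : E) (R : ℝ)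
    (h : ∀ᵐ x : E, x ∈ ball c R → f x = g x) :
    (∫ x in ball c R, f x) = ∫ x in ball c R, g x :=
  setIntegral_congr_ae measurableSet_ball h

theorem ae_scale {P : E → Prop} (h : ∀ᵐ x : E, P x) (p : E) {r : ℝ} (hr : r ≠ 0) :
    ∀ᵐ y : E, P (p + r • y) := by
  have h1 : ∀ᵐ x : E, P (p + x) :=
    (measurePreserving_add_left (volume : Measure E) p).quasiMeasurePreserving.ae h
  have h2 : Measure.QuasiMeasurePreserving (fun y : E => r • y) (volume : Measure E) volume := by
    refine ⟨by fun_prop, ?_⟩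
    rw [Measure.map_addHaar_smul _ hr]
    exact Measure.smul_absolutelyContinuous
  exact h2.ae h1

theorem int_scale (g : E → ℝ) (p c : E) {r : ℝ} (hr : 0 < r) (R : ℝ) :
    ∫ x in ball (p + r • c) (r * R), g x
      = r ^ (Module.finrank ℝ E) * ∫ y in ball c R, g (p + r • y) := by
  rw [← integral_indicator measurableSet_ball, ← integral_indicator measurableSet_ball]
  rw [← integral_add_left_eq_self _ p]
  have h := Measure.integral_comp_smul (volume : Measure E)
    (fun x => (ball (p + r • c) (r * R)).indicator g (p + x)) r
  have h3 : ∀ y : E, (ball (p + r • c) (r * R)).indicator g (p + r • y)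
      = (ball c R).indicator (fun y => g (p + r • y)) y := by
    intro y
    have : p + r • y ∈ ball (p + r • c) (r * R) ↔ y ∈ ball c R := by
      rw [mem_ball, mem_ball, dist_add_left, dist_smul₀, Real.norm_of_nonneg hr.le]
      exact mul_lt_mul_iff_right₀ hr
    by_cases hy : y ∈ ball c R
    · rw [indicator_of_mem hy, indicator_of_mem (this.2 hy)]
    · rw [indicator_of_notMem hy, indicator_of_notMem (fun h => hy (this.1 h))]
  simp only [h3] at h
  rw [h, abs_of_pos (by positivity), smul_eq_mul, ← mul_assoc, mul_inv_cancel₀ (by positivity), one_mul]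

theorem int_scale1 (g : E → ℝ) (p : E) {r : ℝ} (hr : 0 < r) :
    ∫ x in ball p r, g x
      = r ^ (Module.finrank ℝ E) * ∫ y in ball (0:E) 1, g (p + r • y) := by
  have := int_scale g p 0 hr 1
  simpa using this

theorem ll_scale {u : E → ℝ} (hu : LocallyLipschitz u) (p : E) (r a : ℝ) :
    LocallyLipschitz (fun x => a * u (p + r • x)) := by
  apply ll_cmul
  have : LocallyLipschitz (fun x : E => p + r • x) :=
    ContDiff.locallyLipschitz (𝕂 := ℝ) (by fun_prop)
  exact hu.comp this

theorem grad_scale {u : E → ℝ} (hu : LocallyLipschitz u) (p : E) {r : ℝ} (hr : r ≠ 0) :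
    ∀ᵐ x : E, HasGradientAt (fun x => r⁻¹ * u (p + r • x)) (∇ u (p + r • x)) x := by
  filter_upwards [ae_scale (ae_hg hu) p hr] with x hx
  have := hg_cmul r⁻¹ (hg_scale hx)
  rwa [smul_smul, inv_mul_cancel₀ hr, one_smul] at this

theorem q_scale {u : E → ℝ} (hu : LocallyLipschitz u) (p : E) {r : ℝ} (hr : 0 < r) :
    ∀ᵐ x : E, q (fun x => r⁻¹ * u (p + r • x)) x = q u (p + r • x) := by
  filter_upwards [grad_scale hu p hr.ne'] with x hx
  have : (0 < r⁻¹ * u (p + r • x)) ↔ 0 < u (p + r • x) := mul_pos_iff_of_pos_left (inv_pos.2 hr)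
  simp only [q, hx.gradient, this]

theorem Mz.scale {u : E → ℝ} (hu : Mz u) (p : E) {r : ℝ} (hr : 0 < r) :
    Mz (fun x => r⁻¹ * u (p + r • x)) := by
  refine ⟨fun x => mul_nonneg (inv_nonneg.2 hr.le) (hu.1 _), ll_scale hu.2.1 p r _, ?_⟩
  intro v hv0 hv c R hvu
  set w : E → ℝ := fun x => r * v (-(r⁻¹ • p) + r⁻¹ • x) with hw
  have hwl : LocallyLipschitz w := ll_scale hv _ _ _
  have hwv : ∀ x, w (p + r • x) = r * v x := by
    intro x
    simp only [hw]
    congr 2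
    rw [smul_add, smul_smul, inv_mul_cancel₀ hr.ne', one_smul]; abel
  have key := hu.2.2 w (fun x => mul_nonneg hr.le (hv0 _)) hwl (p + r • c) (r * R) (by
    intro x hx
    obtain ⟨y, rfl⟩ : ∃ y, x = p + r • y := ⟨r⁻¹ • (x - p), by
      rw [smul_smul, mul_inv_cancel₀ hr.ne', one_smul]; abel⟩
    rw [hwv, hvu y, ← mul_assoc, mul_inv_cancel₀ hr.ne', one_mul]
    intro hy
    apply hx
    rw [mem_ball, dist_add_left, dist_smul₀, Real.norm_of_nonneg hr.le]
    exact mul_lt_mul_of_pos_left hy hr)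
  rw [int_scale _ _ _ hr, int_scale _ _ _ hr] at key
  have key := le_of_mul_le_mul_left key (by positivity)
  have e1 : ∫ y in ball c R, q u (p + r • y) = ∫ y in ball c R, q (fun x => r⁻¹ * u (p + r • x)) y :=
    integral_congr_ae (ae_restrict_of_ae (by
      filter_upwards [q_scale hu.2.1 p hr] with x hx using hx.symm))
  have e2 : ∫ y in ball c R, q w (p + r • y) = ∫ y in ball c R, q v y :=
    integral_congr_ae (ae_restrict_of_ae (by
      filter_upwards [q_scale hwl p hr] with x hx
      rw [← hx]
      congr 1
      ext y; rw [hwv, ← mul_assoc, inv_mul_cancel₀ hr.ne', one_mul]))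
  rwa [e1, e2] at key

/-- comparison lemma -/
theorem Mz.var {u φ v : E → ℝ} (hu : Mz u) (hφ : LocallyLipschitz φ) (hv0 : ∀ x, 0 ≤ v x)
    (hv : LocallyLipschitz v) (c : E) (R s : ℝ) (hvu : ∀ x, x ∉ ball c R → v x = u x)
    (hq : ∀ᵐ x : E, q v x ≤ ‖∇ u x + s • ∇ φ x‖ ^ 2 + if 0 < u x then 1 else 0) :
    0 ≤ 2 * s * (∫ x in ball c R, ⟪∇ u x, ∇ φ x⟫_ℝ) + s ^ 2 * ∫ x in ball c R, ‖∇ φ x‖ ^ 2 := by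
  have h1 := hu.2.2 v hv0 hv c R hvu
  have i1 := (LB.q hu.2.1)
  have i2 := (LB.inner hu.2.1 hφ).cmul (2 * s)
  have i3 := (LB.nsq hφ).cmul (s ^ 2)
  have h2 : ∫ x in ball c R, q v x ≤
      ∫ x in ball c R, (q u x + 2 * s * ⟪∇ u x, ∇ φ x⟫_ℝ + s ^ 2 * ‖∇ φ x‖ ^ 2) := by
    refine LB.mono_ae (LB.q hv) ((i1.add i2).add i3) c R ?_
    filter_upwards [hq] with x hx _
    refine hx.trans (le_of_eq ?_)
    rw [norm_add_sq_real, inner_smul_right, norm_smul, mul_pow, Real.norm_eq_abs, sq_abs]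
    simp only [q]; ring
  rw [LB.iadd (i1.add i2) i3, LB.iadd i1 i2, integral_const_mul, integral_const_mul] at h2
  linarith

theorem quad_le {a b : ℝ} {s0 : ℝ} (hs0 : 0 < s0)
    (h : ∀ s, 0 < s → s < s0 → 0 ≤ 2 * s * a + s ^ 2 * b) : 0 ≤ a := by
  have h1 : ∀ᶠ s in 𝓝[>] (0:ℝ), 0 ≤ 2 * a + s * b := by
    filter_upwards [Ioo_mem_nhdsGT hs0] with s hs
    have := h s hs.1 hs.2
    have h2 : 0 ≤ s * (2 * a + s * b) := by nlinarith
    exact nonneg_of_mul_nonneg_right h2 hs.1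
  have h2 : Tendsto (fun s : ℝ => 2 * a + s * b) (𝓝[>] 0) (𝓝 (2 * a + 0 * b)) :=
    ((by fun_prop : Continuous (fun s : ℝ => 2 * a + s * b)).tendsto 0).mono_left nhdsWithin_le_nhds
  have := ge_of_tendsto h2 h1
  linarith

theorem F1 {u φ : E → ℝ} (hu : Mz u) (hφ : LocallyLipschitz φ) (hφ0 : ∀ x, 0 ≤ φ x) (c : E) (R : ℝ)
    (hs : ∀ x, x ∉ ball c R → φ x = 0) : ∫ x in ball c R, ⟪∇ u x, ∇ φ x⟫_ℝ ≤ 0 := by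
  have : 0 ≤ - ∫ x in ball c R, ⟪∇ u x, ∇ φ x⟫_ℝ := by
    refine quad_le (b := ∫ x in ball c R, ‖∇ φ x‖ ^ 2) one_pos (fun s hs0 _ => ?_)
    have hl : LocallyLipschitz (fun x => u x + (-s) * φ x) := ll_add hu.2.1 (ll_cmul _ hφ)
    have hvl : LocallyLipschitz (fun x => max (u x + (-s) * φ x) 0) :=
      ll_max hl (LocallyLipschitz.const 0)
    have := hu.var (φ := φ) (v := fun x => max (u x + (-s) * φ x) 0) hφ
      (fun x => le_max_right _ _) hvl c R (-s) (fun x hx => by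
        simp [hs x hx, hu.1 x]) (by
      filter_upwards [ae_hg hu.2.1, ae_hg hφ] with x h1 h2
      by_cases hx : 0 < u x + (-s) * φ x
      · have hg : ∇ (fun x => max (u x + (-s) * φ x) 0) x = ∇ u x + (-s) • ∇ φ x := by
          rw [← (hg_add h1 (hg_cmul (-s) h2)).gradient]
          refine grad_congr_open (isOpen_lt continuous_const hl.continuous) ?_ hx
          intro y hy; exact max_eq_left (le_of_lt hy)
        have hux : 0 < u x := by nlinarith [mul_nonneg hs0.le (hφ0 x)]
        simp only [q, hg, hux, if_true]
        gcongr; split_ifs <;> norm_num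
      · have hz : max (u x + (-s) * φ x) 0 = 0 := max_eq_right (not_lt.1 hx)
        have hg := grad_zero_of_min (f := fun x => max (u x + (-s) * φ x) 0)
          (fun x => le_max_right _ _) hz
        simp only [q, hg, hz]
        simp
        split_ifs <;> positivity)
    linarith [this]
  linarith

theorem F2a {u φ : E → ℝ} (hu : Mz u) (hφ : LocallyLipschitz φ) (c : E) (R : ℝ)
    (hs : ∀ x, x ∉ ball c R → φ x = 0) {C : ℝ} (hC : ∀ x, |φ x| ≤ C * u x) :
    0 ≤ ∫ x in ball c R, ⟪∇ u x, ∇ φ x⟫_ℝ := by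
  refine quad_le (b := ∫ x in ball c R, ‖∇ φ x‖ ^ 2) (s0 := (|C| + 1)⁻¹) (by positivity)
    (fun s hs0 hs1 => ?_)
  have hl : LocallyLipschitz (fun x => u x + s * φ x) := ll_add hu.2.1 (ll_cmul _ hφ)
  have hsC : s * |C| ≤ 1 := by
    rw [lt_inv_comm₀ hs0 (by positivity), ← one_div, lt_div_iff₀ hs0] at hs1
    nlinarith
  have h0 : ∀ x, 0 ≤ u x + s * φ x := by
    intro x
    have h1 := neg_le_of_abs_le (hC x)
    have h2 : C * u x ≤ |C| * u x := mul_le_mul_of_nonneg_right (le_abs_self _) (hu.1 x)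
    have h3 : s * (|C| * u x) ≤ 1 * u x := by
      rw [← mul_assoc]; exact mul_le_mul_of_nonneg_right hsC (hu.1 x)
    have h4 : s * (-(|C| * u x)) ≤ s * φ x := mul_le_mul_of_nonneg_left (by linarith) hs0.le
    linarith
  refine hu.var (φ := φ) (v := fun x => u x + s * φ x) hφ h0 hl c R s (fun x hx => by
        simp [hs x hx]) ?_
  filter_upwards [ae_hg hu.2.1, ae_hg hφ] with x h1 h2
  simp only [q, (hg_add h1 (hg_cmul s h2)).gradient]
  gcongr
  by_cases hux : 0 < u x
  · simp only [hux, if_true]; split_ifs <;> norm_num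
  · have h5 : u x = 0 := le_antisymm (not_lt.1 hux) (hu.1 x)
    have h6 : φ x = 0 := by
      have := hC x; rw [h5, mul_zero] at this; exact abs_nonpos_iff.1 this
    simp [h5, h6]

theorem F2 {u φ : E → ℝ} (hu : Mz u) (hφ : LocallyLipschitz φ) (c : E) (R : ℝ)
    (hs : ∀ x, x ∉ ball c R → φ x = 0) {C : ℝ} (hC : ∀ x, |φ x| ≤ C * u x) :
    ∫ x in ball c R, ⟪∇ u x, ∇ φ x⟫_ℝ = 0 := by
  refine le_antisymm ?_ (F2a hu hφ c R hs hC)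
  have h := F2a hu (φ := fun x => (-1) * φ x) (ll_cmul (-1) hφ) c R (fun x hx => by simp [hs x hx])
    (C := C) (fun x => by simpa using hC x)
  have e : ∫ x in ball c R, ⟪∇ u x, ∇ (fun x => (-1) * φ x) x⟫_ℝ
      = ∫ x in ball c R, - ⟪∇ u x, ∇ φ x⟫_ℝ := by
    refine integral_congr_ae (ae_restrict_of_ae ?_)
    filter_upwards [ae_hg hφ] with x h2
    rw [(hg_cmul (-1) h2).gradient, inner_smul_right]; ring
  rw [e, integral_neg] at h
  linarith

theorem F3 {u φ : E → ℝ} (hu : Mz u) (hnull : ∀ᵐ x : E, 0 < u x) (hφ : LocallyLipschitz φ)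
    (hφ0 : ∀ x, 0 ≤ φ x) (c : E) (R : ℝ)
    (hs : ∀ x, x ∉ ball c R → φ x = 0) : 0 ≤ ∫ x in ball c R, ⟪∇ u x, ∇ φ x⟫_ℝ := by
  refine quad_le (b := ∫ x in ball c R, ‖∇ φ x‖ ^ 2) one_pos (fun s hs0 hs1 => ?_)
  have hl : LocallyLipschitz (fun x => u x + s * φ x) := ll_add hu.2.1 (ll_cmul _ hφ)
  refine hu.var (φ := φ) (v := fun x => u x + s * φ x) hφ
    (fun x => add_nonneg (hu.1 x) (mul_nonneg hs0.le (hφ0 x))) hl c R s (fun x hx => by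
        simp [hs x hx]) ?_
  filter_upwards [ae_hg hu.2.1, ae_hg hφ, hnull] with x h1 h2 hux
  simp only [q, (hg_add h1 (hg_cmul s h2)).gradient]
  gcongr
  simp only [hux, if_true]; split_ifs <;> norm_num

end
end AC

open MeasureTheory Metric Set Filter ENNReal NNReal

set_option linter.all false
namespace AC
open scoped Gradient Topology InnerProductSpace

section
variable {E : Type*} [NormedAddCommGroup E] [InnerProductSpace ℝ E] [FiniteDimensional ℝ E]
variable [MeasureSpace E] [BorelSpace E] [(volume : Measure E).IsAddHaarMeasure]

theorem norm_lt_one_of_mem {y : E} (hy : y ∈ ball (0:E) 1) : ‖y‖ < 1 := by simpa using hy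

theorem mem_ball_scale {p y : E} {r : ℝ} (hr : 0 < r) (hy : y ∈ ball (0:E) 1) :
    p + r • y ∈ ball p r := by
  have := norm_lt_one_of_mem hy
  rw [mem_ball, dist_eq_norm, add_sub_cancel_left, norm_smul, Real.norm_of_nonneg hr.le]
  nlinarith

theorem LB.scale {f : E → ℝ} (hf : LB f) (p : E) (r : ℝ) : LB (fun y => f (p + r • y)) := by
  refine ⟨hf.1.comp (by fun_prop), fun c R => ?_⟩
  obtain ⟨C, hC⟩ := hf.2 p (|r| * (‖c‖ + |R|) + 1)
  refine ⟨C, fun x hx => hC _ ?_⟩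
  rw [mem_ball, dist_eq_norm, add_sub_cancel_left, norm_smul, Real.norm_eq_abs]
  rw [mem_ball, dist_eq_norm] at hx
  have h1 : ‖x‖ ≤ ‖c‖ + |R| := by
    have := norm_add_le (x - c) c
    rw [sub_add_cancel] at this
    linarith [le_abs_self R]
  have := mul_le_mul_of_nonneg_left h1 (abs_nonneg r)
  linarith

theorem LB.gx {f : E → ℝ} (hf : LocallyLipschitz f) (p : E) (r : ℝ) :
    LB (fun y => ⟪∇ f (p + r • y), y⟫_ℝ) := by
  refine ⟨((meas_grad f).comp (by fun_prop : Measurable fun y : E => p + r • y)).inner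
    measurable_id, fun c R => ?_⟩
  obtain ⟨C, hC0, hC⟩ := grad_bdd hf p (|r| * (‖c‖ + |R|) + 1)
  refine ⟨C * (‖c‖ + |R|), fun x hx => ?_⟩
  rw [mem_ball, dist_eq_norm] at hx
  have h1 : ‖x‖ ≤ ‖c‖ + |R| := by
    have := norm_add_le (x - c) c
    rw [sub_add_cancel] at this
    linarith [le_abs_self R]
  refine (abs_real_inner_le_norm _ _).trans (mul_le_mul (hC _ ?_) h1 (norm_nonneg _) hC0)
  rw [mem_ball, dist_eq_norm, add_sub_cancel_left, norm_smul, Real.norm_eq_abs]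
  have := mul_le_mul_of_nonneg_left h1 (abs_nonneg r)
  linarith

theorem HD {f k : E → ℝ} (hf : LocallyLipschitz f) (hk : LB k) (p : E) {r : ℝ} (hr : r ≠ 0) :
    HasDerivAt (fun r => ∫ y in ball (0:E) 1, k y * f (p + r • y))
      (∫ y in ball (0:E) 1, k y * ⟪∇ f (p + r • y), y⟫_ℝ) r := by
  obtain ⟨L, hL⟩ := ll_lip hf p (|r| + 1)
  have hLB : ∀ s, LB (fun y => k y * f (p + s • y)) := fun s =>
    hk.mul ((LB.cont hf.continuous).scale p s)
  refine (hasDerivAt_integral_of_dominated_loc_of_lip (μ := volume.restrict (ball (0:E) 1))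
    (F := fun s y => k y * f (p + s • y)) (F' := fun y => k y * ⟪∇ f (p + r • y), y⟫_ℝ)
    (bound := fun y => |k y| * L) (s := ball r 1) (ball_mem_nhds r one_pos)
    (Eventually.of_forall fun s => (hLB s).1.aestronglyMeasurable) ((hLB r).int 0 1)
    (hk.mul (LB.gx hf p r)).1.aestronglyMeasurable ?_ ?_ ?_).2
  · rw [ae_restrict_iff' measurableSet_ball]
    refine Eventually.of_forall fun y hy => ?_
    have hy1 := norm_lt_one_of_mem hy
    have hm : ∀ s ∈ ball r 1, p + s • y ∈ closedBall p (|r| + 1) := by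
      intro s hs
      rw [mem_ball, Real.dist_eq] at hs
      rw [mem_closedBall, dist_eq_norm, add_sub_cancel_left, norm_smul, Real.norm_eq_abs]
      have : |s| ≤ |r| + 1 := by
        have := abs_add_le (s - r) r
        rw [sub_add_cancel] at this; linarith
      nlinarith [abs_nonneg s, norm_nonneg y]
    refine LipschitzOnWith.of_dist_le_mul fun s hs t ht => ?_
    have h1 := hL.dist_le_mul _ (hm s hs) _ (hm t ht)
    rw [dist_add_left, dist_eq_norm (s • y), ← sub_smul, norm_smul] at h1
    rw [Real.dist_eq, ← mul_sub, abs_mul, ← Real.dist_eq, Real.coe_nnabs, abs_mul, abs_abs, mul_assoc]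
    refine mul_le_mul_of_nonneg_left ?_ (abs_nonneg _)
    refine h1.trans ?_
    rw [Real.dist_eq, ← Real.norm_eq_abs (s - t), NNReal.abs_eq]
    refine mul_le_mul_of_nonneg_left ?_ L.2
    nlinarith [norm_nonneg (s - t), norm_nonneg y]
  · obtain ⟨C, hC⟩ := hk.2 0 1
    refine intB (C := C * L) (by have := hk.1; fun_prop) (fun x hx => ?_)
    rw [Real.norm_eq_abs, abs_mul, abs_abs, NNReal.abs_eq]
    exact mul_le_mul_of_nonneg_right (hC x hx) L.2
  · refine ae_restrict_of_ae ?_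
    filter_upwards [ae_scale (ae_hg hf) p hr] with y hy
    have h1 : HasDerivAt (fun s : ℝ => p + s • y) y r := by
      simpa using ((hasDerivAt_id r).smul_const y).const_add p
    have h2 := (of_hg hy).comp_hasDerivAt r h1
    have := h2.const_mul (k y)
    simpa using this

theorem HC {f k : E → ℝ} (hf : Continuous f) (hk : LB k) (p : E) :
    Continuous (fun r : ℝ => ∫ y in ball (0:E) 1, k y * f (p + r • y)) := by
  rw [continuous_iff_continuousAt]
  intro r
  obtain ⟨C, hC⟩ := (LB.cont hf).2 p (|r| + 2)
  obtain ⟨D, hD⟩ := hk.2 0 1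
  refine continuousAt_of_dominated (bound := fun _ => D * C) ?_ ?_ ?_ ?_
  · exact Eventually.of_forall fun s =>
      (hk.mul ((LB.cont hf).scale p s)).1.aestronglyMeasurable
  · filter_upwards [ball_mem_nhds r one_pos] with s hs
    rw [ae_restrict_iff' measurableSet_ball]
    refine Eventually.of_forall fun y hy => ?_
    have hy1 := norm_lt_one_of_mem hy
    rw [mem_ball, Real.dist_eq] at hs
    rw [Real.norm_eq_abs, abs_mul]
    refine mul_le_mul (hD y hy) (hC _ ?_) (abs_nonneg _) ((abs_nonneg _).trans (hD y hy))
    rw [mem_ball, dist_eq_norm, add_sub_cancel_left, norm_smul, Real.norm_eq_abs]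
    have : |s| ≤ |r| + 1 := by
      have := abs_add_le (s - r) r
      rw [sub_add_cancel] at this; linarith
    nlinarith [abs_nonneg s, norm_nonneg y]
  · exact (LB.const (E := E) (D * C)).int 0 1
  · refine Eventually.of_forall fun y => ?_
    have : Continuous fun s : ℝ => k y * f (p + s • y) := by fun_prop
    exact this.continuousAt

/-- volume of the unit ball -/
noncomputable def bv (E : Type*) [NormedAddCommGroup E] [MeasureSpace E] : ℝ :=
  (volume : Measure E).real (ball (0:E) 1)

theorem bv_pos : 0 < bv E := by
  unfold bv
  rw [Measure.real, ENNReal.toReal_pos_iff]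
  exact ⟨measure_ball_pos _ _ one_pos, measure_ball_lt_top⟩

theorem MV_le {f : E → ℝ} (hf : LocallyLipschitz f) (p : E) {R : ℝ} (hR : 0 ≤ R)
    (h : ∀ r, 0 < r → r < R → 0 ≤ ∫ y in ball (0:E) 1, ⟪∇ f (p + r • y), y⟫_ℝ) :
    bv E * f p ≤ ∫ y in ball (0:E) 1, f (p + R • y) := by
  have hm : MonotoneOn (fun r : ℝ => ∫ y in ball (0:E) 1, (1:ℝ) * f (p + r • y)) (Icc 0 R) := by
    refine monotoneOn_of_deriv_nonneg (convex_Icc 0 R)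
      (HC hf.continuous (LB.const 1) p).continuousOn ?_ ?_
    · intro r hr
      rw [interior_Icc] at hr
      exact (HD hf (LB.const 1) p hr.1.ne').differentiableAt.differentiableWithinAt
    · intro r hr
      rw [interior_Icc] at hr
      rw [(HD hf (LB.const 1) p hr.1.ne').deriv]
      simpa using h r hr.1 hr.2
  have := hm (left_mem_Icc.2 hR) (right_mem_Icc.2 hR) hR
  simpa [bv] using this

theorem grad_neg_ae {f : E → ℝ} (hf : LocallyLipschitz f) :
    ∀ᵐ x, ∇ (fun x => (-1) * f x) x = - ∇ f x := by
  filter_upwards [ae_hg hf] with x hx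
  rw [(hg_cmul (-1) hx).gradient]; simp

theorem MV_ge {f : E → ℝ} (hf : LocallyLipschitz f) (p : E) {R : ℝ} (hR : 0 ≤ R)
    (h : ∀ r, 0 < r → r < R → ∫ y in ball (0:E) 1, ⟪∇ f (p + r • y), y⟫_ℝ ≤ 0) :
    ∫ y in ball (0:E) 1, f (p + R • y) ≤ bv E * f p := by
  have := MV_le (ll_cmul (-1) hf) p hR (fun r hr0 hrR => by
    have e : ∫ y in ball (0:E) 1, ⟪∇ (fun x => (-1) * f x) (p + r • y), y⟫_ℝ
        = - ∫ y in ball (0:E) 1, ⟪∇ f (p + r • y), y⟫_ℝ := by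
      rw [← integral_neg]
      refine int_congr _ _ ?_
      filter_upwards [ae_scale (grad_neg_ae hf) p hr0.ne'] with y hy _
      rw [hy, inner_neg_left]
    rw [e]; linarith [h r hr0 hrR])
  rw [integral_const_mul] at this
  linarith

noncomputable def bump (p : E) (r : ℝ) (x : E) : ℝ := max (r ^ 2 - ‖x - p‖ ^ 2) 0

theorem bump_ll (p : E) (r : ℝ) : LocallyLipschitz (bump p r) :=
  ll_max (ll_cd (contDiff_const.sub ((contDiff_id.sub contDiff_const).norm_sq ℝ))) (LocallyLipschitz.const 0)

theorem bump_nonneg (p : E) (r : ℝ) (x : E) : 0 ≤ bump p r x := le_max_right _ _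

theorem bump_out (p : E) (r : ℝ) (x : E) (hx : x ∉ ball p r) (hr : 0 < r) : bump p r x = 0 := by
  rw [mem_ball, dist_eq_norm, not_lt] at hx
  exact max_eq_right (by nlinarith)

theorem bump_in (p : E) (r : ℝ) (x : E) (hx : x ∈ ball p r) : bump p r x = r ^ 2 - ‖x - p‖ ^ 2 := by
  rw [mem_ball, dist_eq_norm] at hx
  exact max_eq_left (by nlinarith [norm_nonneg (x - p)])

theorem bump_le (p : E) (r : ℝ) (x : E) : bump p r x ≤ r ^ 2 :=
  max_le (by nlinarith [sq_nonneg ‖x - p‖]) (sq_nonneg _)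

theorem bump_hg (p : E) (r : ℝ) (x : E) (hx : x ∈ ball p r) :
    HasGradientAt (bump p r) ((-2 : ℝ) • (x - p)) x := by
  have h1 : HasGradientAt (fun y : E => r ^ 2 - ‖y - p‖ ^ 2) ((-2 : ℝ) • (x - p)) x := by
    have := hg_sub (hasGradientAt_const x (r ^ 2)) (hg_normsq' p x)
    simpa using this
  refine HasGradientAt.congr_of_eventuallyEq h1 ?_
  filter_upwards [isOpen_ball.mem_nhds hx] with y hy using bump_in p r y hy

theorem bump_int (f : E → ℝ) (p : E) {r : ℝ} (hr : 0 < r) :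
    ∫ x in ball p r, ⟪∇ f x, ∇ (bump p r) x⟫_ℝ
      = - (2 * r ^ (Module.finrank ℝ E + 1)) * ∫ y in ball (0:E) 1, ⟪∇ f (p + r • y), y⟫_ℝ := by
  have : ∫ x in ball p r, ⟪∇ f x, ∇ (bump p r) x⟫_ℝ = ∫ x in ball p r, -2 * ⟪∇ f x, x - p⟫_ℝ := by
    refine int_congr _ _ (Eventually.of_forall fun x hx => ?_)
    rw [(bump_hg p r x hx).gradient, inner_smul_right]
  rw [this, int_scale1 _ p hr]
  have e : ∀ y : E, -2 * ⟪∇ f (p + r • y), p + r • y - p⟫_ℝ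
      = (-2 * r) * ⟪∇ f (p + r • y), y⟫_ℝ := by
    intro y; rw [add_sub_cancel_left, inner_smul_right]; ring
  simp only [e]
  rw [integral_const_mul]; ring

theorem Mz.mv_sub {u : E → ℝ} (hu : Mz u) (p : E) {R : ℝ} (hR : 0 ≤ R) :
    bv E * u p ≤ ∫ y in ball (0:E) 1, u (p + R • y) := by
  refine MV_le hu.2.1 p hR (fun r hr _ => ?_)
  have h := F1 hu (bump_ll p r) (bump_nonneg p r) p r (fun x hx => bump_out p r x hx hr)
  rw [bump_int u p hr] at h
  have h3 : 0 < 2 * r ^ (Module.finrank ℝ E + 1) := by positivity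
  by_contra hc
  nlinarith [not_le.1 hc]

/-- super mean value, from nonnegativity against bumps -/
theorem mv_sup {f : E → ℝ} (hf : LocallyLipschitz f) (p : E) {R : ℝ} (hR : 0 ≤ R)
    (h : ∀ r, 0 < r → r < R → 0 ≤ ∫ x in ball p r, ⟪∇ f x, ∇ (bump p r) x⟫_ℝ) :
    ∫ y in ball (0:E) 1, f (p + R • y) ≤ bv E * f p := by
  refine MV_ge hf p hR (fun r hr hrR => ?_)
  have h := h r hr hrR
  rw [bump_int f p hr] at h
  have h3 : 0 < 2 * r ^ (Module.finrank ℝ E + 1) := by positivity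
  by_contra hc
  nlinarith [not_le.1 hc]

theorem bump_le_of_pos {u : E → ℝ} (hu : Continuous u) (h0 : ∀ x, 0 ≤ u x) (p : E) {r : ℝ}
    (hr : 0 < r) (hpos : ∀ x ∈ closedBall p r, 0 < u x) :
    ∃ C : ℝ, ∀ x, |bump p r x| ≤ C * u x := by
  obtain ⟨x0, hx0, hmin⟩ := (isCompact_closedBall p r).exists_isMinOn ⟨p, by simp [hr.le]⟩
    hu.continuousOn
  have hm := hpos x0 hx0
  refine ⟨r ^ 2 / u x0, fun x => ?_⟩
  rw [abs_of_nonneg (bump_nonneg p r x)]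
  by_cases hx : x ∈ ball p r
  · have h1 : u x0 ≤ u x := hmin (ball_subset_closedBall hx)
    refine (bump_le p r x).trans ?_
    rw [div_mul_eq_mul_div, le_div_iff₀ hm]
    exact mul_le_mul_of_nonneg_left h1 (sq_nonneg r)
  · rw [bump_out p r x hx hr]
    exact mul_nonneg (by positivity) (h0 x)

theorem Mz.mv_eq {u : E → ℝ} (hu : Mz u) (p : E) {R : ℝ} (hR : 0 ≤ R)
    (hpos : ∀ x ∈ ball p R, 0 < u x) :
    ∫ y in ball (0:E) 1, u (p + R • y) = bv E * u p := by
  refine le_antisymm (mv_sup hu.2.1 p hR (fun r hr hrR => ?_)) (hu.mv_sub p hR)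
  obtain ⟨C, hC⟩ := bump_le_of_pos hu.2.1.continuous hu.1 p hr
    (fun x hx => hpos x (closedBall_subset_ball hrR hx))
  rw [F2 hu (bump_ll p r) p r (fun x hx => bump_out p r x hx hr) hC]

theorem zero_of_int {f : E → ℝ} (hf : Continuous f) {c : E} {R : ℝ} (h0 : ∀ x ∈ ball c R, 0 ≤ f x)
    (h : ∫ x in ball c R, f x ≤ 0) : ∀ x ∈ ball c R, f x = 0 := by
  have h1 : ∫ x in ball c R, f x = 0 := le_antisymm h (setIntegral_nonneg measurableSet_ball h0)
  rw [setIntegral_eq_zero_iff_of_nonneg_ae ((ae_restrict_iff' measurableSet_ball).2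
    (Eventually.of_forall h0)) ((LB.cont hf).int c R)] at h1
  exact Measure.eqOn_open_of_ae_eq h1 isOpen_ball hf.continuousOn continuousOn_const

theorem zero_of_int1 {f : E → ℝ} (hf : Continuous f) {p : E} {R : ℝ} (hR : 0 < R)
    (h0 : ∀ x, 0 ≤ f x)
    (h : ∫ y in ball (0:E) 1, f (p + R • y) ≤ 0) : ∀ x ∈ ball p R, f x = 0 := by
  refine zero_of_int hf (fun x _ => h0 x) ?_
  rw [int_scale1 _ p hR]
  exact mul_nonpos_of_nonneg_of_nonpos (by positivity) h

theorem Mz.pos_of_ae {u : E → ℝ} (hu : Mz u) (hnull : ∀ᵐ x : E, 0 < u x) (p : E) : 0 < u p := by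
  by_contra hp
  have hp0 : u p = 0 := le_antisymm (not_lt.1 hp) (hu.1 p)
  have h1 := mv_sup hu.2.1 p zero_le_one (fun r hr _ =>
    F3 hu hnull (bump_ll p r) (bump_nonneg p r) p r (fun x hx => bump_out p r x hx hr))
  rw [hp0, mul_zero] at h1
  have h2 := zero_of_int1 hu.2.1.continuous one_pos hu.1 h1
  have h3 : volume (ball p 1) = 0 := by
    refine measure_mono_null (fun x hx => ?_) hnull
    simp [h2 x hx]
  exact (measure_ball_pos volume p one_pos).ne' h3

end
end AC

open MeasureTheory Metric Set Filter ENNReal NNReal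

set_option linter.all false
namespace AC
open scoped Gradient Topology InnerProductSpace

section
variable {E : Type*} [NormedAddCommGroup E] [InnerProductSpace ℝ E] [FiniteDimensional ℝ E]
variable [MeasureSpace E] [BorelSpace E] [(volume : Measure E).IsAddHaarMeasure]

/-- first-order expansion, uniformly on `t ∈ [0,1]`, `|s| ≤ 1` -/
def T1 (f : ℝ → ℝ → ℝ) (f0 f1 : ℝ → ℝ) : Prop :=
  ∃ C : ℝ, 0 ≤ C ∧ ∀ t, 0 ≤ t → t ≤ 1 → |f0 t| ≤ C ∧ |f1 t| ≤ C ∧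
    ∀ s, |s| ≤ 1 → |f s t - f0 t - s * f1 t| ≤ C * s ^ 2

theorem T1.add {f g : ℝ → ℝ → ℝ} {f0 f1 g0 g1 : ℝ → ℝ} (hf : T1 f f0 f1) (hg : T1 g g0 g1) :
    T1 (fun s t => f s t + g s t) (fun t => f0 t + g0 t) (fun t => f1 t + g1 t) := by
  obtain ⟨C, hC0, hC⟩ := hf
  obtain ⟨D, hD0, hD⟩ := hg
  refine ⟨C + D, by positivity, fun t h0 h1 => ?_⟩
  obtain ⟨a1, a2, a3⟩ := hC t h0 h1
  obtain ⟨b1, b2, b3⟩ := hD t h0 h1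
  refine ⟨(abs_add_le _ _).trans (by linarith), (abs_add_le _ _).trans (by linarith), fun s hs => ?_⟩
  have e : f s t + g s t - (f0 t + g0 t) - s * (f1 t + g1 t) =
    (f s t - f0 t - s * f1 t) + (g s t - g0 t - s * g1 t) := by ring
  rw [e]
  refine (abs_add_le _ _).trans ?_
  have := a3 s hs
  have := b3 s hs
  linarith

theorem T1.mul {f g : ℝ → ℝ → ℝ} {f0 f1 g0 g1 : ℝ → ℝ} (hf : T1 f f0 f1) (hg : T1 g g0 g1) :
    T1 (fun s t => f s t * g s t) (fun t => f0 t * g0 t) (fun t => f0 t * g1 t + f1 t * g0 t) := by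
  obtain ⟨C, hC0, hC⟩ := hf
  obtain ⟨D, hD0, hD⟩ := hg
  refine ⟨10 * (C * D), by positivity, fun t h0 h1 => ?_⟩
  obtain ⟨a1, a2, a3⟩ := hC t h0 h1
  obtain ⟨b1, b2, b3⟩ := hD t h0 h1
  have hCD : 0 ≤ C * D := by positivity
  have mm : ∀ {x y X Y : ℝ}, 0 ≤ X → |x| ≤ X → |y| ≤ Y → |x * y| ≤ X * Y := by
    intro x y X Y hX hx hy
    rw [abs_mul]; exact mul_le_mul hx hy (abs_nonneg _) hX
  refine ⟨(mm hC0 a1 b1).trans (by linarith), (abs_add_le _ _).trans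
    (by linarith [mm hC0 a1 b2, mm hC0 a2 b1]), fun s hs => ?_⟩
  set x := f s t - f0 t - s * f1 t with hx
  set y := g s t - g0 t - s * g1 t with hy
  have ha := a3 s hs
  have hb := b3 s hs
  have hs2 : s ^ 2 ≤ 1 := by rw [← sq_abs]; nlinarith [abs_nonneg s]
  have hs0 : 0 ≤ s ^ 2 := sq_nonneg s
  have e : f s t * g s t - f0 t * g0 t - s * (f0 t * g1 t + f1 t * g0 t)
      = s ^ 2 * (f1 t * g1 t) + (f0 t * y + s * (f1 t * y)) + (x * g0 t + s * (x * g1 t)) + x * y := by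
    have e1 : f s t = x + f0 t + s * f1 t := by rw [hx]; ring
    have e2 : g s t = y + g0 t + s * g1 t := by rw [hy]; ring
    rw [e1, e2]; ring
  rw [e]
  have k1 : |s ^ 2 * (f1 t * g1 t)| ≤ s ^ 2 * (C * D) :=
    mm hs0 (by rw [abs_of_nonneg hs0]) (mm hC0 a2 b2)
  have k2 : |f0 t * y| ≤ C * (D * s ^ 2) := mm hC0 a1 hb
  have k3 : |s * (f1 t * y)| ≤ 1 * (C * (D * s ^ 2)) := mm zero_le_one hs (mm hC0 a2 hb)
  have k4 : |x * g0 t| ≤ (C * s ^ 2) * D := mm (by positivity) ha b1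
  have k5 : |s * (x * g1 t)| ≤ 1 * ((C * s ^ 2) * D) := mm zero_le_one hs (mm (by positivity) ha b2)
  have k6 : |x * y| ≤ (C * s ^ 2) * (D * 1) :=
    mm (by positivity) ha (hb.trans (mul_le_mul_of_nonneg_left hs2 hD0))
  have t1 := abs_add_le (s ^ 2 * (f1 t * g1 t) + (f0 t * y + s * (f1 t * y)) + (x * g0 t + s * (x * g1 t))) (x * y)
  have t2 := abs_add_le (s ^ 2 * (f1 t * g1 t) + (f0 t * y + s * (f1 t * y))) (x * g0 t + s * (x * g1 t))
  have t3 := abs_add_le (s ^ 2 * (f1 t * g1 t)) (f0 t * y + s * (f1 t * y))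
  have t4 := abs_add_le (f0 t * y) (s * (f1 t * y))
  have t5 := abs_add_le (x * g0 t) (s * (x * g1 t))
  have : 0 ≤ C * D * s ^ 2 := by positivity
  linarith

theorem T1.const {f0 : ℝ → ℝ} (h : ContinuousOn f0 (Icc 0 1)) : T1 (fun _ t => f0 t) f0 (fun _ => 0) := by
  obtain ⟨C, hC⟩ := isCompact_Icc.exists_bound_of_continuousOn h
  refine ⟨max C 0, le_max_right _ _, fun t h0 h1 => ⟨(hC t ⟨h0, h1⟩).trans (le_max_left _ _), ?_, ?_⟩⟩
  · simp
  · intro s _; simp; positivity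

theorem T1.s : T1 (fun s _ => s) (fun _ => 0) (fun _ => 1) :=
  ⟨1, zero_le_one, fun t _ _ => ⟨by simp, by simp, fun s _ => by simp; positivity⟩⟩

theorem T1.congr {f g : ℝ → ℝ → ℝ} {f0 f1 g0 g1 : ℝ → ℝ} (hf : T1 f f0 f1)
    (h : ∀ s t, f s t = g s t) (h0 : ∀ t, f0 t = g0 t) (h1 : ∀ t, f1 t = g1 t) : T1 g g0 g1 := by
  have e : f = g := by ext s t; exact h s t
  have e0 : f0 = g0 := funext h0
  have e1 : f1 = g1 := funext h1
  subst e e0 e1; exact hf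

/-- `a = 1 + s (1 - t)` -/
theorem T1.a : T1 (fun s t => 1 + s * (1 - t)) (fun _ => 1) (fun t => 1 - t) :=
  ((T1.const (f0 := fun _ => 1) (by fun_prop)).add (T1.s.mul (T1.const (f0 := fun t => 1 - t)
    (by fun_prop)))).congr (fun _ _ => rfl) (fun _ => by simp) (fun _ => by simp)

theorem T1.apow (k : ℕ) : T1 (fun s t => (1 + s * (1 - t)) ^ k) (fun _ => 1) (fun t => k * (1 - t)) := by
  induction k with
  | zero => exact (T1.const (f0 := fun _ => 1) (by fun_prop)).congr (by simp) (by simp) (by simp)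
  | succ k ih => exact (ih.mul T1.a).congr (fun s t => by ring) (by simp) (fun t => by push_cast; ring)

theorem T1.det (k : ℕ) : T1 (fun s t => (1 + s * (1 - t)) ^ k * (1 + s * (1 - t) + (-2 * s) * t))
    (fun _ => 1) (fun t => (k + 1) * (1 - t) - 2 * t) :=
  ((T1.apow k).mul (T1.a.add ((T1.s.mul (T1.const (f0 := fun t => -2 * t) (by fun_prop)))))).congr
    (fun s t => by ring) (fun t => by ring) (fun t => by ring)

/-- pointwise inequality behind the inner variation -/
theorem inner_pt (k : ℕ) : ∃ C s0 : ℝ, 0 ≤ C ∧ 0 < s0 ∧ s0 ≤ 1/4 ∧ ∀ s t P X χ : ℝ, |s| ≤ s0 → 0 ≤ t → t ≤ 1 →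
    0 ≤ X → X ≤ P → 0 ≤ χ → χ ≤ 1 →
    1/2 ≤ (1 + s * (1 - t)) ^ k * (1 + s * (1 - t) + (-2 * s) * t) ∧
    (1 + s * (1 - t)) ^ 2 * P + (2 * (1 + s * (1 - t)) * (-2 * s) + (-2 * s) ^ 2 * t) * X + χ ≤
    (1 + s * (1 - t)) ^ k * (1 + s * (1 - t) + (-2 * s) * t) *
      ((P + χ) * (1 - s * ((k + 1) * (1 - (1 + s * (1 - t)) ^ 2 * t) - 2 * ((1 + s * (1 - t)) ^ 2 * t)))
        + 2 * s * ((1 - (1 + s * (1 - t)) ^ 2 * t) * P - 2 * ((1 + s * (1 - t)) ^ 2 * X))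
        + C * s ^ 2 * (P + 1)) := by
  have hd := T1.det k
  have hc : ∀ c : ℝ, T1 (fun _ _ => c) (fun _ => c) (fun _ => 0) := fun c =>
    T1.const (f0 := fun _ => c) (by fun_prop)
  have hat : T1 (fun s t => (1 + s * (1 - t)) ^ 2 * t) (fun t => t) (fun t => 2 * (1 - t) * t) :=
    ((T1.apow 2).mul (T1.const (f0 := fun t => t) (by fun_prop))).congr (fun _ _ => rfl)
      (by simp) (by simp)
  -- m at y
  have hmy : T1 (fun s t => -(s * ((k + 1) * (1 - (1 + s * (1 - t)) ^ 2 * t) - 2 * ((1 + s * (1 - t)) ^ 2 * t))))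
      (fun _ => 0) (fun t => -((k + 1) * (1 - t) - 2 * t)) :=
    (T1.s.mul (((hc (-(k+1))).add ((hc (k + 3)).mul hat)))).congr (fun s t => by ring)
      (fun t => by ring) (fun t => by ring)
  have h1 : T1 (fun s t => (1 + s * (1 - t)) ^ k * (1 + s * (1 - t) + (-2 * s) * t) *
      (1 - s * ((k + 1) * (1 - (1 + s * (1 - t)) ^ 2 * t) - 2 * ((1 + s * (1 - t)) ^ 2 * t))) - 1)
      (fun _ => 0) (fun _ => 0) :=
    ((hd.mul ((hc 1).add hmy)).add (hc (-1))).congr (fun s t => by ring) (fun t => by ring) (fun t => by ring)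
  have hoy : T1 (fun s t => 2 * s * (1 - (1 + s * (1 - t)) ^ 2 * t)) (fun _ => 0) (fun t => 2 * (1 - t)) :=
    (T1.s.mul ((hc 2).add ((hc (-2)).mul hat))).congr (fun s t => by ring)
      (fun t => by ring) (fun t => by ring)
  have h2 : T1 (fun s t => (1 + s * (1 - t)) ^ k * (1 + s * (1 - t) + (-2 * s) * t) *
      (1 - s * ((k + 1) * (1 - (1 + s * (1 - t)) ^ 2 * t) - 2 * ((1 + s * (1 - t)) ^ 2 * t))
        + 2 * s * (1 - (1 + s * (1 - t)) ^ 2 * t)) - (1 + s * (1 - t)) ^ 2)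
      (fun _ => 0) (fun _ => 0) :=
    ((hd.mul (((hc 1).add hmy).add hoy)).add ((hc (-1)).mul (T1.apow 2))).congr (fun s t => by ring)
      (fun t => by ring) (fun t => by push_cast; ring)
  have h3 : T1 (fun s t => (1 + s * (1 - t)) ^ k * (1 + s * (1 - t) + (-2 * s) * t) *
      (-4 * s * (1 + s * (1 - t)) ^ 2) - (2 * (1 + s * (1 - t)) * (-2 * s) + (-2 * s) ^ 2 * t))
      (fun _ => 0) (fun _ => 0) :=
    ((hd.mul (((hc (-4)).mul T1.s).mul (T1.apow 2))).add ((((hc 4).mul T1.s).mul T1.a).add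
      (((hc (-4)).mul (T1.s.mul T1.s)).mul (T1.const (f0 := fun t => t) (by fun_prop))))).congr
        (fun s t => by ring)
      (fun t => by ring) (fun t => by push_cast; ring)
  obtain ⟨C0, hC0, H0⟩ := hd
  obtain ⟨C1, hC1, H1⟩ := h1
  obtain ⟨C2, hC2, H2⟩ := h2
  obtain ⟨C3, hC3, H3⟩ := h3
  refine ⟨2 * (C1 + C2 + C3), (4 * (C0 + 1))⁻¹, by positivity, by positivity, ?_, ?_⟩
  · rw [one_div]; exact inv_anti₀ (by norm_num) (by linarith)
  intro s t P X χ hs ht0 ht1 hX hXP hχ hχ1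
  have hs4 : |s| * (4 * (C0 + 1)) ≤ 1 := by
    rw [← one_div, le_div_iff₀ (by positivity)] at hs
    exact hs
  have hs1 : |s| ≤ 1 := by nlinarith [abs_nonneg s]
  have hdet : 1/2 ≤ (1 + s * (1 - t)) ^ k * (1 + s * (1 - t) + (-2 * s) * t) := by
    obtain ⟨-, b, c⟩ := H0 t ht0 ht1
    have c := c s hs1
    have h5 : |s * ((k + 1) * (1 - t) - 2 * t)| ≤ |s| * C0 := by
      rw [abs_mul]; exact mul_le_mul_of_nonneg_left b (abs_nonneg _)
    have h6 := neg_le_of_abs_le h5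
    have h7 := neg_le_of_abs_le c
    have h8 : C0 * s ^ 2 ≤ |s| * C0 := by rw [← sq_abs]; nlinarith [abs_nonneg s, mul_nonneg hC0 (abs_nonneg s)]
    nlinarith [abs_nonneg s]
  refine ⟨hdet, ?_⟩
  have G1 := (H1 t ht0 ht1).2.2 s hs1
  have G2 := (H2 t ht0 ht1).2.2 s hs1
  have G3 := (H3 t ht0 ht1).2.2 s hs1
  simp only [mul_zero, sub_zero] at G1 G2 G3
  set d := (1 + s * (1 - t)) ^ k * (1 + s * (1 - t) + (-2 * s) * t) with hdd
  set A := (1 + s * (1 - t)) ^ 2 with hA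
  set m := ((k + 1) * (1 - A * t) - 2 * (A * t)) with hm
  have g1 := neg_le_of_abs_le G1
  have g2 := neg_le_of_abs_le G2
  have g3 := neg_le_of_abs_le G3
  have hP : 0 ≤ P := hX.trans hXP
  have k1 := mul_le_mul_of_nonneg_right g1 hχ
  have k2 := mul_le_mul_of_nonneg_right g2 hP
  have k3 := mul_le_mul_of_nonneg_right g3 hX
  have hs2 : 0 ≤ s ^ 2 := sq_nonneg s
  have j1 : C1 * s ^ 2 * χ ≤ C1 * s ^ 2 * (P + 1) := mul_le_mul_of_nonneg_left (by linarith) (by positivity)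
  have j2 : C2 * s ^ 2 * P ≤ C2 * s ^ 2 * (P + 1) := mul_le_mul_of_nonneg_left (by linarith) (by positivity)
  have j3 : C3 * s ^ 2 * X ≤ C3 * s ^ 2 * (P + 1) := mul_le_mul_of_nonneg_left (by linarith) (by positivity)
  have j4 : 1/2 * (2 * (C1 + C2 + C3) * s ^ 2 * (P + 1)) ≤ d * (2 * (C1 + C2 + C3) * s ^ 2 * (P + 1)) :=
    mul_le_mul_of_nonneg_right hdet (by positivity)
  clear_value d m A
  linarith

end
end AC

open MeasureTheory Metric Set Filter ENNReal NNReal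

set_option linter.all false
namespace AC
open scoped Gradient Topology InnerProductSpace

section
variable {E : Type*} [NormedAddCommGroup E] [InnerProductSpace ℝ E] [FiniteDimensional ℝ E]
variable [MeasureSpace E] [BorelSpace E] [(volume : Measure E).IsAddHaarMeasure]

theorem LB.ix {f : E → ℝ} (hf : LocallyLipschitz f) : LB (fun x => ⟪∇ f x, x⟫_ℝ) := by
  simpa using LB.innerx hf 0

noncomputable def DT (s : ℝ) (x : E) : E →L[ℝ] E :=
  (1 + s * (1 - ‖x‖ ^ 2)) • ContinuousLinearMap.id ℝ E + ((-2 * s) • (innerSL ℝ x)).smulRight x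

theorem DT_apply (s : ℝ) (x h : E) :
    DT s x h = (1 + s * (1 - ‖x‖ ^ 2)) • h + (-2 * s * ⟪x, h⟫_ℝ) • x := by
  simp [DT]

theorem hasDT (s : ℝ) (x : E) :
    HasFDerivAt (fun y : E => (1 + s * (1 - ‖y‖ ^ 2)) • y) (DT s x) x := by
  have h1 : HasGradientAt (fun y : E => 1 + s * (1 - ‖y‖ ^ 2)) (0 + s • (0 - (2:ℝ) • x)) x :=
    hg_add (hasGradientAt_const x (1:ℝ)) (hg_cmul s (hg_sub (hasGradientAt_const x (1:ℝ)) (hg_normsq x)))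
  have h2 := (of_hg h1).smul (hasFDerivAt_id x)
  refine h2.congr_fderiv ?_
  ext h
  rw [DT_apply]
  simp [inner_smul_left, inner_neg_left]
  congr 1
  ring

theorem det_DT (s : ℝ) (x : E) {k : ℕ} (hk : Module.finrank ℝ E = k + 1)
    (ha : 1 + s * (1 - ‖x‖ ^ 2) ≠ 0) :
    (DT s x).det = (1 + s * (1 - ‖x‖ ^ 2)) ^ k * (1 + s * (1 - ‖x‖ ^ 2) + (-2 * s) * ‖x‖ ^ 2) := by
  set a := 1 + s * (1 - ‖x‖ ^ 2) with haa
  have e : ((DT s x : E →L[ℝ] E) : E →ₗ[ℝ] E)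
      = a • LinearMap.transvection ((innerSL ℝ x : E →L[ℝ] ℝ) : E →ₗ[ℝ] ℝ) ((-2 * s / a) • x) := by
    ext h
    simp only [ContinuousLinearMap.coe_coe, DT_apply, LinearMap.smul_apply,
      LinearMap.transvection.apply, smul_add, smul_smul, innerSL_apply_apply]
    rw [← haa]
    congr 2
    field_simp
  rw [ContinuousLinearMap.det, e, LinearMap.det_smul, LinearMap.transvection.det, hk]
  simp only [ContinuousLinearMap.coe_coe, innerSL_apply_apply, inner_smul_right,
    real_inner_self_eq_norm_sq]
  rw [pow_succ]; field_simp

theorem T_inj {s : ℝ} (hs : |s| ≤ 1/4) :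
    InjOn (fun y : E => (1 + s * (1 - ‖y‖ ^ 2)) • y) (ball (0:E) 1) := by
  intro x hx y hy hxy
  have hx := norm_lt_one_of_mem hx
  have hy := norm_lt_one_of_mem hy
  simp only at hxy
  have e : x - y = (-s) • ((1 - ‖x‖ ^ 2) • (x - y) + (‖y‖ ^ 2 - ‖x‖ ^ 2) • y) := by
    have h1 : (1 + s * (1 - ‖x‖ ^ 2)) • x - (1 + s * (1 - ‖y‖ ^ 2)) • y = 0 := sub_eq_zero.2 hxy
    rw [← sub_eq_zero]
    rw [← h1]
    module
  have h2 : |‖y‖ ^ 2 - ‖x‖ ^ 2| ≤ 2 * ‖x - y‖ := by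
    have := abs_norm_sub_norm_le y x
    rw [norm_sub_rev] at this
    have e : ‖y‖ ^ 2 - ‖x‖ ^ 2 = (‖y‖ - ‖x‖) * (‖y‖ + ‖x‖) := by ring
    rw [e, abs_mul, abs_of_nonneg (by positivity : 0 ≤ ‖y‖ + ‖x‖)]
    nlinarith [abs_nonneg (‖y‖ - ‖x‖), norm_nonneg y, norm_nonneg x]
  have h3 : ‖(1 - ‖x‖ ^ 2) • (x - y) + (‖y‖ ^ 2 - ‖x‖ ^ 2) • y‖ ≤ 3 * ‖x - y‖ := by
    refine (norm_add_le _ _).trans ?_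
    rw [norm_smul, norm_smul, Real.norm_eq_abs, Real.norm_eq_abs,
      abs_of_nonneg (by nlinarith [norm_nonneg x] : 0 ≤ 1 - ‖x‖ ^ 2)]
    nlinarith [norm_nonneg (x - y), sq_nonneg ‖x‖, norm_nonneg y,
      mul_nonneg (sq_nonneg ‖x‖) (norm_nonneg (x - y)), abs_nonneg (‖y‖ ^ 2 - ‖x‖ ^ 2)]
  have h4 := congrArg norm e
  rw [norm_smul, norm_neg, Real.norm_eq_abs] at h4
  have h5 : ‖x - y‖ ≤ 0 := by
    have := mul_le_mul hs h3 (norm_nonneg _) (by norm_num)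
    linarith
  exact sub_eq_zero.1 (norm_le_zero_iff.1 h5)

theorem T_maps {s : ℝ} (hs : |s| ≤ 1/4) {x : E} (hx : x ∈ ball (0:E) 1) :
    (1 + s * (1 - ‖x‖ ^ 2)) • x ∈ ball (0:E) 1 := by
  have hx := norm_lt_one_of_mem hx
  have hs := abs_le.1 hs
  rw [mem_ball_zero_iff, norm_smul, Real.norm_eq_abs, abs_of_nonneg (by nlinarith [norm_nonneg x])]
  have h0 := norm_nonneg x
  have : s * (1 - ‖x‖ ^ 2) * ‖x‖ ≤ (1/4) * ((1 - ‖x‖ ^ 2) * ‖x‖) := by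
    rw [mul_assoc]; exact mul_le_mul_of_nonneg_right hs.2 (mul_nonneg (by nlinarith) h0)
  have h3 : 0 < (1 - ‖x‖) * (1 - (1 + ‖x‖) * ‖x‖ / 4) := mul_pos (by linarith) (by nlinarith)
  nlinarith

/-- the comparison density -/
noncomputable def gd (u : E → ℝ) (k : ℕ) (C s : ℝ) (y : E) : ℝ :=
  q u y * (1 - s * ((k + 1) * (1 - ‖y‖ ^ 2) - 2 * ‖y‖ ^ 2))
    + 2 * s * ((1 - ‖y‖ ^ 2) * ‖∇ u y‖ ^ 2 - 2 * ⟪∇ u y, y⟫_ℝ ^ 2) + C * s ^ 2 * (‖∇ u y‖ ^ 2 + 1)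

theorem LB.gd {u : E → ℝ} (hu : LocallyLipschitz u) (k : ℕ) (C s : ℝ) : LB (gd u k C s) :=
  (((LB.q hu).mul (LB.cont (f := fun y : E => 1 - s * ((k + 1) * (1 - ‖y‖ ^ 2) - 2 * ‖y‖ ^ 2))
    (by fun_prop))).add ((((LB.cont (f := fun y : E => 1 - ‖y‖ ^ 2) (by fun_prop)).mul (LB.nsq hu)).sub
      (((LB.ix hu).pow 2).cmul 2)).cmul (2 * s))).add (((LB.nsq hu).add (LB.const 1)).cmul (C * s ^ 2))

theorem gd_nonneg {u : E → ℝ} {k : ℕ} {C s : ℝ} (hC : 0 ≤ C) (hs : |s| * (k + 10) ≤ 1) {y : E}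
    (hy : y ∈ ball (0:E) 1) : 0 ≤ gd u k C s y := by
  have hy := norm_lt_one_of_mem hy
  have hP : ‖∇ u y‖ ^ 2 ≤ q u y := by unfold q; split_ifs <;> simp
  have hP0 : 0 ≤ ‖∇ u y‖ ^ 2 := sq_nonneg _
  have hX : ⟪∇ u y, y⟫_ℝ ^ 2 ≤ ‖∇ u y‖ ^ 2 := by
    have := abs_real_inner_le_norm (∇ u y) y
    rw [← sq_abs]
    have h2 : ‖∇ u y‖ * ‖y‖ ≤ ‖∇ u y‖ := by nlinarith [norm_nonneg (∇ u y)]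
    exact pow_le_pow_left₀ (abs_nonneg _) (this.trans h2) 2
  have ht : ‖y‖ ^ 2 ≤ 1 := by nlinarith [norm_nonneg y]
  have ht0 : 0 ≤ ‖y‖ ^ 2 := sq_nonneg _
  have hX0 : 0 ≤ ⟪∇ u y, y⟫_ℝ ^ 2 := sq_nonneg _
  unfold gd
  generalize ‖y‖ ^ 2 = t at *
  generalize ‖∇ u y‖ ^ 2 = P at *
  generalize ⟪∇ u y, y⟫_ℝ ^ 2 = X at *
  generalize q u y = Q at *
  have hk : (0:ℝ) ≤ k := Nat.cast_nonneg k
  have a1 : |s * ((k + 1) * (1 - t) - 2 * t)| ≤ |s| * (k + 3) := by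
    rw [abs_mul]
    refine mul_le_mul_of_nonneg_left (abs_le.2 ⟨?_, ?_⟩) (abs_nonneg _) <;> nlinarith
  have a2 : |2 * s * ((1 - t) * P - 2 * X)| ≤ 2 * |s| * (2 * P) := by
    rw [abs_mul, abs_mul, abs_two]
    refine mul_le_mul_of_nonneg_left (abs_le.2 ⟨?_, ?_⟩) (by positivity) <;> nlinarith
  have b1 := (abs_le.1 a1).2
  have b2 := (abs_le.1 a2).1
  have b3 : Q * (|s| * (k + 3)) ≤ Q * (1 - 7 * |s|) :=
    mul_le_mul_of_nonneg_left (by linarith) (hP0.trans hP)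
  have b4 : Q * (s * ((k + 1) * (1 - t) - 2 * t)) ≤ Q * (|s| * (k + 3)) :=
    mul_le_mul_of_nonneg_left b1 (hP0.trans hP)
  have b5 : |s| * P ≤ |s| * Q := mul_le_mul_of_nonneg_left hP (abs_nonneg _)
  have b6 : 0 ≤ C * s ^ 2 * (P + 1) := by positivity
  have b7 : 0 ≤ |s| * P := by positivity
  nlinarith

theorem inner_ineq [Nontrivial E] {u : E → ℝ} (hu : Mz u) {k : ℕ} (hk : Module.finrank ℝ E = k + 1) :
    ∃ C s0 : ℝ, 0 < s0 ∧ ∀ s, |s| ≤ s0 →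
      ∫ x in ball (0:E) 1, q u x ≤ ∫ x in ball (0:E) 1, gd u k C s x := by
  obtain ⟨C, s0, hC, hs0, hs4, H⟩ := inner_pt k
  refine ⟨C, min s0 (1 / (k + 10)), by positivity, fun s hs => ?_⟩
  have hs0' := hs.trans (min_le_left _ _)
  have hs10 : |s| * (k + 10) ≤ 1 := by
    have := hs.trans (min_le_right _ _)
    rwa [le_div_iff₀ (by positivity)] at this
  have hs4 := hs0'.trans hs4
  set T : E → E := fun y => (1 + s * (1 - ‖y‖ ^ 2)) • y with hT
  set T' : E → E := fun y => (1 + s * bump 0 1 y) • y with hT'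
  have hTT : ∀ x ∈ ball (0:E) 1, T' x = T x := by
    intro x hx; simp only [hT, hT', bump_in 0 1 x hx]; simp
  have hT'l : LocallyLipschitz T' := by
    have h : LocallyLipschitz (fun p : ℝ × E => p.1 • p.2) :=
      ContDiff.locallyLipschitz (𝕂 := ℝ) (by fun_prop)
    exact h.comp ((ll_add (LocallyLipschitz.const 1) (ll_cmul s (bump_ll 0 1))).prodMk
      LocallyLipschitz.id)
  have hapos : ∀ x ∈ ball (0:E) 1, 0 < 1 + s * (1 - ‖x‖ ^ 2) := by
    intro x hx
    have hx := norm_lt_one_of_mem hx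
    have := abs_le.1 hs4
    nlinarith [norm_nonneg x]
  have hdet : ∀ x ∈ ball (0:E) 1, (DT s x).det
      = (1 + s * (1 - ‖x‖ ^ 2)) ^ k * (1 + s * (1 - ‖x‖ ^ 2) + (-2 * s) * ‖x‖ ^ 2) :=
    fun x hx => det_DT s x hk (hapos x hx).ne'
  have htt : ∀ x ∈ ball (0:E) 1, 0 ≤ ‖x‖ ^ 2 ∧ ‖x‖ ^ 2 ≤ 1 := fun x hx => by
    have hx := norm_lt_one_of_mem hx
    exact ⟨by positivity, by nlinarith [norm_nonneg x]⟩
  have hdet2 : ∀ x ∈ ball (0:E) 1, 1/2 ≤ (DT s x).det := by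
    intro x hx
    rw [hdet x hx]
    exact (H s (‖x‖ ^ 2) 0 0 0 hs0' (htt x hx).1 (htt x hx).2 le_rfl le_rfl le_rfl zero_le_one).1
  have hinj : InjOn T (ball (0:E) 1) := T_inj hs4
  -- differentiability at images
  have hae : ∀ᵐ x : E, x ∈ ball (0:E) 1 → DifferentiableAt ℝ u (T x) := by
    have hTm : Measurable T := by
      have : Continuous T := by simp only [hT]; fun_prop
      exact this.measurable
    set N : Set E := {y | DifferentiableAt ℝ u y}ᶜ with hN
    have hNm : MeasurableSet N := (measurableSet_of_differentiableAt ℝ u).compl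
    have hN0 : volume N = 0 := ae_diff hu.2.1
    set S := ball (0:E) 1 ∩ T ⁻¹' N with hS
    have hSm : MeasurableSet S := measurableSet_ball.inter (hTm hNm)
    have h1 := lintegral_image_eq_lintegral_abs_det_fderiv_mul (volume : Measure E) hSm
      (f := T) (f' := DT s) (fun x _ => (hasDT s x).hasFDerivWithinAt)
      (hinj.mono inter_subset_left) (fun _ => 1)
    have h2 : volume (T '' S) = 0 := measure_mono_null (by
      rintro _ ⟨x, hx, rfl⟩; exact hx.2) hN0
    rw [lintegral_one, Measure.restrict_apply_univ, h2] at h1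
    have h3 : ∫⁻ x in S, ENNReal.ofReal (1/2) ≤ 0 := by
      rw [h1]
      refine setLIntegral_mono' hSm (fun x hx => ?_)
      rw [mul_one]
      exact ENNReal.ofReal_le_ofReal ((hdet2 x hx.1).trans (le_abs_self _))
    rw [setLIntegral_const, nonpos_iff_eq_zero, mul_eq_zero] at h3
    have h4 : volume S = 0 := by
      rcases h3 with h3 | h3
      · rw [ENNReal.ofReal_eq_zero] at h3; norm_num at h3
      · exact h3
    have : ∀ᵐ x : E, x ∉ S := measure_eq_zero_iff_ae_notMem.1 h4
    filter_upwards [this] with x hx hxb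
    by_contra hc
    exact hx ⟨hxb, hc⟩
  have hvl : LocallyLipschitz (u ∘ T') := hu.2.1.comp hT'l
  have h1 := hu.2.2 (u ∘ T') (fun x => hu.1 _) hvl 0 1 (fun x hx => by
    simp [hT', bump_out 0 1 x hx one_pos])
  refine h1.trans ?_
  have hgd : LB (gd u k C s) := LB.gd hu.2.1 k C s
  have hsub : T '' ball (0:E) 1 ⊆ ball (0:E) 1 := by
    rintro _ ⟨x, hx, rfl⟩; exact T_maps hs4 hx
  have himg := integral_image_eq_integral_abs_det_fderiv_smul (volume : Measure E)
    (measurableSet_ball (x := (0:E)) (ε := 1))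
      (f := T) (f' := DT s) (fun x _ => (hasDT s x).hasFDerivWithinAt) hinj (gd u k C s)
  have hIntg := (integrableOn_image_iff_integrableOn_abs_det_fderiv_smul (volume : Measure E)
    (measurableSet_ball (x := (0:E)) (ε := 1))
      (f := T) (f' := DT s) (fun x _ => (hasDT s x).hasFDerivWithinAt) hinj (gd u k C s)).1
      ((hgd.int 0 1).mono_set hsub)
  have hmono : ∫ x in T '' ball (0:E) 1, gd u k C s x ≤ ∫ x in ball (0:E) 1, gd u k C s x := by
    refine setIntegral_mono_set (hgd.int 0 1) ?_ hsub.eventuallyLE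
    exact (ae_restrict_iff' measurableSet_ball).2 (Eventually.of_forall fun x hx => gd_nonneg hC hs10 hx)
  refine le_trans ?_ hmono
  rw [himg]
  refine setIntegral_mono_on_ae ((LB.q hvl).int 0 1) hIntg measurableSet_ball ?_
  filter_upwards [hae] with x hd hx
  have hd := hd hx
  have hg : ∇ (u ∘ T') x = (1 + s * (1 - ‖x‖ ^ 2)) • ∇ u (T x) + (-2 * s * ⟪∇ u (T x), x⟫_ℝ) • x := by
    have e : ∇ (u ∘ T') x = ∇ (u ∘ T) x :=
      grad_congr_open isOpen_ball (fun y hy => by simp [hTT y hy]) hx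
    rw [e]
    have h2 : HasFDerivAt (u ∘ T) _ x := (of_hg hd.hasGradientAt).comp x (hasDT s x)
    refine (hg_of h2 (fun y => ?_)).gradient
    simp only [ContinuousLinearMap.comp_apply, DT_apply, innerSL_apply_apply, inner_add_left, inner_add_right,
      inner_smul_left, inner_smul_right]
    simp; ring
  have hn : ‖∇ (u ∘ T') x‖ ^ 2 = (1 + s * (1 - ‖x‖ ^ 2)) ^ 2 * ‖∇ u (T x)‖ ^ 2 +
      (2 * (1 + s * (1 - ‖x‖ ^ 2)) * (-2 * s) + (-2 * s) ^ 2 * ‖x‖ ^ 2) * ⟪∇ u (T x), x⟫_ℝ ^ 2 := by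
    rw [hg, norm_add_sq_real, inner_smul_left, inner_smul_right, norm_smul, norm_smul, mul_pow, mul_pow,
      Real.norm_eq_abs, Real.norm_eq_abs, sq_abs, sq_abs]
    simp; ring
  have hX : ⟪∇ u (T x), x⟫_ℝ ^ 2 ≤ ‖∇ u (T x)‖ ^ 2 := by
    have := abs_real_inner_le_norm (∇ u (T x)) x
    rw [← sq_abs]
    have h2 : ‖∇ u (T x)‖ * ‖x‖ ≤ ‖∇ u (T x)‖ := by
      nlinarith [norm_nonneg (∇ u (T x)), norm_lt_one_of_mem hx]
    exact pow_le_pow_left₀ (abs_nonneg _) (this.trans h2) 2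
  have key := (H s (‖x‖ ^ 2) (‖∇ u (T x)‖ ^ 2) (⟪∇ u (T x), x⟫_ℝ ^ 2) (if 0 < u (T x) then 1 else 0) hs0'
    (htt x hx).1 (htt x hx).2 (sq_nonneg _) hX (by split_ifs <;> norm_num) (by split_ifs <;> norm_num)).2
  have hnT : ‖T x‖ ^ 2 = (1 + s * (1 - ‖x‖ ^ 2)) ^ 2 * ‖x‖ ^ 2 := by
    simp only [hT]; rw [norm_smul, mul_pow, Real.norm_eq_abs, sq_abs]
  have hiT : ⟪∇ u (T x), T x⟫_ℝ ^ 2 = (1 + s * (1 - ‖x‖ ^ 2)) ^ 2 * ⟪∇ u (T x), x⟫_ℝ ^ 2 := by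
    have : ⟪∇ u (T x), T x⟫_ℝ = (1 + s * (1 - ‖x‖ ^ 2)) * ⟪∇ u (T x), x⟫_ℝ := by
      conv_lhs => rw [hT]
      rw [inner_smul_right]
    rw [this, mul_pow]
  rw [abs_of_pos (by linarith [hdet2 x hx]), hdet x hx, smul_eq_mul]
  simp only [gd, q, hn, hnT, hiT, Function.comp, hTT x hx]
  exact key

theorem inner_var [Nontrivial E] {u : E → ℝ} (hu : Mz u) {k : ℕ} (hk : Module.finrank ℝ E = k + 1) :
    ∫ x in ball (0:E) 1, q u x * ((k + 1) * (1 - ‖x‖ ^ 2) - 2 * ‖x‖ ^ 2)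
      = 2 * ∫ x in ball (0:E) 1, ((1 - ‖x‖ ^ 2) * ‖∇ u x‖ ^ 2 - 2 * ⟪∇ u x, x⟫_ℝ ^ 2) := by
  obtain ⟨C, s0, hs0, H⟩ := inner_ineq hu hk
  have l1 := LB.q hu.2.1
  have l2 := l1.mul (LB.cont (f := fun y : E => ((k:ℝ) + 1) * (1 - ‖y‖ ^ 2) - 2 * ‖y‖ ^ 2)
    (by fun_prop))
  have l3 := ((LB.cont (f := fun y : E => 1 - ‖y‖ ^ 2) (by fun_prop)).mul (LB.nsq hu.2.1)).sub
      (((LB.ix hu.2.1).pow 2).cmul 2)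
  have l4 := (LB.nsq hu.2.1).add (LB.const (1:ℝ))
  have H2 : ∀ s, |s| ≤ s0 → 0 ≤
      2 * s * ((2 * ∫ x in ball (0:E) 1, ((1 - ‖x‖ ^ 2) * ‖∇ u x‖ ^ 2 - 2 * ⟪∇ u x, x⟫_ℝ ^ 2))
      - ∫ x in ball (0:E) 1, q u x * ((k + 1) * (1 - ‖x‖ ^ 2) - 2 * ‖x‖ ^ 2)) / 2 +
      s ^ 2 * (C * ∫ x in ball (0:E) 1, (‖∇ u x‖ ^ 2 + 1)) := by
    intro s hs
    have h := H s hs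
    have e : ∫ x in ball (0:E) 1, gd u k C s x = ∫ x in ball (0:E) 1, ((q u x +
        (-s) * (q u x * ((k + 1) * (1 - ‖x‖ ^ 2) - 2 * ‖x‖ ^ 2))) +
        (2 * s) * ((1 - ‖x‖ ^ 2) * ‖∇ u x‖ ^ 2 - 2 * ⟪∇ u x, x⟫_ℝ ^ 2) +
        (C * s ^ 2) * (‖∇ u x‖ ^ 2 + 1)) := by
      congr 1; ext x; simp only [gd]; ring
    rw [e, LB.iadd ((l1.add (l2.cmul _)).add (l3.cmul _)) (l4.cmul _),
      LB.iadd (l1.add (l2.cmul _)) (l3.cmul _), LB.iadd l1 (l2.cmul _), integral_const_mul,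
      integral_const_mul, integral_const_mul] at h
    linarith
  set A := (2 * ∫ x in ball (0:E) 1, ((1 - ‖x‖ ^ 2) * ‖∇ u x‖ ^ 2 - 2 * ⟪∇ u x, x⟫_ℝ ^ 2))
      - ∫ x in ball (0:E) 1, q u x * ((k + 1) * (1 - ‖x‖ ^ 2) - 2 * ‖x‖ ^ 2) with hA
  have a1 : 0 ≤ A / 2 := quad_le hs0 (fun s h0 h1 => by
    have := H2 s (by rw [abs_of_pos h0]; exact h1.le)
    rwa [← mul_div_assoc])
  have a2 : 0 ≤ -A / 2 := quad_le hs0 (fun s h0 h1 => by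
    have := H2 (-s) (by rw [abs_neg, abs_of_pos h0]; exact h1.le)
    rw [neg_sq] at this
    have e : 2 * s * (-A / 2) = 2 * -s * A / 2 := by ring
    rw [e]; exact this)
  linarith

end
end AC

open MeasureTheory Metric Set Filter ENNReal NNReal

set_option linter.all false
namespace AC
open scoped Gradient Topology InnerProductSpace

section
variable {E : Type*} [NormedAddCommGroup E] [InnerProductSpace ℝ E] [FiniteDimensional ℝ E]
variable [MeasureSpace E] [BorelSpace E] [(volume : Measure E).IsAddHaarMeasure]

noncomputable def us (u : E → ℝ) (p : E) (r : ℝ) (y : E) : ℝ := r⁻¹ * u (p + r • y)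
noncomputable def dd (u : E → ℝ) (p : E) (r : ℝ) (y : E) : ℝ := ⟪∇ u (p + r • y), y⟫_ℝ
noncomputable def Nf (u : E → ℝ) (p : E) (r : ℝ) : ℝ := ∫ y in ball (0:E) 1, us u p r y ^ 2
noncomputable def Df (u : E → ℝ) (p : E) (r : ℝ) : ℝ :=
  ∫ y in ball (0:E) 1, (if 0 < u (p + r • y) then 1 else 0) * (1 - ‖y‖ ^ 2)
noncomputable def Phi (u : E → ℝ) (p : E) (r : ℝ) : ℝ :=
  (∫ y in ball (0:E) 1, q u (p + r • y) * (1 - ‖y‖ ^ 2)) - 2 * Nf u p r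

theorem bump_scale (p y : E) {r : ℝ} (hr : 0 < r) (hy : y ∈ ball (0:E) 1) :
    bump p r (p + r • y) = r ^ 2 * (1 - ‖y‖ ^ 2) := by
  rw [bump_in p r _ (mem_ball_scale hr hy), add_sub_cancel_left, norm_smul, mul_pow,
    Real.norm_eq_abs, sq_abs]; ring

theorem bump_deriv (p x : E) {r : ℝ} (hr : 0 < r) (hx : x ∉ sphere p r) :
    HasDerivAt (fun s => bump p s x) (if dist x p < r then 2 * r else 0) r := by
  by_cases h : dist x p < r
  · rw [if_pos h]
    have h1 : HasDerivAt (fun s : ℝ => s ^ 2 - ‖x - p‖ ^ 2) (2 * r) r := by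
      simpa using (hasDerivAt_pow 2 r).sub_const (‖x - p‖ ^ 2)
    refine h1.congr_of_eventuallyEq ?_
    filter_upwards [lt_mem_nhds (mem_ball.1 h)] with s hs
    exact bump_in p s x hs
  · rw [if_neg h]
    refine (hasDerivAt_const r (0:ℝ)).congr_of_eventuallyEq ?_
    have h2 : r < dist x p := by
      rw [not_lt] at h
      exact lt_of_le_of_ne h (fun e => hx (mem_sphere.2 e.symm))
    filter_upwards [gt_mem_nhds h2, lt_mem_nhds hr] with s hs hs0
    exact bump_out p s x (by rw [mem_ball, not_lt]; exact hs.le) hs0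

theorem K_deriv {g : E → ℝ} (hg : LB g) (p : E) {r : ℝ} (hr : 0 < r) :
    HasDerivAt (fun s => ∫ x in ball p (r + 1), g x * bump p s x) (2 * r * ∫ x in ball p r, g x) r := by
  have hLB : ∀ s, LB (fun x => g x * bump p s x) := fun s => hg.mul (LB.cont (bump_ll p s).continuous)
  have h := (hasDerivAt_integral_of_dominated_loc_of_lip (μ := volume.restrict (ball p (r + 1)))
    (F := fun s x => g x * bump p s x) (F' := fun x => g x * (if dist x p < r then 2 * r else 0))
    (bound := fun x => |g x| * (2 * r + 2)) (x₀ := r) (s := ball r 1) (ball_mem_nhds r one_pos)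
    (Eventually.of_forall fun s => (hLB s).1.aestronglyMeasurable) ((hLB r).int _ _)
    (hg.1.mul (Measurable.ite measurableSet_ball measurable_const measurable_const)).aestronglyMeasurable
    ?_ ?_ ?_).2
  · have e : ∀ x, g x * (if dist x p < r then 2 * r else 0) = (ball p r).indicator (fun x => 2 * r * g x) x := by
      intro x
      by_cases hx : dist x p < r
      · rw [indicator_of_mem (show x ∈ ball p r from hx), if_pos hx]; ring
      · rw [indicator_of_notMem (show x ∉ ball p r from hx), if_neg hx]; ring
    refine h.congr_deriv (Eq.trans (integral_congr_ae (Eventually.of_forall e)) ?_)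
    rw [setIntegral_indicator measurableSet_ball, inter_eq_right.2 (ball_subset_ball (by linarith)),
      integral_const_mul]
  · refine Eventually.of_forall fun x => ?_
    refine LipschitzOnWith.of_dist_le_mul fun s hs t ht => ?_
    rw [mem_ball, Real.dist_eq, abs_lt] at hs ht
    rw [Real.dist_eq, ← mul_sub, abs_mul, Real.coe_nnabs, abs_mul, abs_abs, mul_assoc]
    refine mul_le_mul_of_nonneg_left ?_ (abs_nonneg _)
    unfold bump
    refine (abs_max_sub_max_le_abs _ _ _).trans ?_
    have e : s ^ 2 - ‖x - p‖ ^ 2 - (t ^ 2 - ‖x - p‖ ^ 2) = (s + t) * (s - t) := by ring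
    rw [e, abs_mul, Real.dist_eq]
    refine mul_le_mul_of_nonneg_right ?_ (abs_nonneg _)
    rw [abs_of_pos (by linarith : 0 < 2 * r + 2), abs_le]
    constructor <;> linarith
  · obtain ⟨C, hC⟩ := hg.2 p (r + 1)
    refine intB (C := C * (2 * r + 2)) (by have := hg.1; fun_prop) (fun x hx => ?_)
    rw [Real.norm_eq_abs, abs_mul, abs_abs, abs_of_pos (by linarith : 0 < 2 * r + 2)]
    exact mul_le_mul_of_nonneg_right (hC x hx) (by linarith)
  · refine ae_restrict_of_ae ?_
    have : ∀ᵐ x : E, x ∉ sphere p r :=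
      measure_eq_zero_iff_ae_notMem.1 (Measure.addHaar_sphere_of_ne_zero volume p hr.ne')
    filter_upwards [this] with x hx
    exact (bump_deriv p x hr hx).const_mul (g x)

theorem K_eq {g : E → ℝ} (p : E) {r R : ℝ} (hr : 0 < r) (hrR : r ≤ R) :
    ∫ x in ball p R, g x * bump p r x
      = r ^ (Module.finrank ℝ E + 2) * ∫ y in ball (0:E) 1, g (p + r • y) * (1 - ‖y‖ ^ 2) := by
  rw [setIntegral_eq_of_subset_of_forall_diff_eq_zero measurableSet_ball (ball_subset_ball hrR)
    (fun x hx => by rw [bump_out p r x hx.2 hr, mul_zero]), int_scale1 _ p hr]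
  have : ∫ y in ball (0:E) 1, g (p + r • y) * bump p r (p + r • y)
      = ∫ y in ball (0:E) 1, r ^ 2 * (g (p + r • y) * (1 - ‖y‖ ^ 2)) := by
    refine int_congr _ _ (Eventually.of_forall fun y hy => ?_)
    rw [bump_scale p y hr hy]; ring
  rw [this, integral_const_mul]; ring

theorem H_deriv {g : E → ℝ} (hg : LB g) (p : E) {r : ℝ} (hr : 0 < r) :
    HasDerivAt (fun r => ∫ y in ball (0:E) 1, g (p + r • y) * (1 - ‖y‖ ^ 2))
      (r⁻¹ * ∫ y in ball (0:E) 1, g (p + r • y) *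
        (2 * ‖y‖ ^ 2 - (Module.finrank ℝ E : ℝ) * (1 - ‖y‖ ^ 2))) r := by
  set n := Module.finrank ℝ E with hn
  have h1 := K_deriv hg p hr
  have hp : HasDerivAt (fun s : ℝ => s ^ (n + 2)) (((n + 2 : ℕ) : ℝ) * r ^ (n + 1)) r := by
    simpa using hasDerivAt_pow (n + 2) r
  have h2 := h1.div hp (by positivity)
  refine (h2.congr_of_eventuallyEq ?_).congr_deriv ?_
  · filter_upwards [lt_mem_nhds hr, gt_mem_nhds (lt_add_one r)] with s hs0 hs1
    rw [Pi.div_apply, K_eq p hs0 hs1.le, ← hn]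
    field_simp
  · rw [K_eq p hr (by linarith), int_scale1 g p hr, ← hn]
    have l1 : LB (fun y => g (p + r • y)) := hg.scale p r
    have l2 := l1.mul (LB.cont (f := fun y : E => 1 - ‖y‖ ^ 2) (by fun_prop))
    have e : ∫ y in ball (0:E) 1, g (p + r • y) * (2 * ‖y‖ ^ 2 - (n : ℝ) * (1 - ‖y‖ ^ 2))
        = ∫ y in ball (0:E) 1, (2 * g (p + r • y) - (n + 2) * (g (p + r • y) * (1 - ‖y‖ ^ 2))) := by
      congr 1; ext y; ring
    rw [e, LB.isub (l1.cmul _) (l2.cmul _), integral_const_mul, integral_const_mul]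
    push_cast
    field_simp
    ring

theorem us_ll {u : E → ℝ} (hu : LocallyLipschitz u) (p : E) (r : ℝ) : LocallyLipschitz (us u p r) :=
  ll_scale hu p r _

theorem us_LB {u : E → ℝ} (hu : LocallyLipschitz u) (p : E) (r : ℝ) : LB (us u p r) :=
  LB.cont (us_ll hu p r).continuous

theorem dd_LB {u : E → ℝ} (hu : LocallyLipschitz u) (p : E) (r : ℝ) : LB (dd u p r) := LB.gx hu p r

theorem us_hd {u k : E → ℝ} (hu : LocallyLipschitz u) (hk : LB k) (p : E) {r : ℝ} (hr : 0 < r) :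
    HasDerivAt (fun r => ∫ y in ball (0:E) 1, k y * us u p r y)
      (r⁻¹ * ∫ y in ball (0:E) 1, k y * (dd u p r y - us u p r y)) r := by
  have h1 := (hasDerivAt_inv hr.ne').mul (HD hu hk p hr.ne')
  have l1 := hk.mul (dd_LB hu p r)
  have l2 := hk.mul ((LB.cont hu.continuous).scale p r)
  refine (h1.congr_of_eventuallyEq ?_).congr_deriv ?_
  · refine Eventually.of_forall fun s => ?_
    simp only [Pi.mul_apply]
    rw [← integral_const_mul]
    congr 1; ext y; simp only [us]; ring
  · have e : ∫ y in ball (0:E) 1, k y * (dd u p r y - us u p r y)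
        = ∫ y in ball (0:E) 1, (k y * dd u p r y - r⁻¹ * (k y * u (p + r • y))) := by
      congr 1; ext y; simp only [us]; ring
    rw [e, LB.isub l1 (l2.cmul _), integral_const_mul]
    simp only [dd]
    field_simp; ring

theorem Nf_deriv {u : E → ℝ} (hu : LocallyLipschitz u) (p : E) {r : ℝ} (hr : 0 < r) :
    HasDerivAt (Nf u p) (2 * r⁻¹ * ∫ y in ball (0:E) 1, us u p r y * (dd u p r y - us u p r y)) r := by
  have hu2 : LocallyLipschitz (fun x => u x * u x) := ll_mul hu hu
  have h1 := (hasDerivAt_pow 2 r).inv (by positivity : r ^ 2 ≠ 0)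
  have h2 := h1.mul (HD hu2 (LB.const 1) p hr.ne')
  have l1 := (us_LB hu p r).mul (dd_LB hu p r)
  have l2 := (us_LB hu p r).mul (us_LB hu p r)
  refine (h2.congr_of_eventuallyEq ?_).congr_deriv ?_
  · refine Eventually.of_forall fun s => ?_
    simp only [Pi.mul_apply, Nf, Pi.inv_apply]
    rw [← integral_const_mul]
    congr 1; ext y; simp only [us]; ring
  · have e : ∫ y in ball (0:E) 1, us u p r y * (dd u p r y - us u p r y)
        = ∫ y in ball (0:E) 1, (us u p r y * dd u p r y - us u p r y * us u p r y) := by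
      congr 1; ext y; ring
    have e2 : ∫ y in ball (0:E) 1, (1:ℝ) * ⟪∇ (fun x => u x * u x) (p + r • y), y⟫_ℝ
        = ∫ y in ball (0:E) 1, (2 * r) * (us u p r y * dd u p r y) := by
      refine int_congr _ _ ?_
      filter_upwards [ae_scale (ae_hg hu) p hr.ne'] with y hy _
      rw [(hg_mul hy hy).gradient, inner_add_left, inner_smul_left, us, dd]
      simp; field_simp; ring
    have e3 : ∫ y in ball (0:E) 1, (1:ℝ) * (u (p + r • y) * u (p + r • y))
        = ∫ y in ball (0:E) 1, r ^ 2 * (us u p r y * us u p r y) := by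
      congr 1; ext y; simp only [us]; field_simp
    rw [e, LB.isub l1 l2, e2, e3, integral_const_mul, integral_const_mul]
    simp only [Pi.inv_apply]
    push_cast
    field_simp
    ring

/-- testing with `ω u` -/
theorem omega_id {u : E → ℝ} (hu : Mz u) :
    ∫ x in ball (0:E) 1, (1 - ‖x‖ ^ 2) * ‖∇ u x‖ ^ 2 = 2 * ∫ x in ball (0:E) 1, u x * ⟪∇ u x, x⟫_ℝ := by
  have h := F2 hu (φ := fun x => bump 0 1 x * u x) (ll_mul (bump_ll 0 1) hu.2.1) 0 1
    (fun x hx => by rw [bump_out 0 1 x hx one_pos, zero_mul]) (C := 1) (fun x => by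
      rw [abs_of_nonneg (mul_nonneg (bump_nonneg _ _ _) (hu.1 x))]
      have := bump_le (0:E) 1 x
      exact mul_le_mul_of_nonneg_right (by linarith) (hu.1 x))
  have l1 := (LB.cont (f := fun y : E => 1 - ‖y‖ ^ 2) (by fun_prop)).mul (LB.nsq hu.2.1)
  have l2 := (LB.cont hu.2.1.continuous).mul (LB.ix hu.2.1)
  have e : ∫ x in ball (0:E) 1, ⟪∇ u x, ∇ (fun x => bump 0 1 x * u x) x⟫_ℝ
      = ∫ x in ball (0:E) 1, ((1 - ‖x‖ ^ 2) * ‖∇ u x‖ ^ 2 - 2 * (u x * ⟪∇ u x, x⟫_ℝ)) := by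
    refine int_congr _ _ ?_
    filter_upwards [ae_hg hu.2.1] with x hx hxb
    rw [(hg_mul (bump_hg 0 1 x hxb) hx).gradient, bump_in 0 1 x hxb, inner_add_right, inner_smul_right,
      inner_smul_right, inner_smul_right, real_inner_self_eq_norm_sq]
    simp; ring
  rw [e, LB.isub l1 (l2.cmul _), integral_const_mul] at h
  linarith

theorem omega_id' {u : E → ℝ} (hu : Mz u) (p : E) {r : ℝ} (hr : 0 < r) :
    ∫ y in ball (0:E) 1, (1 - ‖y‖ ^ 2) * ‖∇ u (p + r • y)‖ ^ 2
      = 2 * ∫ y in ball (0:E) 1, us u p r y * dd u p r y := by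
  have h := omega_id (hu.scale p hr)
  have a1 : ∫ x in ball (0:E) 1, (1 - ‖x‖ ^ 2) * ‖∇ (fun x => r⁻¹ * u (p + r • x)) x‖ ^ 2
      = ∫ y in ball (0:E) 1, (1 - ‖y‖ ^ 2) * ‖∇ u (p + r • y)‖ ^ 2 := by
    refine int_congr _ _ ?_
    filter_upwards [grad_scale hu.2.1 p hr.ne'] with x hx _
    rw [hx.gradient]
  have a2 : ∫ x in ball (0:E) 1, (r⁻¹ * u (p + r • x)) * ⟪∇ (fun x => r⁻¹ * u (p + r • x)) x, x⟫_ℝ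
      = ∫ y in ball (0:E) 1, us u p r y * dd u p r y := by
    refine int_congr _ _ ?_
    filter_upwards [grad_scale hu.2.1 p hr.ne'] with x hx _
    rw [hx.gradient, us, dd]
  rw [a1, a2] at h
  exact h

theorem LB.nsq_scale {u : E → ℝ} (hu : LocallyLipschitz u) (p : E) (r : ℝ) :
    LB (fun y => ‖∇ u (p + r • y)‖ ^ 2) := (LB.nsq hu).scale p r

theorem Phi_eq {u : E → ℝ} (hu : Mz u) (p : E) {r : ℝ} (hr : 0 < r) :
    Phi u p r = Df u p r + 2 * ∫ y in ball (0:E) 1, us u p r y * (dd u p r y - us u p r y) := by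
  have lw : LB (fun y : E => 1 - ‖y‖ ^ 2) := LB.cont (by fun_prop)
  have l1 := (us_LB hu.2.1 p r).mul (dd_LB hu.2.1 p r)
  have l2 := (us_LB hu.2.1 p r).pow 2
  have l3 := lw.mul (LB.nsq_scale hu.2.1 p r)
  have l4 := ((LB.ind hu.2.1.continuous).scale p r).mul lw
  have e : ∫ y in ball (0:E) 1, us u p r y * (dd u p r y - us u p r y)
        = ∫ y in ball (0:E) 1, (us u p r y * dd u p r y - us u p r y ^ 2) := by
      congr 1; ext y; ring
  have e2 : ∫ y in ball (0:E) 1, q u (p + r • y) * (1 - ‖y‖ ^ 2)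
      = ∫ y in ball (0:E) 1, ((1 - ‖y‖ ^ 2) * ‖∇ u (p + r • y)‖ ^ 2 +
        (if 0 < u (p + r • y) then 1 else 0) * (1 - ‖y‖ ^ 2)) := by
    congr 1; ext y; simp only [q]; ring
  rw [Phi, e2, e, LB.iadd l3 l4, LB.isub l1 l2, omega_id' hu p hr, Nf, Df]
  ring

theorem Phi_deriv [Nontrivial E] {u : E → ℝ} (hu : Mz u) (p : E) {r : ℝ} (hr : 0 < r) :
    HasDerivAt (Phi u p) (4 * r⁻¹ * ∫ y in ball (0:E) 1, (dd u p r y - us u p r y) ^ 2) r := by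
  obtain ⟨k, hk⟩ : ∃ k, Module.finrank ℝ E = k + 1 := Nat.exists_eq_succ_of_ne_zero
    (Module.finrank_pos (R := ℝ) (M := E)).ne'
  have h1 := (H_deriv (LB.q hu.2.1) p hr).sub ((Nf_deriv hu.2.1 p hr).const_mul 2)
  refine h1.congr_deriv ?_
  have lw : LB (fun y : E => 1 - ‖y‖ ^ 2) := LB.cont (by fun_prop)
  have l1 := (us_LB hu.2.1 p r).mul (dd_LB hu.2.1 p r)
  have l2 := (us_LB hu.2.1 p r).pow 2
  have l3 := lw.mul (LB.nsq_scale hu.2.1 p r)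
  have l4 := (dd_LB hu.2.1 p r).pow 2
  have h2 := inner_var (hu.scale p hr) hk
  have a1 : ∫ x in ball (0:E) 1, q (fun x => r⁻¹ * u (p + r • x)) x * ((k + 1) * (1 - ‖x‖ ^ 2) - 2 * ‖x‖ ^ 2)
      = - ∫ y in ball (0:E) 1, q u (p + r • y) *
        (2 * ‖y‖ ^ 2 - (Module.finrank ℝ E : ℝ) * (1 - ‖y‖ ^ 2)) := by
    rw [← integral_neg]
    refine int_congr _ _ ?_
    filter_upwards [q_scale hu.2.1 p hr] with x hx _
    rw [hx, hk]; push_cast; ring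
  have a2 : ∫ x in ball (0:E) 1, ((1 - ‖x‖ ^ 2) * ‖∇ (fun x => r⁻¹ * u (p + r • x)) x‖ ^ 2 -
      2 * ⟪∇ (fun x => r⁻¹ * u (p + r • x)) x, x⟫_ℝ ^ 2)
      = ∫ y in ball (0:E) 1, ((1 - ‖y‖ ^ 2) * ‖∇ u (p + r • y)‖ ^ 2 - 2 * dd u p r y ^ 2) := by
    refine int_congr _ _ ?_
    filter_upwards [grad_scale hu.2.1 p hr.ne'] with x hx _
    rw [hx.gradient, dd]
  rw [a1, a2, LB.isub l3 (l4.cmul _), integral_const_mul, omega_id' hu p hr] at h2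
  have e : ∫ y in ball (0:E) 1, us u p r y * (dd u p r y - us u p r y)
        = ∫ y in ball (0:E) 1, (us u p r y * dd u p r y - us u p r y ^ 2) := by
      congr 1; ext y; ring
  have e2 : ∫ y in ball (0:E) 1, (dd u p r y - us u p r y) ^ 2
        = ∫ y in ball (0:E) 1, (dd u p r y ^ 2 - 2 * (us u p r y * dd u p r y) + us u p r y ^ 2) := by
      congr 1; ext y; ring
  rw [e, e2, LB.isub l1 l2, LB.iadd (l4.sub (l1.cmul 2)) l2, LB.isub l4 (l1.cmul 2), integral_const_mul]
  have h3 : ∫ y in ball (0:E) 1, q u (p + r • y) *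
        (2 * ‖y‖ ^ 2 - (Module.finrank ℝ E : ℝ) * (1 - ‖y‖ ^ 2)) =
     - (2 * (2 * (∫ y in ball (0:E) 1, us u p r y * dd u p r y) - 2 * ∫ y in ball (0:E) 1, dd u p r y ^ 2)) := by
    linarith
  rw [h3]; ring

end
end AC

open MeasureTheory Metric Set Filter ENNReal NNReal

set_option linter.all false
namespace AC
open scoped Gradient Topology InnerProductSpace

section
variable {E : Type*} [NormedAddCommGroup E] [InnerProductSpace ℝ E] [FiniteDimensional ℝ E]
variable [MeasureSpace E] [BorelSpace E] [(volume : Measure E).IsAddHaarMeasure]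

theorem const_of_grad {f : E → ℝ} (hf : LocallyLipschitz f) {p : E} {R : ℝ} (hR : 0 < R)
    (h : ∀ᵐ x : E, x ∈ ball p R → ∇ f x = 0) : ∀ x ∈ ball p R, f x = f p := by
  set k : E → ℝ := fun y => f (p + R • y) - f p with hkd
  have hkc : Continuous k := by
    have := hf.continuous
    fun_prop
  have hk : LB k := LB.cont hkc
  have hder : ∀ r, 0 < r → r < R → HasDerivAt (fun r => ∫ y in ball (0:E) 1, k y * f (p + r • y)) 0 r := by
    intro r hr hrR
    refine (HD hf hk p hr.ne').congr_deriv ?_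
    have : ∫ y in ball (0:E) 1, k y * ⟪∇ f (p + r • y), y⟫_ℝ = ∫ y in ball (0:E) 1, (0:ℝ) := by
      refine int_congr _ _ ?_
      filter_upwards [ae_scale h p hr.ne'] with y hy hyb
      rw [hy (ball_subset_ball hrR.le (mem_ball_scale hr hyb))]; simp
    rw [this]; simp
  have hc := HC hf.continuous hk p
  have heq : (∫ y in ball (0:E) 1, k y * f (p + R • y)) = ∫ y in ball (0:E) 1, k y * f (p + (0:ℝ) • y) := by
    obtain ⟨c, hc1, hc2⟩ := exists_hasDerivAt_eq_slope (fun r => ∫ y in ball (0:E) 1, k y * f (p + r • y))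
      (fun _ => 0) hR hc.continuousOn (fun r hr => hder r hr.1 hr.2)
    have : R - 0 ≠ 0 := by simpa using hR.ne'
    rw [eq_div_iff this, zero_mul] at hc2
    linarith
  have h0 : ∫ y in ball (0:E) 1, k y * k y = 0 := by
    have e : ∫ y in ball (0:E) 1, k y * k y = ∫ y in ball (0:E) 1, (k y * f (p + R • y) - k y * f (p + (0:ℝ) • y)) := by
      congr 1; ext y; simp only [hkd, zero_smul, add_zero]; ring
    rw [e, LB.isub (hk.mul ((LB.cont hf.continuous).scale p R)) (hk.mul ((LB.cont hf.continuous).scale p 0)),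
      heq, sub_self]
  have h1 := zero_of_int (f := fun y => k y * k y) (hkc.mul hkc) (fun x _ => mul_self_nonneg _) h0.le
  intro x hx
  have hy : R⁻¹ • (x - p) ∈ ball (0:E) 1 := by
    rw [mem_ball, dist_eq_norm] at hx
    rw [mem_ball, dist_zero_right, norm_smul, Real.norm_of_nonneg (by positivity), inv_mul_lt_iff₀ hR]
    simpa using hx
  have := mul_self_eq_zero.1 (h1 _ hy)
  simp only [hkd, smul_smul, mul_inv_cancel₀ hR.ne', one_smul, add_sub_cancel] at this
  linarith

theorem divx {ψ : E → ℝ} (hψ : LocallyLipschitz ψ) {R : ℝ} (hR : 0 < R)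
    (hs : ∀ x, x ∉ ball (0:E) R → ψ x = 0) :
    ∫ x in ball (0:E) R, ⟪∇ ψ x, x⟫_ℝ = - (Module.finrank ℝ E : ℝ) * ∫ x in ball (0:E) R, ψ x := by
  set n := Module.finrank ℝ E with hn
  set I := ∫ x in ball (0:E) R, ψ x with hI
  have h1 := (HD hψ (LB.const 1) 0 hR.ne').hasDerivWithinAt (s := Ici R)
  have h2 : HasDerivWithinAt (fun r : ℝ => (r ^ n)⁻¹ * I) (-(n * R ^ (n - 1)) / (R ^ n) ^ 2 * I) (Ici R) R :=
    (((hasDerivAt_pow n R).inv (by positivity)).mul_const I).hasDerivWithinAt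
  have heq : ∀ r ∈ Ici R, (∫ y in ball (0:E) 1, (1:ℝ) * ψ (0 + r • y)) = (r ^ n)⁻¹ * I := by
    intro r hr
    have hr0 : 0 < r := hR.trans_le hr
    have e := int_scale1 ψ 0 hr0
    rw [setIntegral_eq_of_subset_of_forall_diff_eq_zero measurableSet_ball (ball_subset_ball hr)
      (fun x hx => hs x hx.2)] at e
    rw [hI, e, ← hn, ← mul_assoc, inv_mul_cancel₀ (by positivity), one_mul]
    simp
  have h3 := h2.congr heq (heq R self_mem_Ici)
  have h4 := (uniqueDiffWithinAt_Ici R).eq_deriv _ h1 h3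
  have e := int_scale1 (fun x => ⟪∇ ψ x, x⟫_ℝ) 0 hR
  have e2 : ∫ y in ball (0:E) 1, ⟪∇ ψ (0 + R • y), 0 + R • y⟫_ℝ
      = R * ∫ y in ball (0:E) 1, 1 * ⟪∇ ψ (0 + R • y), y⟫_ℝ := by
    rw [← integral_const_mul]
    congr 1; ext y; rw [zero_add, inner_smul_right, one_mul]
  rw [e, e2, h4, ← hn]
  rcases Nat.eq_zero_or_pos n with h0 | h0
  · simp [h0]
  · obtain ⟨k, hk⟩ := Nat.exists_eq_succ_of_ne_zero h0.ne'
    rw [hk]; simp only [Nat.succ_eq_add_one, Nat.add_sub_cancel]; field_simp; ring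


theorem growth [Nontrivial E] {u : E → ℝ} (hu : Mz u)
    (ha : ∀ x ∈ closedBall (0:E) 1, Real.exp (15 * Module.finrank ℝ E) ≤ u x) :
    ∀ x ∈ ball (0:E) 4, 0 < u x := by
  set c : ℝ := ((Module.finrank ℝ E : ℕ) : ℝ) with hc
  have hc1 : 1 ≤ c := by
    have : 0 < Module.finrank ℝ E := Module.finrank_pos
    rw [hc]; exact_mod_cast this
  clear_value c
  set e : E → ℝ := fun z => Real.exp (-c * ‖z‖ ^ 2) with he
  have hecd : ContDiff ℝ 1 e := by
    have := contDiff_norm_sq ℝ (E := E) (n := 1)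
    rw [he]; fun_prop
  have hell : LocallyLipschitz e := ll_cd hecd
  have heg : ∀ x, HasGradientAt e ((-2 * c * e x) • x) x := by
    intro x
    have h1 := hg_cmul (-c) (hg_normsq x)
    have h2 := hg_comp (f := fun y : E => -c * ‖y‖ ^ 2) (Real.hasDerivAt_exp _) h1
    convert h2 using 1
    rw [smul_smul, smul_smul]; congr 1; ring
  have hep : ∀ x, 0 < e x := fun x => Real.exp_pos _
  set K : ℝ := Real.exp (16 * c) with hK
  have hK0 : 0 < K := Real.exp_pos _
  have hK1 : K * Real.exp (-16 * c) = 1 := by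
    rw [hK, ← Real.exp_add]; simp
  set h : E → ℝ := fun z => max (K * min (e z) (Real.exp (-c)) - 1) 0 with hh
  have hhll : LocallyLipschitz h := ll_max (ll_sub (ll_cmul K (ll_min hell (LocallyLipschitz.const _)))
    (LocallyLipschitz.const 1)) (LocallyLipschitz.const 0)
  have hh4 : ∀ x, x ∉ ball (0:E) 4 → h x = 0 := by
    intro x hx
    rw [mem_ball, dist_zero_right, not_lt] at hx
    refine max_eq_right ?_
    have hx2 : 16 ≤ ‖x‖ ^ 2 := by nlinarith
    have : e x ≤ Real.exp (-16 * c) := Real.exp_le_exp.2 (by nlinarith)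
    have h2 := mul_le_mul_of_nonneg_left ((min_le_left (e x) (Real.exp (-c))).trans this) hK0.le
    linarith
  have hhp : ∀ x ∈ ball (0:E) 4, 0 < h x := by
    intro x hx
    rw [mem_ball, dist_zero_right] at hx
    refine lt_max_of_lt_left ?_
    have hx2 : ‖x‖ ^ 2 < 16 := by nlinarith [norm_nonneg x]
    have h1 : Real.exp (-16 * c) < e x := Real.exp_lt_exp.2 (by nlinarith [norm_nonneg x])
    have h2 : Real.exp (-16 * c) < Real.exp (-c) := Real.exp_lt_exp.2 (by linarith)
    have := mul_lt_mul_of_pos_left (lt_min h1 h2) hK0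
    linarith
  have hh1 : ∀ x, h x ≤ Real.exp (15 * c) := by
    intro x
    refine max_le ?_ (Real.exp_pos _).le
    have h1 := mul_le_mul_of_nonneg_left (min_le_right (e x) (Real.exp (-c))) hK0.le
    have h2 : K * Real.exp (-c) = Real.exp (15 * c) := by
      rw [hK, ← Real.exp_add]; congr 1; ring
    linarith
  set ζ : E → ℝ := fun x => max (h x - u x) 0 with hζ
  have hζll : LocallyLipschitz ζ := ll_max (ll_sub hhll hu.2.1) (LocallyLipschitz.const 0)
  have hζ0 : ∀ x, 0 ≤ ζ x := fun x => le_max_right _ _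
  have hζ4 : ∀ x, x ∉ ball (0:E) 4 → ζ x = 0 := fun x hx => max_eq_right (by
    rw [hh4 x hx]; linarith [hu.1 x])
  have hζ1 : ∀ x, ‖x‖ ≤ 1 → ζ x = 0 := fun x hx => max_eq_right (by
    have := ha x (by simpa using hx)
    linarith [hh1 x])
  set F : E → E := fun x => (-2 * c * K * e x) • x with hF
  have hpt : ∀ᵐ x : E, q (fun x => u x + ζ x) x ≤ q u x + 2 * ⟪F x, ∇ ζ x⟫_ℝ - 3 / 4 * ‖∇ ζ x‖ ^ 2 := by
    filter_upwards [ae_hg hu.2.1, ae_hg hζll] with x hux hζx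
    have hv := (hg_add hux hζx).gradient
    simp only [q]
    rw [hv]
    rcases (hζ0 x).eq_or_lt with h0 | h0
    · rw [grad_zero_of_min hζ0 h0.symm]; simp [← h0]
    · have hx1 : 1 < ‖x‖ := by
        by_contra hcon
        exact h0.ne' (hζ1 x (not_lt.1 hcon))
      have hx4 : x ∈ ball (0:E) 4 := by
        by_contra hcon
        exact h0.ne' (hζ4 x hcon)
      have hx4' : ‖x‖ < 4 := by simpa using hx4
      have hnear : ∀ᶠ y in 𝓝 x, ζ y = K * e y - 1 - u y := by
        have a1 : ∀ᶠ y in 𝓝 x, 0 < ζ y := hζll.continuous.continuousAt.eventually_const_lt h0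
        have a2 : ∀ᶠ y in 𝓝 x, 1 < ‖y‖ := continuous_norm.continuousAt.eventually_const_lt hx1
        filter_upwards [a1, a2, isOpen_ball.mem_nhds hx4] with y hy1 hy2 hy3
 
        have hx2 : 1 < ‖y‖ ^ 2 := by nlinarith [norm_nonneg y]
        have b1 : e y ≤ Real.exp (-c) := Real.exp_le_exp.2 (by nlinarith)
        have b2 : h y = K * e y - 1 := by
          have := hhp y hy3
          simp only [hh, min_eq_left b1] at this ⊢
          refine max_eq_left ?_
          rcases lt_max_iff.1 this with h' | h'
          · exact h'.le
          · exact absurd h' (lt_irrefl _)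
        have b3 : ζ y = h y - u y := by
          rcases lt_max_iff.1 hy1 with h' | h'
          · exact max_eq_left h'.le
          · exact absurd h' (lt_irrefl _)
        rw [b3, b2]
      have hgz : ∇ ζ x = F x - ∇ u x := by
        rw [Filter.EventuallyEq.gradient_eq hnear]
        have := hg_sub (hg_sub (hg_cmul K (heg x)) (hasGradientAt_const x (1:ℝ))) hux
        rw [this.gradient, hF, smul_smul, sub_zero]
        congr 2; ring
      have hFn : 2 ≤ ‖F x‖ := by
        have e1 : 1 ≤ K * e x := by
          have hx2 : ‖x‖ ^ 2 < 16 := by nlinarith [norm_nonneg x]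
          have h1 : Real.exp (-16 * c) ≤ e x := Real.exp_le_exp.2 (by nlinarith [norm_nonneg x])
          have := mul_le_mul_of_nonneg_left h1 hK0.le
          linarith
        rw [hF, norm_smul, Real.norm_eq_abs]
        have : |(-2 * c * K * e x)| = 2 * c * (K * e x) := by
          rw [abs_of_nonpos (by have := hep x; nlinarith [mul_pos hK0 this])]; ring
        rw [this]
        nlinarith [mul_le_mul hc1 e1 zero_le_one (by linarith)]
      rw [hgz, if_pos (by linarith [hu.1 x] : 0 < u x + ζ x)]
      rcases (hu.1 x).eq_or_lt with hu0 | hu0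
      · rw [if_neg (by rw [← hu0]; exact lt_irrefl _), grad_zero_of_min hu.1 hu0.symm]
        simp only [sub_zero, zero_add, norm_zero, real_inner_self_eq_norm_sq]
        nlinarith
      · rw [if_pos hu0, add_sub_cancel, inner_sub_right, real_inner_self_eq_norm_sq, norm_sub_sq_real]
        have := real_inner_comm (F x) (∇ u x)
        have h3 : 0 ≤ ‖F x - ∇ u x‖ ^ 2 := sq_nonneg _
        rw [norm_sub_sq_real] at h3
        nlinarith
  have lG : LB (fun x => e x * ⟪∇ ζ x, x⟫_ℝ) := (LB.cont hell.continuous).mul (LB.ix hζll)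
  have lZ := LB.nsq hζll
  have hv := hu.2.2 (fun x => u x + ζ x) (fun x => add_nonneg (hu.1 x) (hζ0 x)) (ll_add hu.2.1 hζll) 0 4
    (fun x hx => by rw [hζ4 x hx, add_zero])
  have h2 := LB.mono_ae (LB.q (ll_add hu.2.1 hζll))
    (((LB.q hu.2.1).add (lG.cmul (-4 * c * K))).sub (lZ.cmul (3/4))) 0 4 (by
      filter_upwards [hpt] with x hx _
      refine hx.trans (le_of_eq ?_)
      rw [hF, real_inner_smul_left, real_inner_comm]; ring)
  rw [LB.isub ((LB.q hu.2.1).add (lG.cmul (-4 * c * K))) (lZ.cmul (3/4)),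
    LB.iadd (LB.q hu.2.1) (lG.cmul (-4 * c * K)), integral_const_mul, integral_const_mul] at h2
  have hG : 0 ≤ ∫ x in ball (0:E) 4, e x * ⟪∇ ζ x, x⟫_ℝ := by
    have d := divx (ψ := fun x => e x * ζ x) (ll_mul hell hζll) (R := 4) (by norm_num)
      (fun x hx => by rw [hζ4 x hx, mul_zero])
    have l3 : LB (fun x => e x * ζ x) := LB.cont (hell.continuous.mul hζll.continuous)
    have l4 : LB (fun x : E => ‖x‖ ^ 2 * (e x * ζ x)) := (LB.cont (by fun_prop)).mul l3
    have e1 : ∫ x in ball (0:E) 4, ⟪∇ (fun x => e x * ζ x) x, x⟫_ℝ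
        = ∫ x in ball (0:E) 4, (e x * ⟪∇ ζ x, x⟫_ℝ - (2 * c) * (‖x‖ ^ 2 * (e x * ζ x))) := by
      refine int_congr _ _ ?_
      filter_upwards [ae_hg hζll] with x hx _
      rw [(hg_mul (heg x) hx).gradient, inner_add_left, real_inner_smul_left, real_inner_smul_left,
        real_inner_smul_left, real_inner_self_eq_norm_sq]
      ring
    rw [e1, LB.isub lG (l4.cmul _), integral_const_mul, ← hc] at d
    have hm : ∫ x in ball (0:E) 4, e x * ζ x ≤ ∫ x in ball (0:E) 4, ‖x‖ ^ 2 * (e x * ζ x) := by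
      refine LB.mono_ae l3 l4 _ _ (Eventually.of_forall fun x _ => ?_)
      rcases le_or_gt ‖x‖ 1 with hx | hx
      · rw [hζ1 x hx]; simp
      · have : 0 ≤ e x * ζ x := mul_nonneg (hep x).le (hζ0 x)
        have h1 : 1 ≤ ‖x‖ ^ 2 := by nlinarith
        nlinarith
    have hp : 0 ≤ ∫ x in ball (0:E) 4, e x * ζ x :=
      setIntegral_nonneg measurableSet_ball (fun x _ => mul_nonneg (hep x).le (hζ0 x))
    nlinarith
  have hZ : ∫ x in ball (0:E) 4, ‖∇ ζ x‖ ^ 2 = 0 := by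
    refine le_antisymm ?_ (setIntegral_nonneg measurableSet_ball (fun x _ => sq_nonneg _))
    have : 0 ≤ c * K * ∫ x in ball (0:E) 4, e x * ⟪∇ ζ x, x⟫_ℝ := mul_nonneg (by positivity) hG
    nlinarith
  rw [setIntegral_eq_zero_iff_of_nonneg_ae (Eventually.of_forall fun x => sq_nonneg _) (lZ.int 0 4)] at hZ
  have hZ2 := (ae_restrict_iff' measurableSet_ball).1 hZ
  obtain ⟨w, hw⟩ : ∃ w : E, ‖w‖ = 5 := exists_norm_eq E (by norm_num)
  have hfin : ∀ x ∈ ball w 10, ζ x = ζ w := by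
    refine const_of_grad hζll (by norm_num) ?_
    filter_upwards [hZ2] with x hx _
    by_cases hxb : x ∈ ball (0:E) 4
    · have := hx hxb
      simpa using this
    · exact grad_zero_of_min hζ0 (hζ4 x hxb)
  intro x hx
  have h5 := hfin x (by
    rw [mem_ball, dist_zero_right] at hx
    rw [mem_ball, dist_eq_norm]
    linarith [norm_sub_le x w])
  rw [hζ4 w (by simp [hw]; norm_num)] at h5
  have h6 := hhp x hx
  have h7 : h x - u x ≤ ζ x := le_max_left _ _
  linarith

end
end AC

open MeasureTheory Metric Set Filter ENNReal NNReal

set_option linter.all false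
namespace AC
open scoped Gradient Topology InnerProductSpace

section
variable {E : Type*} [NormedAddCommGroup E] [InnerProductSpace ℝ E] [FiniteDimensional ℝ E]
variable [MeasureSpace E] [BorelSpace E] [(volume : Measure E).IsAddHaarMeasure]

theorem harnack {u : E → ℝ} (hu : Mz u) {x z : E} {d r s : ℝ} (hpos : ∀ y ∈ ball x d, 0 < u y)
    (hs : dist z x ≤ s) (hr : 0 < r) (hd : r + 2 * s ≤ d) :
    (r / (r + s)) ^ (Module.finrank ℝ E) * u x ≤ u z := by
  have hs0 : 0 ≤ s := dist_nonneg.trans hs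
  have h1 := hu.mv_eq x hr.le (fun y hy => hpos y (ball_subset_ball (by linarith) hy))
  have h2 := hu.mv_eq z (R := r + s) (by linarith) (fun y hy => hpos y (by
    rw [mem_ball] at hy ⊢
    linarith [dist_triangle y z x]))
  have e1 := int_scale1 u x hr
  have e2 := int_scale1 u z (by linarith : 0 < r + s)
  rw [h1] at e1
  rw [h2] at e2
  have h3 : ∫ y in ball x r, u y ≤ ∫ y in ball z (r + s), u y := by
    refine setIntegral_mono_set ((LB.cont hu.2.1.continuous).int _ _) (Eventually.of_forall hu.1) ?_
    refine HasSubset.Subset.eventuallyLE (fun y hy => ?_)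
    rw [mem_ball] at hy ⊢
    linarith [dist_triangle y x z, dist_comm z x]
  rw [e1, e2] at h3
  have hb := bv_pos (E := E)
  have hp : 0 < (r + s) ^ (Module.finrank ℝ E) := by positivity
  rw [div_pow, div_mul_eq_mul_div, div_le_iff₀ hp]
  by_contra hcon
  push Not at hcon
  nlinarith [mul_lt_mul_of_pos_left hcon hb]

theorem liouville {u : E → ℝ} (hu : Mz u) (hpos : ∀ y, 0 < u y) (x z : E) : u x = u z := by
  have key : ∀ x z, u x ≤ u z := by
    intro x z
    have h1 : Tendsto (fun r : ℝ => (r / (r + dist z x)) ^ (Module.finrank ℝ E) * u x) atTop (𝓝 (1 ^ (Module.finrank ℝ E) * u x)) := by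
      refine Tendsto.mul_const _ (Tendsto.pow ?_ _)
      have h2 : Tendsto (fun r : ℝ => 1 - dist z x / (r + dist z x)) atTop (𝓝 (1 - 0)) := by
        refine tendsto_const_nhds.sub ?_
        exact Tendsto.div_atTop tendsto_const_nhds (tendsto_atTop_add_const_right _ _ tendsto_id)
      rw [sub_zero] at h2
      refine h2.congr' ?_
      filter_upwards [eventually_gt_atTop 0] with r hr
      have : r + dist z x ≠ 0 := by positivity
      field_simp; ring
    rw [one_pow, one_mul] at h1
    refine le_of_tendsto h1 ?_
    filter_upwards [eventually_gt_atTop 0] with r hr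
    exact harnack hu (d := r + 2 * dist z x) (fun y _ => hpos y) le_rfl hr le_rfl
  exact le_antisymm (key x z) (key z x)

variable (E) in
noncomputable def CL : ℝ := 2 ^ (Module.finrank ℝ E) * Real.exp (15 * Module.finrank ℝ E)

variable (E) in
theorem CL_pos : 0 < CL E := by unfold CL; positivity

theorem lin_bound [Nontrivial E] {u : E → ℝ} (hu : Mz u) {x z : E} {d : ℝ} (hd : 0 < d)
    (hpos : ∀ y ∈ ball x d, 0 < u y) (hz : dist z x ≤ d) (hz0 : u z = 0) : u x ≤ CL E * d := by
  by_contra hcon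
  push Not at hcon
  have h3 : 0 < d / 3 := by positivity
  have hg := growth (hu.scale x h3) (fun y hy => by
    have hy1 : ‖y‖ ≤ 1 := by simpa using hy
    have h1 := harnack hu (z := x + (d / 3) • y) (s := d / 3) hpos (by
      rw [dist_eq_norm, add_sub_cancel_left, norm_smul, Real.norm_of_nonneg h3.le]
      nlinarith) h3 (by linarith)
    have e : d / 3 / (d / 3 + d / 3) = 2⁻¹ := by field_simp; norm_num
    rw [e] at h1
    have h2 : (d / 3)⁻¹ * ((2⁻¹) ^ (Module.finrank ℝ E) * (CL E * d)) ≤ (d / 3)⁻¹ * u (x + (d / 3) • y) := by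
      refine mul_le_mul_of_nonneg_left (le_trans ?_ h1) (by positivity)
      exact mul_le_mul_of_nonneg_left hcon.le (by positivity)
    refine le_trans ?_ h2
    have e2 : (d / 3)⁻¹ * ((2⁻¹) ^ (Module.finrank ℝ E) * (CL E * d)) = 3 * Real.exp (15 * Module.finrank ℝ E) := by
      rw [CL, inv_pow]; field_simp
    rw [e2]
    linarith [Real.exp_pos (15 * Module.finrank ℝ E)])
  have h4 := hg ((d / 3)⁻¹ • (z - x)) (by
    rw [mem_ball, dist_zero_right, norm_smul, Real.norm_of_nonneg (by positivity), ← dist_eq_norm,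
      inv_mul_lt_iff₀ h3]
    linarith)
  simp only [smul_smul, mul_inv_cancel₀ h3.ne', one_smul, add_sub_cancel, hz0, mul_zero, lt_irrefl] at h4

variable (E) in
noncomputable def LC : ℝ≥0 := ⟨(2 * Module.finrank ℝ E + 3) * CL E, by
  have := (CL_pos E).le
  positivity⟩

theorem Mz.lip [Nontrivial E] {u : E → ℝ} (hu : Mz u) {z0 : E} (hz0 : u z0 = 0) : LipschitzWith (LC E) u := by
  refine LipschitzWith.of_le_add_mul _ (fun z x => ?_)
  have hC := CL_pos E
  set n := Module.finrank ℝ E with hn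
  have hLC : ((LC E : ℝ≥0) : ℝ) = (2 * n + 3) * CL E := rfl
  rw [hLC]
  have hn0 : (0:ℝ) ≤ n := Nat.cast_nonneg _
  have hs0 : 0 ≤ dist z x := dist_nonneg
  have hx0 := hu.1 x
  rcases (hu.1 z).eq_or_lt with h0 | h0
  · rw [← h0]; positivity
  have hZc : IsClosed {y | u y = 0} := isClosed_eq hu.2.1.continuous continuous_const
  obtain ⟨w, hw, hwd⟩ := hZc.exists_infDist_eq_dist ⟨z0, hz0⟩ z
  set D := infDist z {y | u y = 0} with hD
  have hD0 : 0 < D := by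
    rw [hwd]
    refine dist_pos.2 (fun e => ?_)
    rw [e] at h0; exact h0.ne' hw
  have hpos : ∀ y ∈ ball z D, 0 < u y := by
    intro y hy
    refine lt_of_le_of_ne (hu.1 y) (fun e => ?_)
    have := infDist_le_dist_of_mem (x := z) (show y ∈ {y | u y = 0} from e.symm)
    rw [mem_ball, dist_comm] at hy
    linarith
  have hb := lin_bound hu hD0 hpos (by rw [dist_comm, hwd]) hw
  clear_value D n
  set s := dist z x with hs
  clear_value s
  rcases le_or_gt s (D / 3) with h | h
  · have h1 := harnack hu (z := x) (s := s) (r := D - 2 * s) hpos (by rw [dist_comm, hs]) (by linarith) (by linarith)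
    rw [← hn] at h1
    have e : (D - 2 * s) / (D - 2 * s + s) = 1 + -(s / (D - s)) := by
      have : D - s ≠ 0 := by linarith
      have : D - 2 * s + s ≠ 0 := by linarith
      field_simp; ring
    rw [e] at h1
    have hr1 : s / (D - s) ≤ 2 * s / D := by
      rw [div_le_div_iff₀ (by linarith) hD0]; nlinarith
    have hr2 : s / (D - s) ≤ 1 := by rw [div_le_one (by linarith)]; linarith
    have hb2 := one_add_mul_le_pow (a := -(s / (D - s))) (by linarith) n
    have h5 : (1 - n * (2 * s / D)) * u z ≤ u x := by
      refine le_trans (mul_le_mul_of_nonneg_right (le_trans ?_ hb2) h0.le) h1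
      nlinarith
    have h6 : n * (2 * s / D) * u z ≤ n * (2 * s / D) * (CL E * D) :=
      mul_le_mul_of_nonneg_left hb (by positivity)
    have h7 : n * (2 * s / D) * (CL E * D) = 2 * n * CL E * s := by field_simp
    nlinarith [mul_nonneg hC.le hs0]
  · have : CL E * D ≤ 3 * CL E * s := by nlinarith
    have h8 : 0 ≤ 2 * n * CL E * s := by positivity
    nlinarith

end
end AC

open MeasureTheory Metric Set Filter ENNReal NNReal

set_option linter.all false
namespace AC
open scoped Gradient Topology InnerProductSpace

section
variable {E : Type*} [NormedAddCommGroup E] [InnerProductSpace ℝ E] [FiniteDimensional ℝ E]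
variable [MeasureSpace E] [BorelSpace E] [(volume : Measure E).IsAddHaarMeasure]

theorem weak_cs {w : ℕ → E → ℝ} {M : ℝ≥0} (hw : ∀ k, LipschitzWith M (w k))
    (h0 : ∀ x, Tendsto (fun k => w k x) atTop (𝓝 0)) {g : E → ℝ} (hg : HasCompactSupport g)
    (hgs : ContDiff ℝ 1 g) (v : E) :
    Tendsto (fun k => ∫ x, g x * ⟪∇ (w k) x, v⟫_ℝ) atTop (𝓝 0) := by
  obtain ⟨D, hD⟩ := ContDiff.lipschitzWith_of_hasCompactSupport hg hgs one_ne_zero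
  have e : ∀ k, ∫ x, g x * ⟪∇ (w k) x, v⟫_ℝ = ∫ x, fderiv ℝ g x (-v) * w k x := by
    intro k
    have h1 := LipschitzWith.integral_lineDeriv_mul_eq (μ := (volume : Measure E)) (hw k) hD hg v
    have h2 : ∫ x, g x * ⟪∇ (w k) x, v⟫_ℝ = ∫ x, lineDeriv ℝ (w k) x v * g x := by
      refine integral_congr_ae ?_
      filter_upwards [ae_diff (hw k).locallyLipschitz] with x hx
      rw [hx.lineDeriv_eq_fderiv, (of_hg hx.hasGradientAt).fderiv, mul_comm]
      rfl
    rw [h2, h1]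
    refine integral_congr_ae (Eventually.of_forall fun x => ?_)
    simp only
    rw [((hgs.differentiable one_ne_zero) x).lineDeriv_eq_fderiv]
  simp only [e]
  obtain ⟨B, hB⟩ : ∃ B : ℝ, ∀ k, |w k 0| ≤ B := by
    obtain ⟨B, hB⟩ := (h0 0).abs.bddAbove_range
    exact ⟨B, fun k => hB ⟨k, rfl⟩⟩
  have hcf : Continuous (fun x => fderiv ℝ g x (-v)) := (hgs.continuous_fderiv one_ne_zero).clm_apply continuous_const
  have key := tendsto_integral_of_dominated_convergence (μ := (volume : Measure E))
    (F := fun k x => fderiv ℝ g x (-v) * w k x) (f := fun x => fderiv ℝ g x (-v) * 0)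
    (fun x => |fderiv ℝ g x (-v)| * (B + M * ‖x‖))
    (fun k => (hcf.mul (hw k).continuous).aestronglyMeasurable) ?_ ?_ ?_
  · simpa using key
  · refine Continuous.integrable_of_hasCompactSupport (by fun_prop) ?_
    refine HasCompactSupport.mul_right ?_
    refine HasCompactSupport.norm (f := fun x => fderiv ℝ g x (-v)) ?_
    exact (hg.fderiv_apply (𝕜 := ℝ) (-v))
  · intro k
    refine Eventually.of_forall fun x => ?_
    rw [Real.norm_eq_abs, abs_mul]
    refine mul_le_mul_of_nonneg_left ?_ (abs_nonneg _)
    have h1 := (hw k).dist_le_mul x 0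
    rw [Real.dist_eq, dist_zero_right] at h1
    have := abs_sub_abs_le_abs_sub (w k x) (w k 0)
    linarith [hB k]
  · exact Eventually.of_forall fun x => (h0 x).const_mul _

theorem weak0 {w : ℕ → E → ℝ} {M : ℝ≥0} (hw : ∀ k, LipschitzWith M (w k))
    (h0 : ∀ x, Tendsto (fun k => w k x) atTop (𝓝 0)) {g : E → ℝ} (hg : Integrable g) (v : E) :
    Tendsto (fun k => ∫ x, g x * ⟪∇ (w k) x, v⟫_ℝ) atTop (𝓝 0) := by
  rw [Metric.tendsto_atTop]
  intro ε hε
  set A : ℝ := M * ‖v‖ + 1 with hA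
  have hA0 : 0 < A := by positivity
  obtain ⟨g', hg'c, hg's, hg'⟩ := MemLp.exist_eLpNorm_sub_le (μ := (volume : Measure E)) (p := 1) (by simp) le_rfl
    (memLp_one_iff_integrable.2 hg) (ε := ε / (2 * A)) (by positivity)
  have hg's1 : ContDiff ℝ 1 g' := hg's.of_le (by simp)
  have hg'i : Integrable g' := hg's1.continuous.integrable_of_hasCompactSupport hg'c
  have hgi : Integrable (fun x => g x - g' x) := hg.sub hg'i
  have hL1 : ∫ x, |g x - g' x| ≤ ε / (2 * A) := by
    have h1 : ENNReal.ofReal (∫ x, |g x - g' x|) ≤ ENNReal.ofReal (ε / (2 * A)) := by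
      refine le_trans (le_of_eq ?_) hg'
      rw [eLpNorm_one_eq_lintegral_enorm, ofReal_integral_eq_lintegral_ofReal hgi.abs
        (Eventually.of_forall fun x => abs_nonneg _)]
      congr 1; ext x
      rw [← Real.enorm_abs, Real.enorm_of_nonneg (abs_nonneg _)]
      rfl
    exact (ENNReal.ofReal_le_ofReal_iff (by positivity)).1 h1
  obtain ⟨N, hN⟩ := Metric.tendsto_atTop.1 (weak_cs hw h0 hg'c hg's1 v) (ε / 2) (by positivity)
  refine ⟨N, fun k hk => ?_⟩
  have h1 := hN k hk
  rw [Real.dist_eq, sub_zero] at h1 ⊢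
  have hb : ∀ x, |⟪∇ (w k) x, v⟫_ℝ| ≤ A := by
    intro x
    refine (abs_real_inner_le_norm _ _).trans ?_
    have := grad_norm_le ((hw k).lipschitzOnWith (s := univ)) (univ_mem : univ ∈ 𝓝 x)
    have := mul_le_mul_of_nonneg_right this (norm_nonneg v)
    linarith
  have hm : Measurable (fun x => ⟪∇ (w k) x, v⟫_ℝ) := (meas_grad _).inner measurable_const
  have i1 : ∀ f : E → ℝ, Integrable f → Integrable (fun x => f x * ⟪∇ (w k) x, v⟫_ℝ) := fun f hf =>
    hf.mul_bdd (c := A) hm.aestronglyMeasurable (Eventually.of_forall hb)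
  have e : ∫ x, g x * ⟪∇ (w k) x, v⟫_ℝ = (∫ x, g' x * ⟪∇ (w k) x, v⟫_ℝ)
      + ∫ x, (g x - g' x) * ⟪∇ (w k) x, v⟫_ℝ := by
    rw [← integral_add (i1 _ hg'i) (i1 _ hgi)]
    congr 1; ext x; ring
  have h2 : |∫ x, (g x - g' x) * ⟪∇ (w k) x, v⟫_ℝ| ≤ ∫ x, A * |g x - g' x| := by
    rw [← Real.norm_eq_abs]
    refine norm_integral_le_of_norm_le (hgi.abs.const_mul A) (Eventually.of_forall fun x => ?_)
    rw [Real.norm_eq_abs, abs_mul, mul_comm]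
    exact mul_le_mul_of_nonneg_right (hb x) (abs_nonneg _)
  rw [integral_const_mul] at h2
  have h3 : A * ∫ x, |g x - g' x| ≤ ε / 2 := by
    refine (mul_le_mul_of_nonneg_left hL1 hA0.le).trans (le_of_eq ?_)
    field_simp
  rw [e]
  refine (abs_add_le _ _).trans_lt ?_
  linarith

theorem weakG {w : ℕ → E → ℝ} {M : ℝ≥0} (hw : ∀ k, LipschitzWith M (w k))
    (h0 : ∀ x, Tendsto (fun k => w k x) atTop (𝓝 0)) {u : E → ℝ} (hu : LocallyLipschitz u) (c : E) (R : ℝ) :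
    Tendsto (fun k => ∫ x in ball c R, ⟪∇ u x, ∇ (w k) x⟫_ℝ) atTop (𝓝 0) := by
  set b := stdOrthonormalBasis ℝ E
  have lb : ∀ {f : E → ℝ} (hf : LocallyLipschitz f) i, LB (fun x => ⟪∇ f x, b i⟫_ℝ) := by
    intro f hf i
    refine ⟨(meas_grad _).inner measurable_const, fun c R => ?_⟩
    obtain ⟨L, hL0, hL⟩ := grad_bdd hf c R
    exact ⟨L * ‖b i‖, fun x hx => (abs_real_inner_le_norm _ _).trans
      (mul_le_mul_of_nonneg_right (hL x hx) (norm_nonneg _))⟩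
  have e : ∀ k, ∫ x in ball c R, ⟪∇ u x, ∇ (w k) x⟫_ℝ
      = ∑ i, ∫ x, (ball c R).indicator (fun x => ⟪∇ u x, b i⟫_ℝ) x * ⟪∇ (w k) x, b i⟫_ℝ := by
    intro k
    have h1 : ∀ x, ⟪∇ u x, ∇ (w k) x⟫_ℝ = ∑ i, ⟪∇ u x, b i⟫_ℝ * ⟪∇ (w k) x, b i⟫_ℝ := by
      intro x
      rw [← b.sum_inner_mul_inner]
      refine Finset.sum_congr rfl fun i _ => ?_
      rw [real_inner_comm (∇ (w k) x)]
    simp only [h1]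
    rw [integral_finsetSum _ (fun i _ => ((lb hu i).mul (lb (hw k).locallyLipschitz i)).int c R)]
    refine Finset.sum_congr rfl fun i _ => ?_
    rw [← integral_indicator measurableSet_ball]
    congr 1; ext x
    by_cases hx : x ∈ ball c R <;> simp [hx]
  simp only [e]
  have : (0:ℝ) = ∑ i : Fin (Module.finrank ℝ E), 0 := by simp
  rw [this]
  refine tendsto_finsetSum _ fun i _ => weak0 hw h0 ?_ (b i)
  exact (integrable_indicator_iff measurableSet_ball).2 ((lb hu i).int c R)

end
end AC

open MeasureTheory Metric Set Filter ENNReal NNReal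

set_option linter.all false
namespace AC
open scoped Gradient Topology InnerProductSpace

section
variable {E : Type*} [NormedAddCommGroup E] [InnerProductSpace ℝ E] [FiniteDimensional ℝ E]
variable [MeasureSpace E] [BorelSpace E] [(volume : Measure E).IsAddHaarMeasure]

theorem dctb {f : ℕ → E → ℝ} {g : E → ℝ} {c : E} {R C : ℝ} (hm : ∀ k, Measurable (f k))
    (hb : ∀ k, ∀ x ∈ ball c R, |f k x| ≤ C) (hl : ∀ᵐ x : E, x ∈ ball c R → Tendsto (fun k => f k x) atTop (𝓝 (g x))) :
    Tendsto (fun k => ∫ x in ball c R, f k x) atTop (𝓝 (∫ x in ball c R, g x)) := by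
  refine tendsto_integral_of_dominated_convergence (fun _ => C) (fun k => (hm k).aestronglyMeasurable)
    ((LB.const C).int c R) (fun k => ?_) ?_
  · exact (ae_restrict_iff' measurableSet_ball).2 (Eventually.of_forall (hb k))
  · exact (ae_restrict_iff' measurableSet_ball).2 hl

theorem lip_bdd {w : ℕ → E → ℝ} {M : ℝ≥0} (hw : ∀ k, LipschitzWith M (w k)) {a : ℝ} {x0 : E}
    (h0 : Tendsto (fun k => w k x0) atTop (𝓝 a)) (c : E) (R : ℝ) : ∃ C : ℝ, 0 ≤ C ∧ ∀ k, ∀ x ∈ ball c R, |w k x| ≤ C := by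
  obtain ⟨B, hB⟩ := h0.abs.bddAbove_range
  have hB' : ∀ k, |w k x0| ≤ B := fun k => hB ⟨k, rfl⟩
  refine ⟨B + M * (|R| + dist c x0), add_nonneg ((abs_nonneg _).trans (hB' 0)) (by positivity), fun k x hx => ?_⟩
  have h1 := (hw k).dist_le_mul x x0
  rw [Real.dist_eq] at h1
  rw [mem_ball] at hx
  have h2 : dist x x0 ≤ |R| + dist c x0 := (dist_triangle x c x0).trans (by linarith [le_abs_self R])
  have h3 := mul_le_mul_of_nonneg_left h2 M.2
  have := abs_sub_abs_le_abs_sub (w k x) (w k x0)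
  have h4 : (M : ℝ) * dist x x0 ≤ M * (|R| + dist c x0) := h3
  linarith [hB' k]

theorem lip_lim {u : ℕ → E → ℝ} {u0 : E → ℝ} {M : ℝ≥0} (hu : ∀ k, LipschitzWith M (u k))
    (h0 : ∀ x, Tendsto (fun k => u k x) atTop (𝓝 (u0 x))) : LipschitzWith M u0 := by
  refine LipschitzWith.of_dist_le_mul fun x y => ?_
  exact le_of_tendsto ((h0 x).dist (h0 y)) (Eventually.of_forall fun k => (hu k).dist_le_mul x y)

noncomputable def cut (c : E) (R δ : ℝ) (x : E) : ℝ := max (min (δ⁻¹ * (R + δ - dist x c)) 1) 0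

theorem cut_lip (c : E) (R : ℝ) {δ : ℝ} (hδ : 0 < δ) : LipschitzWith (Real.toNNReal δ⁻¹) (cut c R δ) := by
  refine LipschitzWith.max_const (LipschitzWith.min_const ?_ 1) 0
  refine LipschitzWith.of_le_add_mul _ fun x y => ?_
  rw [Real.coe_toNNReal _ (by positivity), ← mul_add]
  refine mul_le_mul_of_nonneg_left ?_ (by positivity)
  linarith [dist_triangle y x c, dist_comm x y]

theorem cut_in (c : E) (R : ℝ) {δ : ℝ} (hδ : 0 < δ) {x : E} (hx : x ∈ ball c R) : cut c R δ x = 1 := by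
  rw [mem_ball] at hx
  have : 1 ≤ δ⁻¹ * (R + δ - dist x c) := by
    rw [← div_eq_inv_mul, one_le_div hδ]; linarith
  rw [cut, min_eq_right this]; simp

theorem cut_out (c : E) (R : ℝ) {δ : ℝ} (hδ : 0 < δ) {x : E} (hx : x ∉ ball c (R + δ)) : cut c R δ x = 0 := by
  rw [mem_ball, not_lt] at hx
  have : δ⁻¹ * (R + δ - dist x c) ≤ 0 := mul_nonpos_of_nonneg_of_nonpos (by positivity) (by linarith)
  exact max_eq_right ((min_le_left _ _).trans this)

theorem cut_nonneg (c : E) (R δ : ℝ) (x : E) : 0 ≤ cut c R δ x := le_max_right _ _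
theorem cut_le (c : E) (R δ : ℝ) (x : E) : cut c R δ x ≤ 1 := max_le (min_le_right _ _) zero_le_one

theorem lip_grad {f : E → ℝ} {M : ℝ≥0} (h : LipschitzWith M f) (x : E) : ‖∇ f x‖ ≤ M :=
  grad_norm_le (h.lipschitzOnWith (s := univ)) (univ_mem : univ ∈ 𝓝 x)

theorem Mz_limit {u : ℕ → E → ℝ} {u0 : E → ℝ} {L : ℝ≥0} (hL : ∀ k, LipschitzWith L (u k))
    (hu : ∀ k, Mz (u k)) (h0 : ∀ x, Tendsto (fun k => u k x) atTop (𝓝 (u0 x))) : Mz u0 := by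
  have hL0 : LipschitzWith L u0 := lip_lim hL h0
  have hu0 : LocallyLipschitz u0 := hL0.locallyLipschitz
  have hnn : ∀ x, 0 ≤ u0 x := fun x => ge_of_tendsto' (h0 x) (fun k => (hu k).1 x)
  refine ⟨hnn, hu0, fun v hv0 hv c R hvu => ?_⟩
  rcases le_or_gt R 0 with hR | hR
  · rw [ball_eq_empty.2 hR]; simp
  set n := Module.finrank ℝ E with hn
  set w : ℕ → E → ℝ := fun k x => u k x - u0 x with hw
  have hwL : ∀ k, LipschitzWith (L + L) (w k) := fun k => (hL k).sub hL0
  have hw0 : ∀ x, Tendsto (fun k => w k x) atTop (𝓝 0) := fun x => by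
    simpa using (h0 x).sub_const (u0 x)
  have hwll : ∀ k, LocallyLipschitz (w k) := fun k => (hwL k).locallyLipschitz
  have tb := weakG hwL hw0 hu0 c R
  have ta : Tendsto (fun k => ∫ x in ball c R, max ((if 0 < u0 x then (1:ℝ) else 0) - if 0 < u k x then 1 else 0) 0) atTop
      (𝓝 (∫ x in ball c R, (0:ℝ))) := by
    refine dctb (C := 1) (fun k => (((LB.ind hu0.continuous).sub (LB.ind (hu k).2.1.continuous)).1.max measurable_const)) ?_ ?_
    · intro k x _
      split_ifs <;> simp
    · refine Eventually.of_forall fun x _ => ?_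
      by_cases hx : 0 < u0 x
      · refine tendsto_const_nhds.congr' ?_
        filter_upwards [(h0 x).eventually_const_lt hx] with k hk
        simp [hx, hk]
      · refine tendsto_const_nhds.congr fun k => ?_
        rw [if_neg hx]; split_ifs <;> simp
  have tc : ∀ ρ, Tendsto (fun k => ∫ x in ball c ρ, w k x ^ 2) atTop (𝓝 (∫ x in ball c ρ, (0:ℝ))) := by
    intro ρ
    obtain ⟨C, hC0, hC⟩ := lip_bdd hwL (hw0 0) c ρ
    refine dctb (C := C ^ 2) (fun k => ((hwL k).continuous.pow 2).measurable) (fun k x hx => ?_) ?_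
    · rw [abs_pow]; exact pow_le_pow_left₀ (abs_nonneg _) (hC k x hx) 2
    · refine Eventually.of_forall fun x _ => ?_
      simpa using (hw0 x).pow 2
  simp only [integral_zero] at ta tc
  set C1 : ℝ := 1 + 18 * (L:ℝ) ^ 2 with hC1
  set K1 : ℝ := ∫ y in ball (0:E) 1, C1 with hK1
  have lower : ∀ k, (∫ x in ball c R, q u0 x) ≤ (∫ x in ball c R, q (u k) x)
      - 2 * (∫ x in ball c R, ⟪∇ u0 x, ∇ (w k) x⟫_ℝ)
      + ∫ x in ball c R, max ((if 0 < u0 x then (1:ℝ) else 0) - if 0 < u k x then 1 else 0) 0 := by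
    intro k
    have l1 := LB.q (hu k).2.1
    have l2 := LB.inner hu0 (hwll k)
    have l3 : LB (fun x => max ((if 0 < u0 x then (1:ℝ) else 0) - if 0 < u k x then 1 else 0) 0) := by
      refine ⟨(((LB.ind hu0.continuous).sub (LB.ind (hu k).2.1.continuous)).1.max measurable_const), fun _ _ => ⟨1, fun x _ => ?_⟩⟩
      show |max ((if 0 < u0 x then (1:ℝ) else 0) - if 0 < u k x then 1 else 0) 0| ≤ 1
      split_ifs <;> simp
    rw [← integral_const_mul, ← LB.isub l1 (l2.cmul 2), ← LB.iadd (l1.sub (l2.cmul 2)) l3]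
    refine LB.mono_ae (LB.q hu0) ((l1.sub (l2.cmul 2)).add l3) _ _ ?_
    filter_upwards [ae_hg hu0, ae_hg (hu k).2.1] with x hx hxk _
    have hwg : ∇ (w k) x = ∇ (u k) x - ∇ u0 x := (hg_sub hxk hx).gradient
    rw [hwg, inner_sub_right, real_inner_self_eq_norm_sq]
    simp only [q]
    have h1 := norm_sub_sq_real (∇ u0 x) (∇ (u k) x)
    have h2 := le_max_left ((if 0 < u0 x then (1:ℝ) else 0) - if 0 < u k x then 1 else 0) 0
    nlinarith [sq_nonneg ‖∇ u0 x - ∇ (u k) x‖]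
  have upper : ∀ δ, 0 < δ → ∀ k, (∫ x in ball c R, q (u k) x) ≤ (∫ x in ball c R, q v x)
      + K1 * ((R + δ) ^ n - R ^ n) + 2 * δ⁻¹ ^ 2 * ∫ x in ball c (R + δ), w k x ^ 2 := by
    intro δ hδ k
    set η := cut c R δ with hη
    have hηll : LocallyLipschitz η := (cut_lip c R hδ).locallyLipschitz
    set vk : E → ℝ := fun x => v x + (1 - η x) * w k x with hvk
    have hvkll : LocallyLipschitz vk := ll_add hv (ll_mul (ll_sub (LocallyLipschitz.const 1) hηll) (hwll k))
    have hin : ∀ x ∈ ball c R, vk x = v x := fun x hx => by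
      simp only [hvk, hη]; rw [cut_in c R hδ hx]; ring
    have hm := (hu k).2.2 vk (fun x => by
      by_cases hx : x ∈ ball c R
      · rw [hin x hx]; exact hv0 x
      · have e : vk x = η x * u0 x + (1 - η x) * u k x := by
          simp only [hvk, hvu x hx, hw]; ring
        rw [e]
        exact add_nonneg (mul_nonneg (cut_nonneg _ _ _ _) (hnn x))
          (mul_nonneg (sub_nonneg.2 (cut_le _ _ _ _)) ((hu k).1 x))) hvkll c (R + δ) (fun x hx => by
      have hx' : x ∉ ball c R := fun h => hx (ball_subset_ball (by linarith) h)
      simp only [hvk, hη, hw]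
      rw [cut_out c R hδ hx, hvu x hx']; ring)
    have hsub : ball c R ⊆ ball c (R + δ) := ball_subset_ball (by linarith)
    have h1 : (∫ x in ball c R, q (u k) x) ≤ ∫ x in ball c (R + δ), q (u k) x :=
      setIntegral_mono_set ((LB.q (hu k).2.1).int _ _) (Eventually.of_forall fun x => q_nonneg _ x)
        (HasSubset.Subset.eventuallyLE hsub)
    have lw : LB (fun x => w k x ^ 2) := LB.cont ((hwL k).continuous.pow 2)
    have lG : LB (fun x => C1 + 2 * δ⁻¹ ^ 2 * w k x ^ 2) := (LB.const C1).add (lw.cmul (2 * δ⁻¹ ^ 2))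
    have hd : ∫ x in ball c (R + δ) \ ball c R, q vk x ≤ ∫ x in ball c (R + δ) \ ball c R, (C1 + 2 * δ⁻¹ ^ 2 * w k x ^ 2) := by
      refine setIntegral_mono_on_ae (((LB.q hvkll).int c (R + δ)).mono_set diff_subset)
        ((lG.int c (R + δ)).mono_set diff_subset) (measurableSet_ball.diff measurableSet_ball) ?_
      have hsph : ∀ᵐ x : E, x ∉ sphere c R :=
        measure_eq_zero_iff_ae_notMem.1 (Measure.addHaar_sphere_of_ne_zero volume c hR.ne')
      filter_upwards [hsph, ae_hg hu0, ae_hg (hwll k), ae_hg hηll] with x hxs hx hxw hxη hxd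
      have hxo : x ∈ (closedBall c R)ᶜ := by
        intro hc
        rcases (mem_closedBall.1 hc).lt_or_eq with h | h
        · exact hxd.2 h
        · exact hxs h
      have e1 : ∇ vk x = ∇ (fun x => u0 x + (1 - η x) * w k x) x := by
        refine grad_congr_open isClosed_closedBall.isOpen_compl (fun y hy => ?_) hxo
        simp only [hvk]
        rw [hvu y (fun h => hy (ball_subset_closedBall h))]
      have e2 := hg_add hx (hg_mul (hg_sub (hasGradientAt_const x (1:ℝ)) hxη) hxw)
      rw [e2.gradient] at e1
      have n1 : ‖∇ vk x‖ ≤ 3 * L + δ⁻¹ * |w k x| := by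
        rw [e1]
        refine (norm_add_le _ _).trans ?_
        have a1 := lip_grad hL0 x
        have a2 := lip_grad (hwL k) x
        have a3 := lip_grad (cut_lip c R hδ) x
        rw [Real.coe_toNNReal _ (by positivity)] at a3
        have a4 : ‖(1 - η x) • ∇ (w k) x‖ ≤ 2 * L := by
          rw [norm_smul, Real.norm_of_nonneg (sub_nonneg.2 (cut_le _ _ _ _))]
          push_cast at a2
          have := cut_nonneg c R δ x
          nlinarith [norm_nonneg (∇ (w k) x), cut_le c R δ x]
        have a5 : ‖w k x • (0 - ∇ η x)‖ ≤ δ⁻¹ * |w k x| := by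
          rw [norm_smul, zero_sub, norm_neg, mul_comm, Real.norm_eq_abs]
          exact mul_le_mul_of_nonneg_right a3 (abs_nonneg _)
        have := norm_add_le ((1 - η x) • ∇ (w k) x) (w k x • (0 - ∇ η x))
        linarith
      have n2 : ‖∇ vk x‖ ^ 2 ≤ 18 * (L:ℝ) ^ 2 + 2 * (δ⁻¹ ^ 2 * w k x ^ 2) := by
        have := pow_le_pow_left₀ (norm_nonneg _) n1 2
        have hs := sq_abs (w k x)
        nlinarith [sq_nonneg (3 * (L:ℝ) - δ⁻¹ * |w k x|)]
      have n3 : (if 0 < vk x then (1:ℝ) else 0) ≤ 1 := by split_ifs <;> norm_num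
      simp only [q]
      linarith
    rw [integral_diff measurableSet_ball ((LB.q hvkll).int _ _) hsub,
      integral_diff measurableSet_ball (lG.int _ _) hsub, LB.iadd (LB.const C1) (lw.cmul _),
      LB.iadd (LB.const C1) (lw.cmul _), int_scale1 (fun _ => C1) c hR,
      int_scale1 (fun _ => C1) c (by linarith : 0 < R + δ), integral_const_mul, integral_const_mul, ← hn, ← hK1] at hd
    have h2 : ∫ x in ball c R, q vk x = ∫ x in ball c R, q v x := by
      refine int_congr _ _ (Eventually.of_forall fun x hx => ?_)
      simp only [q]
      rw [hin x hx, grad_congr_open isOpen_ball hin hx]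
    have h3 : 0 ≤ 2 * δ⁻¹ ^ 2 * ∫ x in ball c R, w k x ^ 2 :=
      mul_nonneg (by positivity) (setIntegral_nonneg measurableSet_ball fun x _ => sq_nonneg _)
    rw [h2] at hd
    linarith
  have hδ : ∀ δ, 0 < δ → (∫ x in ball c R, q u0 x) ≤ (∫ x in ball c R, q v x) + K1 * ((R + δ) ^ n - R ^ n) := by
    intro δ hδ
    have t := (((tc (R + δ)).const_mul (2 * δ⁻¹ ^ 2)).const_add
      ((∫ x in ball c R, q v x) + K1 * ((R + δ) ^ n - R ^ n))).sub (tb.const_mul 2) |>.add ta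
    simp only [mul_zero, add_zero, sub_zero] at t
    refine ge_of_tendsto' t fun k => ?_
    have := lower k
    have := upper δ hδ k
    linarith
  have t : Tendsto (fun δ : ℝ => (∫ x in ball c R, q v x) + K1 * ((R + δ) ^ n - R ^ n)) (𝓝[>] 0)
      (𝓝 ((∫ x in ball c R, q v x) + K1 * ((R + 0) ^ n - R ^ n))) := by
    have : Continuous (fun δ : ℝ => (∫ x in ball c R, q v x) + K1 * ((R + δ) ^ n - R ^ n)) := by fun_prop
    exact this.continuousAt.tendsto.mono_left nhdsWithin_le_nhds
  simp only [add_zero, sub_self, mul_zero] at t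
  exact ge_of_tendsto t (by filter_upwards [self_mem_nhdsWithin] with δ hd using hδ δ hd)

end
end AC

open MeasureTheory Metric Set Filter ENNReal NNReal

set_option linter.all false
namespace AC
open scoped Gradient Topology InnerProductSpace

section
variable {E : Type*} [NormedAddCommGroup E] [InnerProductSpace ℝ E] [FiniteDimensional ℝ E]
variable [MeasureSpace E] [BorelSpace E] [(volume : Measure E).IsAddHaarMeasure]

theorem lip_extract {f : ℕ → E → ℝ} {L : ℝ≥0} (hL : ∀ k, LipschitzWith L (f k)) {C : ℝ}
    (h0 : ∀ k, |f k 0| ≤ C) : ∃ (φ : ℕ → ℕ) (g : E → ℝ), StrictMono φ ∧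
      ∀ x, Tendsto (fun k => f (φ k) x) atTop (𝓝 (g x)) := by
  set d := TopologicalSpace.denseSeq E with hd
  have hdd : DenseRange d := TopologicalSpace.denseRange_denseSeq E
  have hb : ∀ k x, f k x ∈ Icc (-(C + L * ‖x‖)) (C + L * ‖x‖) := by
    intro k x
    have h1 := (hL k).dist_le_mul x 0
    rw [Real.dist_eq, dist_zero_right] at h1
    rw [mem_Icc, ← abs_le]
    have := abs_sub_abs_le_abs_sub (f k x) (f k 0)
    linarith [h0 k]
  have hcomp : IsCompact (Set.pi univ fun i : ℕ => Icc (-(C + L * ‖d i‖)) (C + L * ‖d i‖)) :=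
    isCompact_univ_pi fun i => isCompact_Icc
  obtain ⟨a, -, φ, hφ, ha⟩ := hcomp.tendsto_subseq (x := fun k i => f k (d i)) (fun k i _ => hb k (d i))
  have ha' : ∀ i, Tendsto (fun k => f (φ k) (d i)) atTop (𝓝 (a i)) := fun i => (tendsto_pi_nhds.1 ha) i
  have hc : ∀ x, CauchySeq (fun k => f (φ k) x) := by
    intro x
    rw [Metric.cauchySeq_iff']
    intro ε hε
    obtain ⟨i, hi⟩ := hdd.exists_dist_lt x (ε := ε / (4 * (L + 1))) (by positivity)
    obtain ⟨N, hN⟩ := Metric.cauchySeq_iff'.1 (ha' i).cauchySeq (ε / 4) (by positivity)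
    refine ⟨N, fun n hn => ?_⟩
    have h1 := (hL (φ n)).dist_le_mul x (d i)
    have h2 := (hL (φ N)).dist_le_mul (d i) x
    have h3 := hN n hn
    have h4 : L * dist x (d i) ≤ ε / 4 := by
      have : (L:ℝ) * dist x (d i) ≤ (L + 1) * (ε / (4 * (L + 1))) :=
        mul_le_mul (by linarith) hi.le dist_nonneg (by positivity)
      refine this.trans (le_of_eq ?_)
      field_simp
    rw [dist_comm (d i) x] at h2
    have := dist_triangle4 (f (φ n) x) (f (φ n) (d i)) (f (φ N) (d i)) (f (φ N) x)
    linarith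
  choose g hg using fun x => cauchySeq_tendsto_of_complete (hc x)
  exact ⟨φ, g, hφ, hg⟩

theorem Phi_mono [Nontrivial E] {u : E → ℝ} (hu : Mz u) (p : E) : MonotoneOn (Phi u p) (Ioi 0) := by
  refine monotoneOn_of_deriv_nonneg (convex_Ioi 0)
    (fun r hr => (Phi_deriv hu p hr).continuousAt.continuousWithinAt)
    (fun r hr => (Phi_deriv hu p (by simpa using hr)).differentiableAt.differentiableWithinAt) (fun r hr => ?_)
  rw [interior_Ioi, mem_Ioi] at hr
  rw [(Phi_deriv hu p hr).deriv]
  have : 0 ≤ ∫ y in ball (0:E) 1, (dd u p r y - us u p r y) ^ 2 := integral_nonneg fun _ => sq_nonneg _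
  positivity

theorem Phi_bdd {u : E → ℝ} (hu : LocallyLipschitz u) {L : ℝ≥0} (hL : LipschitzWith L u) (p : E) :
    ∃ C, ∀ r, Phi u p r ≤ C := by
  refine ⟨∫ y in ball (0:E) 1, (L:ℝ) ^ 2 + 1, fun r => ?_⟩
  have h1 : (∫ y in ball (0:E) 1, q u (p + r • y) * (1 - ‖y‖ ^ 2)) ≤ ∫ y in ball (0:E) 1, (L:ℝ) ^ 2 + 1 := by
    refine LB.mono_ae (((LB.q hu).scale p r).mul (LB.cont (by fun_prop))) (LB.const _) _ _ (Eventually.of_forall fun y hy => ?_)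
    have h1 := norm_lt_one_of_mem hy
    have h2 : q u (p + r • y) ≤ (L:ℝ) ^ 2 + 1 := by
      unfold q
      have := pow_le_pow_left₀ (norm_nonneg _) (lip_grad hL (p + r • y)) 2
      split_ifs <;> linarith
    have h3 := q_nonneg u (p + r • y)
    nlinarith [sq_nonneg ‖y‖, norm_nonneg y]
  have h2 : 0 ≤ Nf u p r := integral_nonneg fun _ => sq_nonneg _
  unfold Phi; linarith

theorem Gf_bound [Nontrivial E] {u : E → ℝ} (hu : Mz u) (p : E) {a b : ℝ} (ha : 0 < a) (hab : a ≤ b) :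
    ∫ y in ball (0:E) 1, (us u p b y - us u p a y) ^ 2 ≤ b * (Phi u p b - Phi u p a) / (4 * a) := by
  have la := us_LB hu.2.1 p a
  set G : ℝ → ℝ := fun r => Nf u p r - 2 * (∫ y in ball (0:E) 1, us u p a y * us u p r y) + Nf u p a with hG
  have hGe : ∀ r, G r = ∫ y in ball (0:E) 1, (us u p r y - us u p a y) ^ 2 := by
    intro r
    have lr := us_LB hu.2.1 p r
    simp only [hG, Nf]
    rw [← integral_const_mul, ← LB.isub (lr.pow 2) ((la.mul lr).cmul 2), ← LB.iadd ((lr.pow 2).sub ((la.mul lr).cmul 2)) (la.pow 2)]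
    refine int_congr _ _ (Eventually.of_forall fun y _ => by ring)
  have hder : ∀ r, 0 < r → ∃ G', HasDerivAt G G' r ∧
      G' ≤ r⁻¹ * G r + r⁻¹ * ∫ y in ball (0:E) 1, (dd u p r y - us u p r y) ^ 2 := by
    intro r hr
    have lr := us_LB hu.2.1 p r
    have ld := (dd_LB hu.2.1 p r).sub lr
    refine ⟨_, ((Nf_deriv hu.2.1 p hr).sub ((us_hd hu.2.1 la p hr).const_mul 2)).add_const _, ?_⟩
    rw [hGe]
    have e : (2 * r⁻¹ * ∫ y in ball (0:E) 1, us u p r y * (dd u p r y - us u p r y)) -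
        2 * (r⁻¹ * ∫ y in ball (0:E) 1, us u p a y * (dd u p r y - us u p r y))
        = r⁻¹ * (2 * ∫ y in ball (0:E) 1, (us u p r y * (dd u p r y - us u p r y) - us u p a y * (dd u p r y - us u p r y))) := by
      rw [LB.isub (lr.mul ld) (la.mul ld)]; ring
    rw [e, ← mul_add, ← LB.iadd ((lr.sub la).pow 2) (ld.pow 2), ← integral_const_mul]
    refine mul_le_mul_of_nonneg_left ?_ (by positivity)
    refine LB.mono_ae (((lr.mul ld).sub (la.mul ld)).cmul 2) (((lr.sub la).pow 2).add (ld.pow 2)) _ _ (Eventually.of_forall fun y _ => ?_)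
    nlinarith [sq_nonneg ((us u p r y - us u p a y) - (dd u p r y - us u p r y))]
  have hanti : AntitoneOn (fun r => r⁻¹ * G r - (4 * a)⁻¹ * Phi u p r) (Ici a) := by
    have hd : ∀ r, a ≤ r → ∃ h', HasDerivAt (fun r => r⁻¹ * G r - (4 * a)⁻¹ * Phi u p r) h' r ∧ h' ≤ 0 := by
      intro r har
      have hr : 0 < r := ha.trans_le har
      obtain ⟨G', h1, h2⟩ := hder r hr
      refine ⟨_, ((hasDerivAt_inv hr.ne').mul h1).sub ((Phi_deriv hu p hr).const_mul _), ?_⟩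
      set S := ∫ y in ball (0:E) 1, (dd u p r y - us u p r y) ^ 2 with hS
      have hS0 : 0 ≤ S := integral_nonneg fun _ => sq_nonneg _
      have e1 : r⁻¹ * G' ≤ r⁻¹ * (r⁻¹ * G r + r⁻¹ * S) := mul_le_mul_of_nonneg_left h2 (by positivity)
      have e2 : r⁻¹ * (r⁻¹ * S) ≤ a⁻¹ * (r⁻¹ * S) := mul_le_mul_of_nonneg_right ((inv_le_inv₀ hr ha).2 har) (by positivity)
      have e3 : -(r ^ 2)⁻¹ * G r = - (r⁻¹ * (r⁻¹ * G r)) := by field_simp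
      have e4 : (4 * a)⁻¹ * (4 * r⁻¹ * S) = a⁻¹ * (r⁻¹ * S) := by field_simp
      rw [e3, e4]; linarith
    refine antitoneOn_of_deriv_nonpos (convex_Ici a) (fun r hr => ?_) (fun r hr => ?_) (fun r hr => ?_)
    · obtain ⟨h', h1, -⟩ := hd r hr
      exact h1.continuousAt.continuousWithinAt
    · rw [interior_Ici, mem_Ioi] at hr
      obtain ⟨h', h1, -⟩ := hd r hr.le
      exact h1.differentiableAt.differentiableWithinAt
    · rw [interior_Ici, mem_Ioi] at hr
      obtain ⟨h', h1, h2⟩ := hd r hr.le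
      rwa [h1.deriv]
  have h := hanti (mem_Ici.2 le_rfl) (mem_Ici.2 hab) hab
  have hGa : G a = 0 := by rw [hGe]; simp
  simp only [hGa, mul_zero, zero_sub] at h
  rw [← hGe]
  have hb : 0 < b := ha.trans_le hab
  have h2 : b⁻¹ * G b ≤ (4 * a)⁻¹ * (Phi u p b - Phi u p a) := by linarith
  have h3 : b * (b⁻¹ * G b) ≤ b * ((4 * a)⁻¹ * (Phi u p b - Phi u p a)) := mul_le_mul_of_nonneg_left h2 hb.le
  rw [mul_inv_cancel_left₀ hb.ne'] at h3
  refine h3.trans (le_of_eq ?_)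
  field_simp

theorem blow_hom [Nontrivial E] {u W : E → ℝ} (hu : Mz u) {L : ℝ≥0} (hL : LipschitzWith L u) {t : ℕ → ℝ}
    (ht : Tendsto t atTop atTop) (ht0 : ∀ k, 0 < t k)
    (hW : ∀ x, Tendsto (fun k => us u 0 (t k) x) atTop (𝓝 (W x))) :
    LipschitzWith L W ∧ Mz W ∧ W 0 = 0 ∧ ∀ s : ℝ, 0 < s → ∀ x, W (s • x) = s * W x := by
  have hlip : ∀ r, 0 < r → LipschitzWith L (us u 0 r) := by
    intro r hr
    refine LipschitzWith.of_dist_le_mul fun x y => ?_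
    have h1 := hL.dist_le_mul (0 + r • x) (0 + r • y)
    have h2 : dist (0 + r • x) (0 + r • y) = r * dist x y := by
      rw [zero_add, zero_add, dist_smul₀, Real.norm_of_nonneg hr.le]
    rw [h2, Real.dist_eq] at h1
    simp only [us]
    rw [Real.dist_eq, ← mul_sub, abs_mul, abs_of_pos (inv_pos.2 hr)]
    calc r⁻¹ * |u (0 + r • x) - u (0 + r • y)| ≤ r⁻¹ * (L * (r * dist x y)) := by gcongr
      _ = L * dist x y := by field_simp
  have hWL : LipschitzWith L W := lip_lim (fun k => hlip _ (ht0 k)) hW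
  have hWM : Mz W := Mz_limit (fun k => hlip _ (ht0 k)) (fun k => hu.scale 0 (ht0 k)) hW
  have hW0 : W 0 = 0 := by
    refine tendsto_nhds_unique (hW 0) ?_
    have : Tendsto (fun k => (t k)⁻¹ * u 0) atTop (𝓝 (0 * u 0)) :=
      (tendsto_inv_atTop_zero.comp ht).mul_const _
    simpa [us] using this
  obtain ⟨C, hC⟩ := Phi_bdd hu.2.1 hL 0
  have hPl : ∃ l, Tendsto (Phi u 0) atTop (𝓝 l) := by
    have hm : Monotone (fun r => Phi u 0 (max r 1)) := fun r s hrs =>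
      Phi_mono hu 0 (mem_Ioi.2 (by positivity)) (mem_Ioi.2 (by positivity)) (max_le_max_right 1 hrs)
    rcases tendsto_of_monotone hm with h | ⟨l, h⟩
    · exfalso
      obtain ⟨r, hr⟩ := (h.eventually_gt_atTop C).exists
      exact absurd (hC (max r 1)) (not_le.2 hr)
    · refine ⟨l, h.congr' ?_⟩
      filter_upwards [eventually_ge_atTop 1] with r hr
      rw [max_eq_left hr]
  obtain ⟨l, hl⟩ := hPl
  have key : ∀ a b : ℝ, 0 < a → a ≤ b → ∀ y ∈ ball (0:E) 1, b⁻¹ * W (b • y) = a⁻¹ * W (a • y) := by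
    intro a b ha hab
    have hb : 0 < b := ha.trans_le hab
    have tl : ∀ c, 0 < c → Tendsto (fun k => Phi u 0 (c * t k)) atTop (𝓝 l) := fun c hc =>
      hl.comp (ht.const_mul_atTop hc)
    have t1 : Tendsto (fun k => (b * t k) * (Phi u 0 (b * t k) - Phi u 0 (a * t k)) / (4 * (a * t k))) atTop (𝓝 0) := by
      have := ((tl b hb).sub (tl a ha)).const_mul (b / (4 * a))
      rw [sub_self, mul_zero] at this
      refine this.congr fun k => ?_
      have := (ht0 k).ne'
      field_simp
    have tp : ∀ c, 0 < c → ∀ y, Tendsto (fun k => us u 0 (c * t k) y) atTop (𝓝 (c⁻¹ * W (c • y))) := by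
      intro c hc y
      refine ((hW (c • y)).const_mul c⁻¹).congr fun k => ?_
      simp only [us, zero_add, smul_smul]
      rw [mul_inv, mul_assoc, mul_comm c (t k)]
    have lipw : ∀ k, LipschitzWith (L + L) (fun y => us u 0 (b * t k) y - us u 0 (a * t k) y) := fun k =>
      (hlip _ (mul_pos hb (ht0 k))).sub (hlip _ (mul_pos ha (ht0 k)))
    have t0 : ∀ y, Tendsto (fun k => us u 0 (b * t k) y - us u 0 (a * t k) y) atTop (𝓝 (b⁻¹ * W (b • y) - a⁻¹ * W (a • y))) :=
      fun y => (tp b hb y).sub (tp a ha y)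
    obtain ⟨C, hC0, hC⟩ := lip_bdd lipw (t0 0) 0 1
    have t2 : Tendsto (fun k => ∫ y in ball (0:E) 1, (us u 0 (b * t k) y - us u 0 (a * t k) y) ^ 2) atTop
        (𝓝 (∫ y in ball (0:E) 1, (b⁻¹ * W (b • y) - a⁻¹ * W (a • y)) ^ 2)) := by
      refine dctb (C := C ^ 2) (fun k => ((lipw k).continuous.pow 2).measurable) (fun k x hx => ?_) ?_
      · rw [abs_pow]; exact pow_le_pow_left₀ (abs_nonneg _) (hC k x hx) 2
      · exact Eventually.of_forall fun x _ => (t0 x).pow 2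
    have hle := le_of_tendsto_of_tendsto' t2 t1 fun k =>
      Gf_bound hu 0 (mul_pos ha (ht0 k)) (mul_le_mul_of_nonneg_right hab (ht0 k).le)
    have hWc := hWL.continuous
    intro y hy
    have := zero_of_int (f := fun y => (b⁻¹ * W (b • y) - a⁻¹ * W (a • y)) ^ 2) (by fun_prop) (fun _ _ => sq_nonneg _) hle y hy
    have := pow_eq_zero_iff (two_ne_zero) |>.1 this
    linarith
  have key2 : ∀ s : ℝ, 1 ≤ s → ∀ x, W (s • x) = s * W x := by
    intro s hs x
    have hM : 0 < ‖x‖ + 1 := by positivity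
    have hs0 : 0 < s := by linarith
    have h := key (‖x‖ + 1) (s * (‖x‖ + 1)) hM (by nlinarith) ((‖x‖ + 1)⁻¹ • x) (by
      rw [mem_ball_zero_iff, norm_smul, norm_inv, Real.norm_of_nonneg hM.le, inv_mul_lt_iff₀ hM]; linarith)
    rw [smul_smul, smul_smul, mul_assoc, mul_inv_cancel₀ hM.ne', mul_one, one_smul, mul_inv] at h
    field_simp at h
    linarith
  refine ⟨hWL, hWM, hW0, fun s hs x => ?_⟩
  rcases le_total 1 s with h | h
  · exact key2 s h x
  · have := key2 s⁻¹ ((one_le_inv₀ hs).2 h) (s • x)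
    rw [smul_smul, inv_mul_cancel₀ hs.ne', one_smul] at this
    rw [this, mul_inv_cancel_left₀ hs.ne']

end
end AC

open MeasureTheory Metric Set Filter ENNReal NNReal

set_option linter.all false
namespace AC
open scoped Gradient Topology InnerProductSpace

section
variable {E : Type*} [NormedAddCommGroup E] [InnerProductSpace ℝ E] [FiniteDimensional ℝ E]
variable [MeasureSpace E] [BorelSpace E] [(volume : Measure E).IsAddHaarMeasure]

def Hom (A : E → ℝ) : Prop := ∀ s : ℝ, 0 < s → ∀ x, A (s • x) = s * A x

theorem conn_ind {S : Set E} (hS : IsPreconnected S) {P : E → Prop}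
    (h1 : ∀ x ∈ S, P x → ∀ᶠ y in 𝓝 x, P y) (h2 : ∀ x ∈ S, ¬ P x → ∀ᶠ y in 𝓝 x, ¬ P y)
    {x0 : E} (hx0 : x0 ∈ S) (hP : P x0) : ∀ x ∈ S, P x := by
  by_contra hcon
  push Not at hcon
  obtain ⟨z, hz, hPz⟩ := hcon
  have ho : ∀ Q : E → Prop, IsOpen {x | ∀ᶠ y in 𝓝 x, Q y} := fun Q => isOpen_setOf_eventually_nhds
  obtain ⟨w, hw, hw1, hw2⟩ := hS _ _ (ho P) (ho fun y => ¬ P y) (fun x hx => by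
    by_cases h : P x
    · exact Or.inl (h1 x hx h)
    · exact Or.inr (h2 x hx h)) ⟨x0, hx0, h1 x0 hx0 hP⟩ ⟨z, hz, h2 z hz hPz⟩
  exact absurd (hw1.self_of_nhds) hw2.self_of_nhds

theorem Hom.zero {A : E → ℝ} (h : Hom A) : A 0 = 0 := by
  have := h 2 two_pos 0
  rw [smul_zero] at this; linarith

theorem Hom.euler {A : E → ℝ} (h : Hom A) {x : E} {g : E} (hg : HasGradientAt A g x) : ⟪g, x⟫_ℝ = A x := by
  have h1 : HasDerivAt (fun s : ℝ => s • x) ((1:ℝ) • x) 1 := (hasDerivAt_id (1:ℝ)).smul_const x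
  have h2 : HasFDerivAt A (InnerProductSpace.toDual ℝ E g) ((1:ℝ) • x) := by
    rw [one_smul]; exact hg.hasFDerivAt
  have h3 := h2.comp_hasDerivAt (1:ℝ) h1
  have h4 : HasDerivAt (A ∘ fun s : ℝ => s • x) (A x) 1 := by
    have : HasDerivAt (fun s : ℝ => s * A x) (1 * A x) 1 := (hasDerivAt_id (1:ℝ)).mul_const _
    rw [one_mul] at this
    refine this.congr_of_eventuallyEq ?_
    filter_upwards [eventually_gt_nhds (zero_lt_one (α := ℝ))] with s hs
    exact h s hs x
  have := h3.unique h4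
  simpa using this

theorem hom_sym {A B : E → ℝ} (hA : LocallyLipschitz A) (hB : LocallyLipschitz B) (hhA : Hom A) (R : ℝ) :
    ∀ᵐ x : E, x ∈ ball (0:E) R → ⟪∇ A x, ∇ (fun x => bump 0 R x * B x) x⟫_ℝ
      = bump 0 R x * ⟪∇ A x, ∇ B x⟫_ℝ - 2 * (A x * B x) := by
  filter_upwards [ae_hg hA, ae_hg hB] with x h1 h2 hx
  rw [(hg_mul (bump_hg 0 R x hx) h2).gradient, inner_add_right, real_inner_smul_right, real_inner_smul_right,
    sub_zero, real_inner_smul_right, hhA.euler h1]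
  ring

theorem int_supp {B φ : E → ℝ} (hφ0 : ∀ x, 0 ≤ φ x) {c p : E} {R r : ℝ} (hsub : ball p r ⊆ ball c R)
    (hs : ∀ x, x ∉ ball p r → φ x = 0) :
    ∫ x in ball c R, ⟪∇ B x, ∇ φ x⟫_ℝ = ∫ x in ball p r, ⟪∇ B x, ∇ φ x⟫_ℝ :=
  setIntegral_eq_of_subset_of_forall_diff_eq_zero measurableSet_ball hsub
    (fun x hx => by rw [grad_zero_of_min hφ0 (hs x hx.2), inner_zero_right])

theorem pair {A B : E → ℝ} (hA : Mz A) (hB : Mz B) (hhA : Hom A) (hhB : Hom B) (hBA : ∀ x, B x ≤ A x)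
    {p : E} (hpA : 0 < A p) (hpB : B p = 0) : ∃ r > 0, ∀ x ∈ ball p r, B x = 0 := by
  obtain ⟨r, hr, hrA⟩ : ∃ r > 0, ∀ x ∈ closedBall p r, 0 < A x := by
    have : {x | 0 < A x} ∈ 𝓝 p := (isOpen_lt continuous_const hA.2.1.continuous).mem_nhds hpA
    obtain ⟨r, hr, h⟩ := Metric.nhds_basis_closedBall.mem_iff.1 this
    exact ⟨r, hr, h⟩
  refine ⟨r, hr, ?_⟩
  have hmv := mv_sup hB.2.1 p hr.le (fun s hs hsr => ?_)
  · rw [hpB, mul_zero] at hmv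
    exact zero_of_int1 hB.2.1.continuous hr hB.1 hmv
  · set R := ‖p‖ + r + 1 with hR
    have hR0 : 0 < R := by positivity
    have e1 := F2 hA (φ := fun x => bump 0 R x * B x) (ll_mul (bump_ll 0 R) hB.2.1) 0 R
      (fun x hx => by rw [bump_out 0 R x hx hR0, zero_mul]) (C := R ^ 2) (fun x => by
        rw [abs_of_nonneg (mul_nonneg (bump_nonneg _ _ _) (hB.1 x))]
        exact mul_le_mul (bump_le _ _ _) (hBA x) (hB.1 x) (by positivity))
    rw [int_congr _ _ (hom_sym hA.2.1 hB.2.1 hhA R)] at e1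
    have lA := ll_mul (bump_ll 0 R) hA.2.1
    have e2 : ∫ x in ball (0:E) R, ⟪∇ B x, ∇ (fun x => bump 0 R x * A x) x⟫_ℝ = 0 := by
      rw [int_congr _ _ (hom_sym hB.2.1 hA.2.1 hhB R), ← e1]
      refine int_congr _ _ (Eventually.of_forall fun x _ => ?_)
      rw [real_inner_comm, mul_comm (A x)]
    have hsub : closedBall p s ⊆ ball (0:E) R := fun x hx => by
      rw [mem_closedBall, dist_eq_norm] at hx
      rw [mem_ball_zero_iff]
      have := norm_add_le (x - p) p
      rw [sub_add_cancel] at this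
      linarith
    obtain ⟨C, hC⟩ := bump_le_of_pos (u := fun x => bump 0 R x * A x) lA.continuous
      (fun x => mul_nonneg (bump_nonneg _ _ _) (hA.1 x)) p hs (fun x hx => by
        refine mul_pos ?_ (hrA x (closedBall_subset_closedBall hsr.le hx))
        have h := hsub hx
        rw [bump_in 0 R x h, sub_zero]
        rw [mem_ball_zero_iff] at h
        nlinarith [norm_nonneg x])
    have hφ : LocallyLipschitz (fun x => C * (bump 0 R x * A x) - bump p s x) :=
      ll_sub (ll_cmul C lA) (bump_ll p s)
    have e3 := F1 hB hφ (fun x => by have := (le_abs_self _).trans (hC x); linarith) 0 R (fun x hx => by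
      rw [bump_out 0 R x hx hR0, bump_out p s x (fun h => hx (hsub (ball_subset_closedBall h))) hs]; simp)
    have e4 : ∫ x in ball (0:E) R, ⟪∇ B x, ∇ (fun x => C * (bump 0 R x * A x) - bump p s x) x⟫_ℝ
        = C * (∫ x in ball (0:E) R, ⟪∇ B x, ∇ (fun x => bump 0 R x * A x) x⟫_ℝ) - ∫ x in ball (0:E) R, ⟪∇ B x, ∇ (bump p s) x⟫_ℝ := by
      rw [← integral_const_mul, ← LB.isub ((LB.inner hB.2.1 lA).cmul C) (LB.inner hB.2.1 (bump_ll p s))]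
      refine int_congr _ _ ?_
      filter_upwards [ae_hg lA, ae_hg (bump_ll p s)] with x h1 h2 _
      rw [(hg_sub (hg_cmul C h1) h2).gradient, inner_sub_right, real_inner_smul_right]
    rw [e4, e2, int_supp (bump_nonneg p s) (ball_subset_closedBall.trans hsub) (fun x hx => bump_out p s x hx hs)] at e3
    linarith

theorem ae_of_balls {P : E → Prop} (h : ∀ k : ℕ, ∀ᵐ x : E, x ∈ ball (0:E) (k + 1) → P x) : ∀ᵐ x : E, P x := by
  filter_upwards [ae_all_iff.2 h] with x hx
  obtain ⟨k, hk⟩ := exists_nat_gt ‖x‖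
  exact hx k (by rw [mem_ball_zero_iff]; linarith)

theorem scale_one [Nontrivial E] {A : E → ℝ} {c : ℝ} (hA : Mz A) (hc : 0 < c) (hcA : Mz (fun x => c * A x))
    {p z : E} (hz : A z = 0) (hp : 0 < A p) : c = 1 := by
  by_contra hc1
  have hc2 : 1 - c ^ 2 ≠ 0 := by
    intro h
    have : (c - 1) * (c + 1) = 0 := by nlinarith
    rcases mul_eq_zero.1 this with h | h
    · exact hc1 (by linarith)
    · linarith
  have hus : ∀ r y, us (fun x => c * A x) p r y = c * us A p r y := fun r y => by simp only [us]; ring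
  have hdd : ∀ r, 0 < r → ∀ᵐ y : E, dd (fun x => c * A x) p r y = c * dd A p r y := by
    intro r hr
    filter_upwards [ae_scale (ae_hg hA.2.1) p hr.ne'] with y hy
    simp only [dd]
    rw [(hg_cmul c hy).gradient, real_inner_smul_left]
  have hD : ∀ r, Df (fun x => c * A x) p r = Df A p r := by
    intro r; unfold Df
    simp only [mul_pos_iff_of_pos_left hc]
  have hI : ∀ r, 0 < r → ∫ y in ball (0:E) 1, us (fun x => c * A x) p r y * (dd (fun x => c * A x) p r y - us (fun x => c * A x) p r y)
      = c ^ 2 * ∫ y in ball (0:E) 1, us A p r y * (dd A p r y - us A p r y) := by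
    intro r hr
    rw [← integral_const_mul]
    refine int_congr _ _ ?_
    filter_upwards [hdd r hr] with y hy _
    rw [hy, hus]; ring
  have hS : ∀ r, 0 < r → ∫ y in ball (0:E) 1, (dd (fun x => c * A x) p r y - us (fun x => c * A x) p r y) ^ 2
      = c ^ 2 * ∫ y in ball (0:E) 1, (dd A p r y - us A p r y) ^ 2 := by
    intro r hr
    rw [← integral_const_mul]
    refine int_congr _ _ ?_
    filter_upwards [hdd r hr] with y hy _
    rw [hy, hus]; ring
  have hDc : ∀ r, 0 < r → HasDerivAt (fun r => Phi (fun x => c * A x) p r - c ^ 2 * Phi A p r) 0 r := by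
    intro r hr
    have := (Phi_deriv hcA p hr).sub ((Phi_deriv hA p hr).const_mul (c ^ 2))
    refine this.congr_deriv ?_
    rw [hS r hr]; ring
  have hDe : ∀ r, 0 < r → Phi (fun x => c * A x) p r - c ^ 2 * Phi A p r = (1 - c ^ 2) * Df A p r := by
    intro r hr
    rw [Phi_eq hcA p hr, Phi_eq hA p hr, hD, hI r hr]; ring
  have hconst : ∀ r s, 0 < r → 0 < s → Df A p r = Df A p s := by
    intro r s hr hs
    have := (isOpen_Ioi (a := (0:ℝ))).is_const_of_deriv_eq_zero isPreconnected_Ioi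
      (fun r hr => (hDc r hr).differentiableAt.differentiableWithinAt) (fun r hr => (hDc r hr).deriv) hr hs
    rw [hDe r hr, hDe s hs] at this
    exact mul_left_cancel₀ hc2 this
  obtain ⟨r0, hr0, hr0A⟩ : ∃ r > 0, ∀ x ∈ ball p r, 0 < A x := by
    have : {x | 0 < A x} ∈ 𝓝 p := (isOpen_lt continuous_const hA.2.1.continuous).mem_nhds hp
    exact Metric.mem_nhds_iff.1 this
  have lw : LB (fun y : E => 1 - ‖y‖ ^ 2) := LB.cont (by fun_prop)
  have hfull : Df A p r0 = ∫ y in ball (0:E) 1, (1 - ‖y‖ ^ 2) := by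
    refine int_congr _ _ (Eventually.of_forall fun y hy => ?_)
    rw [if_pos (hr0A _ (mem_ball_scale hr0 hy)), one_mul]
  have hae : ∀ r, 0 < r → ∀ᵐ x : E, x ∈ ball p r → 0 < A x := by
    intro r hr
    have h1 := (hconst r r0 hr hr0).trans hfull
    have li : LB (fun y => (if 0 < A (p + r • y) then (1:ℝ) else 0)) := (LB.ind hA.2.1.continuous).scale p r
    have h2 : ∫ y in ball (0:E) 1, ((1 - ‖y‖ ^ 2) - (if 0 < A (p + r • y) then (1:ℝ) else 0) * (1 - ‖y‖ ^ 2)) = 0 := by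
      rw [LB.isub lw (li.mul lw), ← h1, Df, sub_self]
    rw [setIntegral_eq_zero_iff_of_nonneg_ae ((ae_restrict_iff' measurableSet_ball).2
      (Eventually.of_forall fun y hy => ?_)) ((lw.sub (li.mul lw)).int _ _)] at h2
    · rw [Filter.EventuallyEq, ae_restrict_iff' measurableSet_ball] at h2
      have h3 := ae_scale h2 (-(r⁻¹ • p)) (inv_ne_zero hr.ne')
      filter_upwards [h3] with x hx hxr
      have e : p + r • (-(r⁻¹ • p) + r⁻¹ • x) = x := by
        rw [smul_add, smul_neg, smul_smul, smul_smul, mul_inv_cancel₀ hr.ne', one_smul, one_smul]; abel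
      have hm : -(r⁻¹ • p) + r⁻¹ • x ∈ ball (0:E) 1 := by
        rw [mem_ball_zero_iff, neg_add_eq_sub, ← smul_sub, norm_smul, norm_inv, Real.norm_of_nonneg hr.le, inv_mul_lt_iff₀ hr]
        simpa [dist_eq_norm] using hxr
      have hx := hx hm
      rw [e] at hx
      by_contra hn
      rw [if_neg hn] at hx
      have := norm_lt_one_of_mem hm
      simp at hx
      nlinarith [norm_nonneg (-(r⁻¹ • p) + r⁻¹ • x)]
    · have := norm_lt_one_of_mem hy
      show 0 ≤ (1 - ‖y‖ ^ 2) - (if 0 < A (p + r • y) then (1:ℝ) else 0) * (1 - ‖y‖ ^ 2)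
      split_ifs
      · simp
      · nlinarith [norm_nonneg y]
  have hall : ∀ᵐ x : E, 0 < A x := by
    refine ae_of_balls fun k => ?_
    filter_upwards [hae (k + 1 + ‖p‖) (by positivity)] with x hx hxk
    refine hx ?_
    rw [mem_ball_zero_iff] at hxk
    rw [mem_ball, dist_eq_norm]
    linarith [norm_sub_le x p]
  exact absurd hz (hA.pos_of_ae hall z).ne'

end
end AC

open MeasureTheory Metric Set Filter ENNReal NNReal

set_option linter.all false
namespace AC
open scoped Gradient Topology InnerProductSpace

section
variable {E : Type*} [NormedAddCommGroup E] [InnerProductSpace ℝ E] [FiniteDimensional ℝ E]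
variable [MeasureSpace E] [BorelSpace E] [(volume : Measure E).IsAddHaarMeasure]

theorem picone {A B : E → ℝ} (hA : Mz A) (hB : Mz B) (hhA : Hom A) (hhB : Hom B) (hBA : ∀ x, B x ≤ A x)
    {R ε : ℝ} (hR : 0 < R) (hε : 0 < ε) :
    ∫ x in ball (0:E) R, bump 0 R x * ‖∇ B x - (B x / (A x + ε)) • ∇ A x‖ ^ 2
      ≤ 2 * ε * ∫ x in ball (0:E) R, B x := by
  have hp : ∀ x, 0 < A x + ε := fun x => by linarith [hA.1 x]
  have lAe : LocallyLipschitz (fun x => A x + ε) := ll_add hA.2.1 (LocallyLipschitz.const ε)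
  have lI := ll_inv lAe (fun x => (hp x).ne')
  have lψ : LocallyLipschitz (fun x => (B x * B x) * (A x + ε)⁻¹) := ll_mul (ll_mul hB.2.1 hB.2.1) lI
  have hψ0 : ∀ x, 0 ≤ (B x * B x) * (A x + ε)⁻¹ := fun x =>
    mul_nonneg (mul_self_nonneg _) (inv_nonneg.2 (hp x).le)
  have hψ : ∀ x, (B x * B x) * (A x + ε)⁻¹ ≤ B x := fun x => by
    rw [← div_eq_mul_inv, div_le_iff₀ (hp x)]
    exact mul_le_mul_of_nonneg_left (by linarith [hBA x]) (hB.1 x)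
  have e1 := F2 hA (φ := fun x => bump 0 R x * ((B x * B x) * (A x + ε)⁻¹)) (ll_mul (bump_ll 0 R) lψ) 0 R
    (fun x hx => by rw [bump_out 0 R x hx hR, zero_mul]) (C := R ^ 2) (fun x => by
      rw [abs_of_nonneg (mul_nonneg (bump_nonneg _ _ _) (hψ0 x))]
      exact mul_le_mul (bump_le _ _ _) ((hψ x).trans (hBA x)) (hψ0 x) (by positivity))
  have e2 := F2 hB (φ := fun x => bump 0 R x * B x) (ll_mul (bump_ll 0 R) hB.2.1) 0 R
    (fun x hx => by rw [bump_out 0 R x hx hR, zero_mul]) (C := R ^ 2) (fun x => by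
      rw [abs_of_nonneg (mul_nonneg (bump_nonneg _ _ _) (hB.1 x))]
      exact mul_le_mul (bump_le _ _ _) le_rfl (hB.1 x) (by positivity))
  have l1 := LB.inner hA.2.1 (ll_mul (bump_ll 0 R) lψ)
  have l2 := LB.inner hB.2.1 (ll_mul (bump_ll 0 R) hB.2.1)
  have lB := LB.cont hB.2.1.continuous
  have e3 : ∫ x in ball (0:E) R, bump 0 R x * ‖∇ B x - (B x / (A x + ε)) • ∇ A x‖ ^ 2
      ≤ ∫ x in ball (0:E) R, ((⟪∇ B x, ∇ (fun x => bump 0 R x * B x) x⟫_ℝ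
        - ⟪∇ A x, ∇ (fun x => bump 0 R x * ((B x * B x) * (A x + ε)⁻¹)) x⟫_ℝ) + 2 * ε * B x) := by
    refine setIntegral_mono_on_ae ?_ (((l2.sub l1).add (lB.cmul _)).int _ _) measurableSet_ball ?_
    · have : LB (fun x => bump 0 R x * ((‖∇ B x‖ ^ 2 - 2 * ((B x * (A x + ε)⁻¹) * ⟪∇ B x, ∇ A x⟫_ℝ)) + (B x * (A x + ε)⁻¹) ^ 2 * ‖∇ A x‖ ^ 2)) := by
        have lq := lB.mul (LB.cont lI.continuous)
        exact (LB.cont (bump_ll 0 R).continuous).mul (((LB.nsq hB.2.1).sub ((lq.mul (LB.inner hB.2.1 hA.2.1)).cmul 2)).add ((lq.pow 2).mul (LB.nsq hA.2.1)))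
      refine (this.int 0 R).congr_fun (fun x _ => ?_) measurableSet_ball
      simp only []
      rw [norm_sub_sq_real, real_inner_smul_right, norm_smul, mul_pow ‖B x / (A x + ε)‖, Real.norm_eq_abs, sq_abs, div_eq_mul_inv]
    · filter_upwards [hom_sym hA.2.1 lψ hhA R, hom_sym hB.2.1 hB.2.1 hhB R, ae_hg hA.2.1, ae_hg hB.2.1] with x h1 h2 hgA hgB hx
      rw [h1 hx, h2 hx]
      have hgi : HasGradientAt (fun x => (A x + ε)⁻¹) ((-((A x + ε) ^ 2)⁻¹) • ∇ A x) x := by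
        have h3 : HasGradientAt (fun x => A x + ε) (∇ A x) x := by
          simpa using hg_add hgA (hasGradientAt_const x ε)
        exact hg_comp (φ := fun t => t⁻¹) (hasDerivAt_inv (hp x).ne') h3
      rw [(hg_mul (hg_mul hgB hgB) hgi).gradient]
      rw [norm_sub_sq_real, real_inner_smul_right, norm_smul, mul_pow, Real.norm_eq_abs, sq_abs]
      simp only [inner_add_right, real_inner_smul_right, real_inner_self_eq_norm_sq]
      rw [real_inner_comm (∇ A x) (∇ B x)]
      have hq := hψ x
      have hpx := hp x
      generalize ⟪∇ A x, ∇ B x⟫_ℝ = i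
      generalize bump 0 R x = b
      generalize ‖∇ A x‖ ^ 2 = na
      generalize ‖∇ B x‖ ^ 2 = nb
      have k1 : A x * (B x * B x * (A x + ε)⁻¹) = B x * B x - ε * (B x * B x * (A x + ε)⁻¹) := by
        field_simp; ring
      rw [k1]
      have k2 : b * (nb - 2 * (B x / (A x + ε) * i) + (B x / (A x + ε)) ^ 2 * na) =
        b * nb - b * (B x * B x * (-((A x + ε) ^ 2)⁻¹ * na) + (A x + ε)⁻¹ * (B x * i + B x * i)) := by
        field_simp; ring
      rw [k2]
      nlinarith [mul_le_mul_of_nonneg_left hq hε.le]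
  refine e3.trans (le_of_eq ?_)
  rw [LB.iadd (l2.sub l1) (lB.cmul _), LB.isub l2 l1, e1, e2, integral_const_mul]; ring

theorem picone0 {A B : E → ℝ} (hA : Mz A) (hB : Mz B) (hhA : Hom A) (hhB : Hom B) (hBA : ∀ x, B x ≤ A x) :
    ∀ᵐ x : E, ∇ B x = (B x / A x) • ∇ A x := by
  refine ae_of_balls fun k => ?_
  set R : ℝ := k + 1 with hR
  have hR0 : 0 < R := by positivity
  set e : ℕ → ℝ := fun j => ((j:ℝ) + 1)⁻¹ with he
  have he0 : ∀ j, 0 < e j := fun j => by positivity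
  have het : Tendsto e atTop (𝓝 0) := tendsto_inv_atTop_zero.comp (tendsto_atTop_add_const_right _ 1 tendsto_natCast_atTop_atTop)
  obtain ⟨LA, hLA0, hLA⟩ := grad_bdd hA.2.1 0 R
  obtain ⟨LBd, hLB0, hLB⟩ := grad_bdd hB.2.1 0 R
  have hs : ∀ x ε, 0 < ε → 0 ≤ B x / (A x + ε) ∧ B x / (A x + ε) ≤ 1 := fun x ε hε => by
    have h : 0 < A x + ε := by linarith [hA.1 x]
    exact ⟨div_nonneg (hB.1 x) h.le, (div_le_one h).2 (by linarith [hBA x])⟩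
  have hAm := hA.2.1.continuous.measurable
  have hBm := hB.2.1.continuous.measurable
  have hbm := (bump_ll (0:E) R).continuous.measurable
  have mm : ∀ ε : ℝ, Measurable (fun x => bump 0 R x * ‖∇ B x - (B x / (A x + ε)) • ∇ A x‖ ^ 2) := fun ε =>
    hbm.mul ((((meas_grad B).sub ((hBm.div (hAm.add_const ε)).smul (meas_grad A))).norm).pow_const 2)
  have hbnd : ∀ ε, 0 < ε → ∀ x ∈ ball (0:E) R, |bump 0 R x * ‖∇ B x - (B x / (A x + ε)) • ∇ A x‖ ^ 2| ≤ R ^ 2 * (LBd + LA) ^ 2 := by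
    intro ε hε x hx
    rw [abs_of_nonneg (mul_nonneg (bump_nonneg _ _ _) (sq_nonneg _))]
    refine mul_le_mul (bump_le _ _ _) (pow_le_pow_left₀ (norm_nonneg _) ?_ 2) (sq_nonneg _) (by positivity)
    refine (norm_sub_le _ _).trans (add_le_add (hLB x hx) ?_)
    rw [norm_smul, Real.norm_of_nonneg (hs x ε hε).1]
    calc _ ≤ 1 * LA := mul_le_mul (hs x ε hε).2 (hLA x hx) (norm_nonneg _) zero_le_one
      _ = LA := one_mul _
  have hlim : ∀ x, Tendsto (fun j => bump 0 R x * ‖∇ B x - (B x / (A x + e j)) • ∇ A x‖ ^ 2) atTop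
      (𝓝 (bump 0 R x * ‖∇ B x - (B x / A x) • ∇ A x‖ ^ 2)) := by
    intro x
    have h1 : Tendsto (fun j => B x / (A x + e j)) atTop (𝓝 (B x / A x)) := by
      rcases (hA.1 x).eq_or_lt with h | h
      · have : B x = 0 := le_antisymm (h ▸ hBA x) (hB.1 x)
        simp [this]
      · have : Tendsto (fun j => A x + e j) atTop (𝓝 (A x + 0)) := tendsto_const_nhds.add het
        rw [add_zero] at this
        exact tendsto_const_nhds.div this h.ne'
    exact ((((tendsto_const_nhds.sub (h1.smul_const _)).norm).pow 2).const_mul _)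
  have t1 := dctb (c := (0:E)) (R := R) (fun j => mm (e j)) (fun j => hbnd (e j) (he0 j)) (Eventually.of_forall fun x _ => hlim x)
  have t2 : Tendsto (fun j => 2 * e j * ∫ x in ball (0:E) R, B x) atTop (𝓝 (2 * 0 * ∫ x in ball (0:E) R, B x)) :=
    (het.const_mul 2).mul_const _
  rw [mul_zero, zero_mul] at t2
  have hle := le_of_tendsto_of_tendsto' t1 t2 fun j => picone hA hB hhA hhB hBA hR0 (he0 j)
  have hlb : LB (fun x => bump 0 R x * ‖∇ B x - (B x / A x) • ∇ A x‖ ^ 2) := by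
    have m0 := mm 0
    simp only [add_zero] at m0
    refine ⟨m0, fun c ρ => ?_⟩
    refine ⟨R ^ 2 * (LBd + LA) ^ 2, fun x _ => ?_⟩
    by_cases hx : x ∈ ball (0:E) R
    · exact le_of_tendsto (hlim x).abs (Eventually.of_forall fun j => hbnd (e j) (he0 j) x hx)
    · show |bump 0 R x * ‖∇ B x - (B x / A x) • ∇ A x‖ ^ 2| ≤ R ^ 2 * (LBd + LA) ^ 2
      rw [bump_out 0 R x hx hR0, zero_mul, abs_zero]; positivity
  have h0 : ∫ x in ball (0:E) R, bump 0 R x * ‖∇ B x - (B x / A x) • ∇ A x‖ ^ 2 = 0 :=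
    le_antisymm hle (integral_nonneg fun x => mul_nonneg (bump_nonneg _ _ _) (sq_nonneg _))
  rw [setIntegral_eq_zero_iff_of_nonneg_ae (Eventually.of_forall fun x => mul_nonneg (bump_nonneg _ _ _) (sq_nonneg _)) (hlb.int _ _),
    Filter.EventuallyEq, ae_restrict_iff' measurableSet_ball] at h0
  filter_upwards [h0] with x hx hxR
  have hx := hx hxR
  have hb : 0 < bump 0 R x := by
    rw [bump_in 0 R x hxR, sub_zero]
    rw [mem_ball_zero_iff] at hxR
    nlinarith [norm_nonneg x]
  simp only [Pi.zero_apply, mul_eq_zero, hb.ne', false_or] at hx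
  have := norm_eq_zero.1 (pow_eq_zero_iff two_ne_zero |>.1 hx)
  exact sub_eq_zero.1 this

theorem uniq [Nontrivial E] {A B : E → ℝ} (hA : Mz A) (hB : Mz B) (hhA : Hom A) (hhB : Hom B) (hBA : ∀ x, B x ≤ A x)
    (hpos : ∀ x, 0 < A x → 0 < B x) (hconn : IsConnected {x | 0 < A x}) : ∀ x, A x = B x := by
  obtain ⟨x0, hx0⟩ := hconn.nonempty
  have hx0 : 0 < A x0 := hx0
  set c := B x0 / A x0 with hc
  have hloc : ∀ p, 0 < A p → ∀ᶠ y in 𝓝 p, B y / A y = B p / A p := by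
    intro p hp
    have h1 : ∀ᶠ y in 𝓝 p, A p / 2 < A y := hA.2.1.continuous.continuousAt.eventually_const_lt (by linarith)
    obtain ⟨r, hr, hrA⟩ := Metric.eventually_nhds_iff_ball.1 h1
    have hm : ∀ x, max (A x) (A p / 2) ≠ 0 := fun x => (lt_of_lt_of_le (by linarith) (le_max_right _ _)).ne'
    have lf : LocallyLipschitz (fun x => B x * (max (A x) (A p / 2))⁻¹) :=
      ll_mul hB.2.1 (ll_inv (ll_max hA.2.1 (LocallyLipschitz.const _)) hm)
    have heq : ∀ x ∈ ball p r, B x * (max (A x) (A p / 2))⁻¹ = B x * (A x)⁻¹ := fun x hx => by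
      rw [max_eq_left (hrA x hx).le]
    have := const_of_grad lf hr (p := p) (by
      filter_upwards [picone0 hA hB hhA hhB hBA, ae_hg hA.2.1, ae_hg hB.2.1] with x h1 h2 h3 hx
      rw [grad_congr_open isOpen_ball heq hx]
      have hA0 : 0 < A x := by linarith [hrA x hx]
      have hgi : HasGradientAt (fun x => (A x)⁻¹) ((-((A x) ^ 2)⁻¹) • ∇ A x) x :=
        hg_comp (φ := fun t => t⁻¹) (hasDerivAt_inv hA0.ne') h2
      rw [(hg_mul h3 hgi).gradient, h1, smul_smul, smul_smul, ← add_smul]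
      have : B x * -(A x ^ 2)⁻¹ + (A x)⁻¹ * (B x / A x) = 0 := by field_simp; ring
      rw [this, zero_smul])
    filter_upwards [ball_mem_nhds p hr] with y hy
    have h := this y hy
    rw [heq y hy, heq p (mem_ball_self hr)] at h
    simpa [div_eq_mul_inv] using h
  have hall := conn_ind hconn.isPreconnected (P := fun x => B x / A x = c)
    (fun x hx hP => by filter_upwards [hloc x hx] with y hy; rw [hy, hP])
    (fun x hx hP => by filter_upwards [hloc x hx] with y hy; rwa [hy]) hx0 rfl
  have hc0 : 0 < c := div_pos (hpos _ hx0) hx0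
  have hBc : ∀ x, B x = c * A x := by
    intro x
    rcases (hA.1 x).eq_or_lt with h | h
    · have : B x = 0 := le_antisymm (h ▸ hBA x) (hB.1 x)
      rw [this, ← h, mul_zero]
    · have := hall x h
      rw [← this, div_mul_cancel₀ _ h.ne']
  have : B = fun x => c * A x := funext hBc
  have h1 := scale_one hA hc0 (this ▸ hB) hhA.zero hx0
  intro x
  rw [hBc, h1, one_mul]

end
end AC

open MeasureTheory Metric Set Filter ENNReal NNReal

set_option linter.all false
namespace AC
open scoped Gradient Topology InnerProductSpace

section
variable {E : Type*} [NormedAddCommGroup E] [InnerProductSpace ℝ E] [FiniteDimensional ℝ E]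
variable [MeasureSpace E] [BorelSpace E] [(volume : Measure E).IsAddHaarMeasure]

theorem c2_ineq {U v : E → ℝ} (hU : Mz U) (hhU : Hom U) (hv : Mz v) (hvU : ∀ x, v x ≤ U x) :
    ∫ x in ball (0:E) 1, U x * v x ≤ ∫ x in ball (0:E) 1, U x * ⟪∇ v x, x⟫_ℝ := by
  have e1 := F2 hU (φ := fun x => bump 0 1 x * v x) (ll_mul (bump_ll 0 1) hv.2.1) 0 1
    (fun x hx => by rw [bump_out 0 1 x hx one_pos, zero_mul]) (C := 1 ^ 2) (fun x => by
      rw [abs_of_nonneg (mul_nonneg (bump_nonneg _ _ _) (hv.1 x))]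
      exact mul_le_mul (bump_le _ _ _) (hvU x) (hv.1 x) (by positivity))
  rw [int_congr _ _ (hom_sym hU.2.1 hv.2.1 hhU 1)] at e1
  have e2 := F1 hv (φ := fun x => bump 0 1 x * U x) (ll_mul (bump_ll 0 1) hU.2.1)
    (fun x => mul_nonneg (bump_nonneg _ _ _) (hU.1 x)) 0 1
    (fun x hx => by rw [bump_out 0 1 x hx one_pos, zero_mul])
  have e3 : ∫ x in ball (0:E) 1, ⟪∇ v x, ∇ (fun x => bump 0 1 x * U x) x⟫_ℝ
      = ∫ x in ball (0:E) 1, (bump 0 1 x * ⟪∇ U x, ∇ v x⟫_ℝ - 2 * (U x * ⟪∇ v x, x⟫_ℝ)) := by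
    refine int_congr _ _ ?_
    filter_upwards [ae_hg hU.2.1] with x h2 hx
    rw [(hg_mul (bump_hg 0 1 x hx) h2).gradient, inner_add_right, real_inner_smul_right, real_inner_smul_right,
      sub_zero, real_inner_smul_right, real_inner_comm]
    ring
  have l1 : LB (fun x => bump 0 1 x * ⟪∇ U x, ∇ v x⟫_ℝ) := (LB.cont (bump_ll 0 1).continuous).mul (LB.inner hU.2.1 hv.2.1)
  have l2 : LB (fun x => U x * v x) := (LB.cont hU.2.1.continuous).mul (LB.cont hv.2.1.continuous)
  have l3 : LB (fun x => U x * ⟪∇ v x, x⟫_ℝ) := (LB.cont hU.2.1.continuous).mul (by simpa using LB.gx hv.2.1 0 1)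
  rw [e3, LB.isub l1 (l3.cmul 2), integral_const_mul] at e2
  rw [LB.isub l1 (l2.cmul 2), integral_const_mul] at e1
  linarith

theorem c2_nonzero {U V W : E → ℝ} (hU : Mz U) (hhU : Hom U) (hV : Mz V) (hVU : ∀ x, V x ≤ U x)
    {L : ℝ≥0} (hL : LipschitzWith L W) {z : E} (hz : 0 < V z) {t : ℕ → ℝ}
    (ht : Tendsto t atTop atTop) (ht0 : ∀ k, 0 < t k)
    (hW : ∀ x, Tendsto (fun k => us V 0 (t k) x) atTop (𝓝 (W x))) : ∃ x, 0 < W x := by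
  have lU := LB.cont hU.2.1.continuous
  have hus : ∀ r, 0 < r → ∀ y, us V 0 r y ≤ U y := by
    intro r hr y
    simp only [us, zero_add]
    rw [inv_mul_le_iff₀ hr, ← hhU r hr]
    exact hVU _
  have hus0 : ∀ r, 0 < r → ∀ y, 0 ≤ us V 0 r y := fun r hr y => mul_nonneg (inv_nonneg.2 hr.le) (hV.1 _)
  set F : ℝ → ℝ := fun r => ∫ y in ball (0:E) 1, U y * us V 0 r y with hF
  have hd : ∀ r, 0 < r → HasDerivAt F (r⁻¹ * ∫ y in ball (0:E) 1, U y * (dd V 0 r y - us V 0 r y)) r :=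
    fun r hr => us_hd hV.2.1 lU 0 hr
  have hmono : MonotoneOn F (Ioi 0) := by
    refine monotoneOn_of_deriv_nonneg (convex_Ioi 0)
      (fun r hr => (hd r hr).continuousAt.continuousWithinAt)
      (fun r hr => (hd r (by simpa using hr)).differentiableAt.differentiableWithinAt) (fun r hr => ?_)
    rw [interior_Ioi, mem_Ioi] at hr
    rw [(hd r hr).deriv]
    refine mul_nonneg (inv_nonneg.2 hr.le) ?_
    have h := c2_ineq hU hhU (hV.scale 0 hr) (hus r hr)
    have e : ∫ x in ball (0:E) 1, U x * ⟪∇ (fun x => r⁻¹ * V (0 + r • x)) x, x⟫_ℝ = ∫ y in ball (0:E) 1, U y * dd V 0 r y := by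
      refine int_congr _ _ ?_
      filter_upwards [grad_scale hV.2.1 0 hr.ne'] with x hx _
      rw [hx.gradient, dd]
    rw [e] at h
    have h' : ∫ y in ball (0:E) 1, U y * us V 0 r y ≤ ∫ y in ball (0:E) 1, U y * dd V 0 r y := h
    have : ∫ y in ball (0:E) 1, U y * (dd V 0 r y - us V 0 r y) = (∫ y in ball (0:E) 1, U y * dd V 0 r y) - ∫ y in ball (0:E) 1, U y * us V 0 r y := by
      rw [← LB.isub (lU.mul (dd_LB hV.2.1 0 r)) (lU.mul (us_LB hV.2.1 0 r))]
      refine int_congr _ _ (Eventually.of_forall fun y _ => by ring)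
    rw [this]; linarith
  set r0 : ℝ := ‖z‖ + 1 with hr0
  have hr00 : 0 < r0 := by positivity
  have hF0 : 0 < F r0 := by
    by_contra hn
    have hc : Continuous (fun y => U y * us V 0 r0 y) := hU.2.1.continuous.mul (us_ll hV.2.1 0 r0).continuous
    have := zero_of_int hc (c := 0) (R := 1) (fun y _ => mul_nonneg (hU.1 y) (hus0 r0 hr00 y)) (not_lt.1 hn) (r0⁻¹ • z) (by
      rw [mem_ball_zero_iff, norm_smul, norm_inv, Real.norm_of_nonneg hr00.le, inv_mul_lt_iff₀ hr00]; linarith)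
    have h1 : 0 < us V 0 r0 (r0⁻¹ • z) := by
      simp only [us, zero_add, smul_smul, mul_inv_cancel₀ hr00.ne', one_smul]; positivity
    have h2 := hus r0 hr00 (r0⁻¹ • z)
    have : 0 < U (r0⁻¹ • z) * us V 0 r0 (r0⁻¹ • z) := mul_pos (by linarith) h1
    linarith
  obtain ⟨C, hC⟩ := (lU.pow 2).2 0 1
  have t1 : Tendsto (fun k => F (t k)) atTop (𝓝 (∫ y in ball (0:E) 1, U y * W y)) := by
    refine dctb (C := C) (fun k => (hU.2.1.continuous.mul (us_ll hV.2.1 0 (t k)).continuous).measurable) (fun k y hy => ?_)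
      (Eventually.of_forall fun y _ => (hW y).const_mul _)
    rw [abs_of_nonneg (mul_nonneg (hU.1 y) (hus0 _ (ht0 k) y))]
    refine le_trans ?_ ((le_abs_self _).trans (hC y hy))
    simp only [sq]
    exact mul_le_mul_of_nonneg_left (hus _ (ht0 k) y) (hU.1 y)
  have h1 : F r0 ≤ ∫ y in ball (0:E) 1, U y * W y := by
    refine ge_of_tendsto t1 ?_
    filter_upwards [ht.eventually_ge_atTop r0] with k hk
    exact hmono hr00 (ht0 k) hk
  by_contra hcon
  push Not at hcon
  have : ∫ y in ball (0:E) 1, U y * W y ≤ 0 := integral_nonpos fun y =>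
    mul_nonpos_of_nonneg_of_nonpos (hU.1 y) (hcon y)
  linarith

theorem c2_end [Nontrivial E] {U W : E → ℝ} (hU : Mz U) (hhU : Hom U) (hW : Mz W) (hhW : Hom W)
    (hWU : ∀ x, W x ≤ U x) (hne : ∃ x, 0 < W x) (hconn : IsConnected {x | 0 < U x}) : ∀ x, W x = U x := by
  obtain ⟨x0, hx0⟩ := hne
  have hall := conn_ind hconn.isPreconnected (P := fun x => 0 < W x)
    (fun x _ hP => hW.2.1.continuous.continuousAt.eventually_const_lt hP)
    (fun x hx hP => by
      obtain ⟨r, hr, h⟩ := pair hU hW hhU hhW hWU hx (le_antisymm (not_lt.1 hP) (hW.1 x))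
      filter_upwards [ball_mem_nhds x hr] with y hy
      rw [h y hy]; exact lt_irrefl _) (lt_of_lt_of_le hx0 (hWU x0)) hx0
  exact fun x => (uniq hU hW hhU hhW hWU hall hconn x).symm

theorem lip_ind {f : E → ℝ} {L : ℝ≥0} (hf : LipschitzWith L f) {S : Set E} (h : ∀ x ∈ frontier S, f x = 0) :
    LipschitzWith L (S.indicator f) := by
  have key : ∀ x ∈ S, ∀ y, y ∉ S → |f x| ≤ L * dist x y := by
    intro x hx y hy
    obtain ⟨z, hz1, hz2⟩ : ((segment ℝ x y) ∩ frontier S).Nonempty := by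
      by_contra hcon
      have hnf : ∀ z ∈ segment ℝ x y, z ∉ frontier S := fun z hz hzf => hcon ⟨z, hz, hzf⟩
      refine hy (conn_ind (convex_segment x y).isPreconnected (P := fun z => z ∈ S) (fun z hz hzS => ?_) (fun z hz hzS => ?_)
        (left_mem_segment ℝ x y) hx y (right_mem_segment ℝ x y))
      · have : z ∈ interior S := by
          by_contra h
          exact hnf z hz ⟨subset_closure hzS, h⟩
        exact mem_interior_iff_mem_nhds.1 this
      · have : z ∉ closure S := by
          intro h
          exact hnf z hz ⟨h, fun hi => hzS (interior_subset hi)⟩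
        filter_upwards [isClosed_closure.isOpen_compl.mem_nhds this] with w hw hwS
        exact hw (subset_closure hwS)
    have h1 := hf.dist_le_mul x z
    rw [h z hz2, Real.dist_eq, sub_zero] at h1
    refine h1.trans (mul_le_mul_of_nonneg_left ?_ L.2)
    have := dist_add_dist_of_mem_segment hz1
    linarith [dist_nonneg (x := z) (y := y)]
  refine LipschitzWith.of_dist_le_mul fun x y => ?_
  by_cases hx : x ∈ S <;> by_cases hy : y ∈ S
  · rw [indicator_of_mem hx, indicator_of_mem hy]; exact hf.dist_le_mul x y
  · rw [indicator_of_mem hx, indicator_of_notMem hy, Real.dist_eq, sub_zero]; exact key x hx y hy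
  · rw [indicator_of_notMem hx, indicator_of_mem hy, Real.dist_eq, zero_sub, abs_neg, dist_comm]; exact key y hy x hx
  · rw [indicator_of_notMem hx, indicator_of_notMem hy, dist_self]; positivity

theorem Mz.split {W A B : E → ℝ} (hW : Mz W) (hA : LocallyLipschitz A) (hB : LocallyLipschitz B) (hA0 : ∀ x, 0 ≤ A x)
    (hB0 : ∀ x, 0 ≤ B x) (hadd : ∀ x, A x + B x = W x) (hmul : ∀ x, A x = 0 ∨ B x = 0) : Mz A := by
  refine ⟨hA0, hA, fun v hv0 hv c R hvA => ?_⟩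
  have lm := ll_max hv hB
  have h1 := hW.2.2 (fun x => max (v x) (B x)) (fun x => (hv0 x).trans (le_max_left _ _)) lm c R (fun x hx => by
    rw [hvA x hx, ← hadd]
    rcases hmul x with h | h
    · rw [h, max_eq_right (hB0 x), zero_add]
    · rw [h, max_eq_left (hA0 x), add_zero])
  have h2 : ∫ x in ball c R, q W x = (∫ x in ball c R, q A x) + ∫ x in ball c R, q B x := by
    rw [← LB.iadd (LB.q hA) (LB.q hB)]
    refine int_congr _ _ ?_
    filter_upwards [ae_hg hA, ae_hg hB] with x hgA hgB _
    have hWe : W = fun x => A x + B x := funext fun x => (hadd x).symm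
    have e : ∇ W x = ∇ A x + ∇ B x := by rw [hWe]; exact (hg_add hgA hgB).gradient
    simp only [q]
    rw [e, ← hadd]
    rcases hmul x with h | h
    · rw [h, grad_zero_of_min hA0 h]; simp
    · rw [h, grad_zero_of_min hB0 h]; simp
  have h3 : ∫ x in ball c R, q (fun x => max (v x) (B x)) x ≤ (∫ x in ball c R, q v x) + ∫ x in ball c R, q B x := by
    rw [← LB.iadd (LB.q hv) (LB.q hB)]
    refine LB.mono_ae (LB.q lm) ((LB.q hv).add (LB.q hB)) _ _ ?_
    have key : ∀ f g : E → ℝ, (∀ x, f x ≤ g x) → ∀ x, HasGradientAt f (∇ f x) x → HasGradientAt g (∇ g x) x → f x = g x → q g x = q f x := by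
      intro f g hfg x h1 h2 h3
      have := grad_zero_of_min (f := fun x => g x - f x) (fun x => by linarith [hfg x]) (x := x) (by simp [h3])
      rw [(hg_sub h2 h1).gradient, sub_eq_zero] at this
      simp only [q, this, h3]
    filter_upwards [ae_hg hv, ae_hg hB, ae_hg lm] with x hgv hgB hgm _
    have q1 := q_nonneg v x
    have q2 := q_nonneg B x
    rcases le_total (B x) (v x) with h | h
    · rw [key v (fun x => max (v x) (B x)) (fun x => le_max_left _ _) x hgv hgm (max_eq_left h).symm]; linarith
    · rw [key B (fun x => max (v x) (B x)) (fun x => le_max_right _ _) x hgB hgm (max_eq_right h).symm]; linarith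
  linarith

end
end AC

open MeasureTheory Metric Set Filter ENNReal NNReal

set_option linter.all false
namespace AC
open scoped Gradient Topology InnerProductSpace

section
variable {E : Type*} [NormedAddCommGroup E] [InnerProductSpace ℝ E] [FiniteDimensional ℝ E]
variable [MeasureSpace E] [BorelSpace E] [(volume : Measure E).IsAddHaarMeasure]

theorem int_neg_ball (f : E → ℝ) : ∫ y in ball (0:E) 1, f (-y) = ∫ y in ball (0:E) 1, f y := by
  rw [← integral_indicator measurableSet_ball, ← integral_indicator measurableSet_ball, ← integral_neg_eq_self]
  congr 1
  ext y
  by_cases h : y ∈ ball (0:E) 1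
  · rw [indicator_of_mem (by simpa using h), indicator_of_mem h]; simp
  · rw [indicator_of_notMem (by simpa using h), indicator_of_notMem h]

theorem LB.ite {P : E → Prop} [DecidablePred P] (hP : MeasurableSet {y | P y}) : LB (fun y => if P y then (1:ℝ) else 0) := by
  refine ⟨Measurable.ite hP measurable_const measurable_const, fun _ _ => ⟨1, fun x _ => ?_⟩⟩
  show |if P x then (1:ℝ) else 0| ≤ 1
  split_ifs <;> simp

theorem half_int {e : E} (he : e ≠ 0) :
    ∫ y in ball (0:E) 1, (if ⟪e, y⟫_ℝ < 0 then (1:ℝ) else 0) * (1 - ‖y‖ ^ 2)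
      = (∫ y in ball (0:E) 1, (1 - ‖y‖ ^ 2)) / 2 := by
  have lw : LB (fun y : E => 1 - ‖y‖ ^ 2) := LB.cont (by fun_prop)
  have l1 : LB (fun y : E => (if ⟪e, y⟫_ℝ < 0 then (1:ℝ) else 0) * (1 - ‖y‖ ^ 2)) :=
    (LB.ite (measurableSet_lt (by fun_prop) measurable_const)).mul lw
  have l2 : LB (fun y : E => (if 0 < ⟪e, y⟫_ℝ then (1:ℝ) else 0) * (1 - ‖y‖ ^ 2)) :=
    (LB.ite (measurableSet_lt measurable_const (by fun_prop))).mul lw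
  have h1 : ∫ y in ball (0:E) 1, (if 0 < ⟪e, y⟫_ℝ then (1:ℝ) else 0) * (1 - ‖y‖ ^ 2)
      = ∫ y in ball (0:E) 1, (if ⟪e, y⟫_ℝ < 0 then (1:ℝ) else 0) * (1 - ‖y‖ ^ 2) := by
    rw [← int_neg_ball]
    simp [inner_neg_right]
  have hnull : ∀ᵐ y : E, ⟪e, y⟫_ℝ ≠ 0 := by
    have := Measure.addHaar_submodule (volume : Measure E) ((ℝ ∙ e)ᗮ) (by
      intro h
      have : e ∈ (ℝ ∙ e)ᗮ := by rw [h]; trivial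
      rw [Submodule.mem_orthogonal_singleton_iff_inner_right] at this
      exact he (inner_self_eq_zero.1 this))
    rw [ae_iff]
    refine measure_mono_null (fun y hy => ?_) this
    simp only [ne_eq, not_not, mem_setOf_eq] at hy
    exact Submodule.mem_orthogonal_singleton_iff_inner_right.2 hy
  have h2 : ∫ y in ball (0:E) 1, (1 - ‖y‖ ^ 2) = ∫ y in ball (0:E) 1, ((if ⟪e, y⟫_ℝ < 0 then (1:ℝ) else 0) * (1 - ‖y‖ ^ 2)
      + (if 0 < ⟪e, y⟫_ℝ then (1:ℝ) else 0) * (1 - ‖y‖ ^ 2)) := by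
    refine int_congr _ _ ?_
    filter_upwards [hnull] with y hy _
    rcases lt_or_gt_of_ne hy with h | h
    · rw [if_pos h, if_neg (not_lt.2 h.le)]; ring
    · rw [if_pos h, if_neg (not_lt.2 h.le)]; ring
  rw [h2, LB.iadd l1 l2, h1]; ring

theorem log_top {N N' : ℝ → ℝ} {C δ ρ : ℝ} (hd : ∀ r, 0 < r → HasDerivAt N (N' r) r) (hN0 : ∀ r, 0 < r → 0 ≤ N r)
    (hC : ∀ r, 0 < r → N r ≤ C) (hδ : 0 < δ) (hρ : 0 < ρ) (h : ∀ r, ρ ≤ r → δ ≤ r * N' r) : False := by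
  have hm : MonotoneOn (fun r => N r - δ * Real.log r) (Ici ρ) := by
    have hd' : ∀ r, ρ ≤ r → HasDerivAt (fun r => N r - δ * Real.log r) (N' r - δ * r⁻¹) r := fun r hr =>
      (hd r (hρ.trans_le hr)).sub ((Real.hasDerivAt_log (hρ.trans_le hr).ne').const_mul δ)
    refine monotoneOn_of_deriv_nonneg (convex_Ici ρ) (fun r hr => (hd' r hr).continuousAt.continuousWithinAt)
      (fun r hr => ?_) (fun r hr => ?_)
    · rw [interior_Ici, mem_Ioi] at hr
      exact (hd' r hr.le).differentiableAt.differentiableWithinAt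
    · rw [interior_Ici, mem_Ioi] at hr
      have hr0 := hρ.trans hr
      rw [(hd' r hr.le).deriv, sub_nonneg, ← div_eq_mul_inv, div_le_iff₀ hr0, mul_comm]
      exact h r hr.le
  have hC0 : 0 ≤ C := (hN0 ρ hρ).trans (hC ρ hρ)
  have h1 := hm (mem_Ici.2 le_rfl) (b := ρ * Real.exp ((C + 1) / δ)) (mem_Ici.2 (le_mul_of_one_le_right hρ.le (Real.one_le_exp (by positivity))))
    (le_mul_of_one_le_right hρ.le (Real.one_le_exp (by positivity)))
  simp only [] at h1
  rw [Real.log_mul hρ.ne' (Real.exp_pos _).ne', Real.log_exp, mul_add, mul_div_cancel₀ _ hδ.ne'] at h1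
  have h2 := hC (ρ * Real.exp ((C + 1) / δ)) (by positivity)
  have h3 := hN0 ρ hρ
  linarith

theorem log_bot {N N' : ℝ → ℝ} {C δ ρ : ℝ} (hd : ∀ r, 0 < r → HasDerivAt N (N' r) r) (hN0 : ∀ r, 0 < r → 0 ≤ N r)
    (hC : ∀ r, 0 < r → N r ≤ C) (hδ : 0 < δ) (hρ : 0 < ρ) (h : ∀ r, 0 < r → r ≤ ρ → r * N' r ≤ -δ) : False := by
  refine log_top (N := fun r => N r⁻¹) (N' := fun r => N' r⁻¹ * (-(r ^ 2)⁻¹)) (C := C) (δ := δ) (ρ := ρ⁻¹)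
    (fun r hr => (hd r⁻¹ (inv_pos.2 hr)).comp r (hasDerivAt_inv hr.ne')) (fun r hr => hN0 _ (inv_pos.2 hr))
    (fun r hr => hC _ (inv_pos.2 hr)) hδ (inv_pos.2 hρ) (fun r hr => ?_)
  have hr0 : 0 < r := (inv_pos.2 hρ).trans_le hr
  have := h r⁻¹ (inv_pos.2 hr0) (inv_le_of_inv_le₀ hρ hr)
  have e : r * (N' r⁻¹ * (-(r ^ 2)⁻¹)) = - (r⁻¹ * N' r⁻¹) := by field_simp
  rw [e]; linarith

theorem density [Nontrivial E] {A : E → ℝ} {L : ℝ≥0} (hA : Mz A) (hL : LipschitzWith L A) (hh : Hom A) {x0 : E} (hx0 : 0 < A x0) :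
    (∫ y in ball (0:E) 1, (1 - ‖y‖ ^ 2)) / 2 ≤ Df A 0 1 := by
  set h := (∫ y in ball (0:E) 1, (1 - ‖y‖ ^ 2)) / 2 with hhdef
  have hAc := hA.2.1.continuous
  have lw : LB (fun y : E => 1 - ‖y‖ ^ 2) := LB.cont (by fun_prop)
  have hw : ∀ y ∈ ball (0:E) 1, 0 ≤ 1 - ‖y‖ ^ 2 := fun y hy => by
    have := norm_lt_one_of_mem hy
    nlinarith [norm_nonneg y]
  have hcl : IsClosed {x | A x = 0} := isClosed_eq hAc continuous_const
  obtain ⟨p, hp, hpd⟩ := hcl.exists_infDist_eq_dist ⟨0, hh.zero⟩ x0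
  have hp : A p = 0 := hp
  set e := p - x0 with he
  have he0 : e ≠ 0 := by
    intro h
    rw [sub_eq_zero.1 h] at hp
    exact hx0.ne' hp
  have hball : ∀ x, ‖x - x0‖ < ‖e‖ → 0 < A x := by
    intro x hx
    by_contra hn
    have h1 := infDist_le_dist_of_mem (x := x0) (s := {x | A x = 0}) (le_antisymm (not_lt.1 hn) (hA.1 x))
    rw [hpd, dist_comm, dist_comm x0, dist_eq_norm, dist_eq_norm] at h1
    linarith
  have lr : ∀ r, LB (fun y : E => (if 2 * ⟪e, y⟫_ℝ + r < 0 then (1:ℝ) else 0) * (1 - ‖y‖ ^ 2)) := fun r =>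
    (LB.ite (measurableSet_lt (by fun_prop) measurable_const)).mul lw
  have hDlow : ∀ δ, 0 < δ → ∃ r0 > 0, ∀ r, 0 < r → r ≤ r0 → h - δ ≤ Df A p r := by
    intro δ hδ
    set s : ℕ → ℝ := fun j => ((j:ℝ) + 1)⁻¹ with hs
    have hst : Tendsto s atTop (𝓝 0) := tendsto_inv_atTop_zero.comp (tendsto_atTop_add_const_right _ 1 tendsto_natCast_atTop_atTop)
    have hs0 : ∀ j, 0 < s j := fun j => by positivity
    have t1 : Tendsto (fun k => ∫ y in ball (0:E) 1, (if 2 * ⟪e, y⟫_ℝ + s k < 0 then (1:ℝ) else 0) * (1 - ‖y‖ ^ 2)) atTop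
        (𝓝 (∫ y in ball (0:E) 1, (if ⟪e, y⟫_ℝ < 0 then (1:ℝ) else 0) * (1 - ‖y‖ ^ 2))) := by
      refine dctb (C := 1) (fun k => (lr (s k)).1) (fun k y hy => ?_) (Eventually.of_forall fun y _ => ?_)
      · have h1 := hw y hy
        split_ifs
        · rw [one_mul, abs_of_nonneg h1]; nlinarith [sq_nonneg ‖y‖]
        · simp
      · refine Tendsto.mul_const _ ?_
        by_cases hy : ⟪e, y⟫_ℝ < 0
        · refine tendsto_const_nhds.congr' ?_
          filter_upwards [hst.eventually_lt_const (show (0:ℝ) < -(2 * ⟪e, y⟫_ℝ) by linarith)] with k hk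
          rw [if_pos hy, if_pos (by linarith)]
        · refine tendsto_const_nhds.congr fun k => ?_
          rw [if_neg hy, if_neg (by linarith [hs0 k])]
    rw [half_int he0] at t1
    obtain ⟨k, hk⟩ := (t1.eventually_const_lt (show h - δ < h by linarith)).exists
    refine ⟨s k, hs0 k, fun r hr hrs => hk.le.trans ?_⟩
    refine LB.mono_ae (lr _) (((LB.ind hAc).scale p r).mul lw) _ _ (Eventually.of_forall fun y hy => ?_)
    refine mul_le_mul_of_nonneg_right ?_ (hw y hy)
    by_cases h1 : 2 * ⟪e, y⟫_ℝ + s k < 0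
    · have : 0 < A (p + r • y) := by
        refine hball _ ?_
        have e1 : p + r • y - x0 = e + r • y := by rw [he]; abel
        rw [e1]
        refine lt_of_pow_lt_pow_left₀ 2 (norm_nonneg _) ?_
        rw [norm_add_sq_real, real_inner_smul_right, norm_smul, mul_pow, Real.norm_eq_abs, sq_abs]
        have := hw y hy
        have h2 : 2 * ⟪e, y⟫_ℝ + r < 0 := by linarith
        nlinarith [mul_neg_of_pos_of_neg hr h2, mul_nonneg (sq_nonneg r) this]
      rw [if_pos h1, if_pos this]
    · rw [if_neg h1]; split_ifs <;> simp
  set N' : ℝ → ℝ := fun r => 2 * r⁻¹ * ∫ y in ball (0:E) 1, us A p r y * (dd A p r y - us A p r y) with hN'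
  have hd : ∀ r, 0 < r → HasDerivAt (Nf A p) (N' r) r := fun r hr => Nf_deriv hA.2.1 p hr
  have hN0 : ∀ r, 0 < r → 0 ≤ Nf A p r := fun r _ => integral_nonneg fun _ => sq_nonneg _
  have hNC : ∀ r, 0 < r → Nf A p r ≤ ∫ y in ball (0:E) 1, (L:ℝ) ^ 2 := by
    intro r hr
    refine LB.mono_ae ((us_LB hA.2.1 p r).pow 2) (LB.const _) _ _ (Eventually.of_forall fun y hy => ?_)
    have h1 := hL.dist_le_mul (p + r • y) p
    rw [hp, Real.dist_eq, sub_zero, dist_eq_norm, add_sub_cancel_left, norm_smul, Real.norm_of_nonneg hr.le, abs_of_nonneg (hA.1 _)] at h1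
    have h2 := norm_lt_one_of_mem hy
    refine pow_le_pow_left₀ (mul_nonneg (inv_nonneg.2 hr.le) (hA.1 _)) ?_ 2
    show r⁻¹ * A (p + r • y) ≤ (L:ℝ)
    rw [inv_mul_le_iff₀ hr]
    refine h1.trans ?_
    have : (L:ℝ) * (r * ‖y‖) ≤ L * (r * 1) := by gcongr
    linarith
  have hPhi : ∀ r, 0 < r → Phi A p r = Df A p r + r * N' r := by
    intro r hr
    rw [Phi_eq hA p hr, hN']
    field_simp
  have step1 : ∀ δ, 0 < δ → ∀ r, 0 < r → h - δ ≤ Phi A p r := by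
    intro δ hδ r1 hr1
    by_contra hn
    push Not at hn
    obtain ⟨r0, hr0, hD⟩ := hDlow (δ / 2) (by positivity)
    refine log_bot hd hN0 hNC (δ := δ / 2) (ρ := min r0 r1) (by positivity) (lt_min hr0 hr1) (fun r hr hrr => ?_)
    have h1 := hD r hr (hrr.trans (min_le_left _ _))
    have h2 := Phi_mono hA p (mem_Ioi.2 hr) (mem_Ioi.2 hr1) (hrr.trans (min_le_right _ _))
    have h3 := hPhi r hr
    linarith
  have hDup : ∃ K : ℝ, 0 ≤ K ∧ ∀ r, 1 ≤ r → ‖p‖ ≤ r → Df A p r ≤ Df A 0 1 + K / r := by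
    refine ⟨∫ x in ball (0:E) 2, 5 * ‖p‖, integral_nonneg fun _ => by positivity, fun r hr hpr => ?_⟩
    have hr0 : 0 < r := by linarith
    set g : E → ℝ := fun x => if 0 < A x then 1 else 0 with hg
    have lg : LB g := LB.ind hAc
    set p' := r⁻¹ • p with hp'
    have hnp : ‖p'‖ = ‖p‖ / r := by rw [hp', norm_smul, norm_inv, Real.norm_of_nonneg hr0.le]; field_simp
    have hp1 : ‖p'‖ ≤ 1 := by rw [hnp, div_le_one hr0]; exact hpr
    have gen : ∀ c : E, ‖c‖ ≤ 1 → ∫ x in ball (0:E) 2, g x * bump c 1 x = ∫ y in ball (0:E) 1, g (c + (1:ℝ) • y) * (1 - ‖y‖ ^ 2) := by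
      intro c hc
      rw [setIntegral_eq_of_subset_of_forall_diff_eq_zero measurableSet_ball (s := ball c 1) (fun x hx => ?_)
        (fun x hx => by rw [bump_out c 1 x hx.2 one_pos, mul_zero]), K_eq c one_pos le_rfl]
      · simp
      · rw [mem_ball, dist_eq_norm] at hx
        rw [mem_ball_zero_iff]
        have := norm_add_le (x - c) c
        rw [sub_add_cancel] at this
        linarith
    have e1 : Df A p r = ∫ x in ball (0:E) 2, g x * bump p' 1 x := by
      rw [gen p' hp1, Df]
      refine int_congr _ _ (Eventually.of_forall fun y _ => ?_)
      simp only [hg]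
      have : p + r • y = r • (p' + (1:ℝ) • y) := by
        rw [smul_add, hp', smul_smul, mul_inv_cancel₀ hr0.ne', one_smul, one_smul]
      rw [this, hh r hr0]
      simp only [mul_pos_iff_of_pos_left hr0]
    have e2 : Df A 0 1 = ∫ x in ball (0:E) 2, g x * bump 0 1 x := by
      rw [gen 0 (by simp), Df]
    rw [e1, e2, div_eq_mul_inv, mul_comm _ r⁻¹, ← integral_const_mul,
      ← LB.iadd (lg.mul (LB.cont (bump_ll 0 1).continuous)) ((LB.const (5 * ‖p‖)).cmul r⁻¹)]
    refine LB.mono_ae (lg.mul (LB.cont (bump_ll p' 1).continuous)) ((lg.mul (LB.cont (bump_ll 0 1).continuous)).add ((LB.const (5 * ‖p‖)).cmul r⁻¹)) _ _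
      (Eventually.of_forall fun x hx => ?_)
    rw [mem_ball_zero_iff] at hx
    have hb : bump p' 1 x ≤ bump 0 1 x + 5 * ‖p'‖ := by
      unfold bump
      have h1 : ‖x‖ ≤ ‖x - p'‖ + ‖p'‖ := by
        have := norm_add_le (x - p') p'
        rwa [sub_add_cancel] at this
      have h2 : ‖x - p'‖ ≤ ‖x‖ + ‖p'‖ := norm_sub_le _ _
      rw [sub_zero]
      have h3 : ‖x‖ ^ 2 ≤ ‖x - p'‖ ^ 2 + 5 * ‖p'‖ := by
        rcases le_total ‖x - p'‖ ‖x‖ with h4 | h4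
        · nlinarith [norm_nonneg p', norm_nonneg x, norm_nonneg (x - p')]
        · nlinarith [norm_nonneg p', norm_nonneg x, norm_nonneg (x - p')]
      refine max_le ?_ ?_
      · have := le_max_left (1 ^ 2 - ‖x‖ ^ 2) 0
        linarith
      · have := le_max_right (1 ^ 2 - ‖x‖ ^ 2) 0
        positivity
    have hk : r⁻¹ * (5 * ‖p‖) = 5 * ‖p'‖ := by rw [hnp]; field_simp
    rw [hk]
    simp only [hg]
    split_ifs
    · linarith
    · simp
  by_contra hn
  push Not at hn
  set δ := (h - Df A 0 1) / 3 with hδ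
  have hδ0 : 0 < δ := by rw [hδ]; linarith
  obtain ⟨K, hK0, hK⟩ := hDup
  refine log_top hd hN0 hNC (δ := δ) (ρ := 1 + ‖p‖ + K / δ) hδ0 (by positivity) (fun r hr => ?_)
  have hKd : 0 ≤ K / δ := by positivity
  have hr0 : 0 < r := by linarith [norm_nonneg p]
  have h1 := hK r (by linarith [norm_nonneg p]) (by linarith)
  have h2 := step1 δ hδ0 r hr0
  have h3 := hPhi r hr0
  have h4 : K / r ≤ δ := by
    rw [div_le_iff₀ hr0, mul_comm, ← div_le_iff₀ hδ0]
    linarith [norm_nonneg p]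
  linarith

end
end AC

open MeasureTheory Metric Set Filter ENNReal NNReal

set_option linter.all false
namespace AC
open scoped Gradient Topology InnerProductSpace

section
variable {E : Type*} [NormedAddCommGroup E] [InnerProductSpace ℝ E] [FiniteDimensional ℝ E]
variable [MeasureSpace E] [BorelSpace E] [(volume : Measure E).IsAddHaarMeasure]

theorem hom_ind {W : E → ℝ} (hW : Hom W) {S : Set E} (hS : ∀ s : ℝ, 0 < s → ∀ x, s • x ∈ S ↔ x ∈ S) : Hom (S.indicator W) := by
  intro s hs x
  by_cases hx : x ∈ S
  · rw [indicator_of_mem hx, indicator_of_mem ((hS s hs x).2 hx), hW s hs]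
  · rw [indicator_of_notMem hx, indicator_of_notMem (fun h => hx ((hS s hs x).1 h)), mul_zero]

theorem c1_end [Nontrivial E] {U W : E → ℝ} {L : ℝ≥0} (hU : Mz U) (hhU : Hom U) (hW : Mz W) (hL : LipschitzWith L W) (hhW : Hom W)
    (hUW : ∀ x, U x ≤ W x) (hconn : IsConnected {x | 0 < U x}) : ∀ x, W x = U x := by
  set S : Set E := {x | 0 < U x} with hS
  have hSo : IsOpen S := isOpen_lt continuous_const hU.2.1.continuous
  have hfr : ∀ x ∈ frontier S, W x = 0 := by
    intro x hx
    have hxS : x ∉ S := by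
      rw [hSo.frontier_eq] at hx; exact hx.2
    have hU0 : U x = 0 := le_antisymm (not_lt.1 hxS) (hU.1 x)
    by_contra hn
    have hWp : 0 < W x := lt_of_le_of_ne (hW.1 x) (Ne.symm hn)
    obtain ⟨r, hr, h⟩ := pair hW hU hhW hhU hUW hWp hU0
    obtain ⟨y, hy, hyS⟩ := Metric.mem_closure_iff.1 (frontier_subset_closure hx) r hr
    have h2 := h y (by rw [mem_ball, dist_comm]; exact hyS)
    have h3 : 0 < U y := hy
    linarith
  have hSs : ∀ s : ℝ, 0 < s → ∀ x, s • x ∈ S ↔ x ∈ S := by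
    intro s hs x
    show 0 < U (s • x) ↔ 0 < U x
    rw [hhU s hs, mul_pos_iff_of_pos_left hs]
  have lA : LipschitzWith L (S.indicator W) := lip_ind hL hfr
  have lB : LipschitzWith L (Sᶜ.indicator W) := lip_ind hL (by rw [frontier_compl]; exact hfr)
  have hhA : Hom (S.indicator W) := hom_ind hhW hSs
  have hhB : Hom (Sᶜ.indicator W) := hom_ind hhW (fun s hs x => not_congr (hSs s hs x))
  have hA0 : ∀ x, 0 ≤ S.indicator W x := fun x => indicator_nonneg (fun y _ => hW.1 y) x
  have hB0 : ∀ x, 0 ≤ Sᶜ.indicator W x := fun x => indicator_nonneg (fun y _ => hW.1 y) x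
  have hadd : ∀ x, S.indicator W x + Sᶜ.indicator W x = W x := fun x => indicator_self_add_compl_apply S W x
  have hmul : ∀ x, S.indicator W x = 0 ∨ Sᶜ.indicator W x = 0 := by
    intro x
    by_cases hx : x ∈ S
    · right; exact indicator_of_notMem (s := Sᶜ) (fun h => h hx) _
    · left; exact indicator_of_notMem hx _
  have mA : Mz (S.indicator W) := hW.split lA.locallyLipschitz lB.locallyLipschitz hA0 hB0 hadd hmul
  have mB : Mz (Sᶜ.indicator W) := hW.split lB.locallyLipschitz lA.locallyLipschitz hB0 hA0
    (fun x => by rw [add_comm]; exact hadd x) (fun x => (hmul x).symm)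
  have hAS : {x | 0 < S.indicator W x} = S := by
    ext x
    by_cases hx : x ∈ S
    · have : 0 < U x := hx
      simp only [mem_setOf_eq, indicator_of_mem hx, hx, iff_true]
      exact this.trans_le (hUW x)
    · simp [indicator_of_notMem hx, hx]
  have hAU : ∀ x, S.indicator W x = U x := by
    refine uniq mA hU hhA hhU (fun x => ?_) (fun x hx => ?_) (by rw [hAS]; exact hconn)
    · by_cases hx : x ∈ S
      · rw [indicator_of_mem hx]; exact hUW x
      · rw [indicator_of_notMem hx]; exact not_lt.1 hx
    · have : x ∈ S := by rw [← hAS]; exact hx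
      exact this
  have hB : ∀ x, Sᶜ.indicator W x = 0 := by
    intro x1
    by_contra hne
    have hx1 : 0 < Sᶜ.indicator W x1 := lt_of_le_of_ne (hB0 x1) (Ne.symm hne)
    obtain ⟨x0, hx0⟩ := hconn.nonempty
    have hx0' : 0 < S.indicator W x0 := by rw [hAU]; exact hx0
    have d1 := density mA lA hhA hx0'
    have d2 := density mB lB hhB hx1
    generalize S.indicator W = A at *
    generalize Sᶜ.indicator W = B at *
    have lw : LB (fun y : E => 1 - ‖y‖ ^ 2) := LB.cont (by fun_prop)
    have la : LB (fun y => (if 0 < A ((0:E) + (1:ℝ) • y) then (1:ℝ) else 0)) := (LB.ind mA.2.1.continuous).scale 0 1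
    have lb : LB (fun y => (if 0 < B ((0:E) + (1:ℝ) • y) then (1:ℝ) else 0)) := (LB.ind mB.2.1.continuous).scale 0 1
    have hpt : ∀ y ∈ ball (0:E) 1, 0 ≤ ((1 - ‖y‖ ^ 2) - (if 0 < A ((0:E) + (1:ℝ) • y) then (1:ℝ) else 0) * (1 - ‖y‖ ^ 2))
        - (if 0 < B ((0:E) + (1:ℝ) • y) then (1:ℝ) else 0) * (1 - ‖y‖ ^ 2) := by
      intro y hy
      have := norm_lt_one_of_mem hy
      have h1 : 0 ≤ 1 - ‖y‖ ^ 2 := by nlinarith [norm_nonneg y]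
      rcases hmul ((0:E) + (1:ℝ) • y) with h | h
      · rw [h, if_neg (lt_irrefl _)]; split_ifs <;> linarith
      · rw [h, if_neg (lt_irrefl _)]; split_ifs <;> linarith
    have h2 : ∫ y in ball (0:E) 1, (((1 - ‖y‖ ^ 2) - (if 0 < A ((0:E) + (1:ℝ) • y) then (1:ℝ) else 0) * (1 - ‖y‖ ^ 2))
        - (if 0 < B ((0:E) + (1:ℝ) • y) then (1:ℝ) else 0) * (1 - ‖y‖ ^ 2)) = 0 := by
      refine le_antisymm ?_ (setIntegral_nonneg measurableSet_ball hpt)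
      rw [LB.isub (lw.sub (la.mul lw)) (lb.mul lw), LB.isub lw (la.mul lw)]
      unfold Df at d1 d2
      linarith
    rw [setIntegral_eq_zero_iff_of_nonneg_ae ((ae_restrict_iff' measurableSet_ball).2
      (Eventually.of_forall hpt)) (((lw.sub (la.mul lw)).sub (lb.mul lw)).int _ _)] at h2
    rw [Filter.EventuallyEq, ae_restrict_iff' measurableSet_ball] at h2
    have h3 : ∀ᵐ y : E, y ∈ ball (0:E) 1 → 0 < W y := by
      filter_upwards [h2] with y hy hyb
      have hy := hy hyb
      have hn := norm_lt_one_of_mem hyb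
      rw [zero_add, one_smul] at hy
      by_contra hW0
      have hWy : W y = 0 := le_antisymm (not_lt.1 hW0) (hW.1 y)
      have ha := hadd y
      have hA1 : ¬ 0 < A y := by linarith [hB0 y]
      have hB1 : ¬ 0 < B y := by linarith [hA0 y]
      rw [if_neg hA1, if_neg hB1] at hy
      simp at hy
      nlinarith [norm_nonneg y]
    have h4 : ∀ᵐ x : E, 0 < W x := by
      refine ae_of_balls fun k => ?_
      have hk : (0:ℝ) < k + 1 := by positivity
      filter_upwards [ae_scale h3 0 (inv_ne_zero hk.ne')] with x hx hxk
      rw [zero_add, hhW _ (inv_pos.2 hk), mul_pos_iff_of_pos_left (inv_pos.2 hk)] at hx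
      refine hx ?_
      rw [mem_ball_zero_iff] at hxk ⊢
      rw [norm_smul, norm_inv, Real.norm_of_nonneg hk.le, inv_mul_lt_iff₀ hk]
      linarith
    exact (hW.pos_of_ae h4 0).ne' hhW.zero
  intro x
  rw [← hadd x, hB x, add_zero, hAU]

theorem us_lip {u : E → ℝ} {L : ℝ≥0} (hL : LipschitzWith L u) {r : ℝ} (hr : 0 < r) : LipschitzWith L (us u 0 r) := by
  refine LipschitzWith.of_dist_le_mul fun x y => ?_
  have h1 := hL.dist_le_mul (0 + r • x) (0 + r • y)
  have h2 : dist (0 + r • x) (0 + r • y) = r * dist x y := by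
    rw [zero_add, zero_add, dist_smul₀, Real.norm_of_nonneg hr.le]
  rw [h2, Real.dist_eq] at h1
  simp only [us]
  rw [Real.dist_eq, ← mul_sub, abs_mul, abs_of_pos (inv_pos.2 hr)]
  calc r⁻¹ * |u (0 + r • x) - u (0 + r • y)| ≤ r⁻¹ * (L * (r * dist x y)) := by gcongr
    _ = L * dist x y := by field_simp

theorem core [Nontrivial E] {U V : E → ℝ} (hU : Mz U) (hhU : Hom U) (hconn : IsConnected {x | 0 < U x}) (hV : Mz V)
    (hcase : (∀ x, U x ≤ V x) ∨ ((∀ x, V x ≤ U x) ∧ V ≠ 0)) :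
    ∀ K : Set E, IsCompact K → TendstoUniformlyOn (fun (t : ℝ) x => V (t • x) / t) U atTop K := by
  obtain ⟨x0, hx0⟩ := hconn.nonempty
  have hx0 : 0 < U x0 := hx0
  obtain ⟨z0, hz0⟩ : ∃ z, V z = 0 := by
    rcases hcase with h | h
    · by_contra hn
      push Not at hn
      have hpos : ∀ y, 0 < V y := fun y => lt_of_le_of_ne (hV.1 y) (Ne.symm (hn y))
      have hs : 0 < (V 0 + 1) / U x0 := div_pos (by linarith [hV.1 0]) hx0
      have h1 := h (((V 0 + 1) / U x0) • x0)
      rw [hhU _ hs, div_mul_cancel₀ _ hx0.ne'] at h1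
      linarith [liouville hV hpos (((V 0 + 1) / U x0) • x0) 0]
    · exact ⟨0, le_antisymm ((h.1 0).trans hhU.zero.le) (hV.1 0)⟩
  have hL := hV.lip hz0
  have main : ∀ (t : ℕ → ℝ) (W : E → ℝ), Tendsto t atTop atTop → (∀ k, 0 < t k) →
      (∀ x, Tendsto (fun k => us V 0 (t k) x) atTop (𝓝 (W x))) → ∀ x, W x = U x := by
    intro t W ht ht0 hW
    obtain ⟨hWL, hWM, hW0, hWh⟩ := blow_hom hV hL ht ht0 hW
    rcases hcase with h | ⟨h, hne⟩
    · refine c1_end hU hhU hWM hWL hWh (fun x => ?_) hconn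
      refine ge_of_tendsto (hW x) (Eventually.of_forall fun k => ?_)
      have h1 := h (0 + t k • x)
      rw [zero_add, hhU _ (ht0 k)] at h1
      show U x ≤ (t k)⁻¹ * V (0 + t k • x)
      rw [zero_add, le_inv_mul_iff₀ (ht0 k)]
      exact h1
    · obtain ⟨z, hz⟩ := Function.ne_iff.1 hne
      have hz : 0 < V z := lt_of_le_of_ne (hV.1 z) (Ne.symm hz)
      refine c2_end hU hhU hWM hWh (fun x => ?_) (c2_nonzero hU hhU hV h hWL hz ht ht0 hW) hconn
      refine le_of_tendsto (hW x) (Eventually.of_forall fun k => ?_)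
      have h1 := h (0 + t k • x)
      rw [zero_add, hhU _ (ht0 k)] at h1
      show (t k)⁻¹ * V (0 + t k • x) ≤ U x
      rw [zero_add, inv_mul_le_iff₀ (ht0 k)]
      exact h1
  intro K hK
  rw [Metric.tendstoUniformlyOn_iff]
  intro ε hε
  by_contra hn
  rw [not_eventually] at hn
  have hsel : ∀ k : ℕ, ∃ t : ℝ, (k:ℝ) + 1 ≤ t ∧ ∃ x ∈ K, ε ≤ dist (U x) (V (t • x) / t) := by
    intro k
    obtain ⟨t, ht, h⟩ := Filter.frequently_atTop.1 hn (k + 1)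
    push Not at h
    exact ⟨t, ht, h⟩
  choose t ht1 x hxK hx using hsel
  have ht0 : ∀ k, 0 < t k := fun k => lt_of_lt_of_le (by positivity) (ht1 k)
  have htt : Tendsto t atTop atTop := tendsto_atTop_mono (fun k => by linarith [ht1 k]) tendsto_natCast_atTop_atTop
  obtain ⟨a, haK, φ, hφ, hxa⟩ := hK.tendsto_subseq hxK
  obtain ⟨ψ, W, hψ, hW⟩ := lip_extract (f := fun k => us V 0 (t (φ k))) (L := LC E) (C := |V 0|)
    (fun k => us_lip hL (ht0 _)) (fun k => by
      show |(t (φ k))⁻¹ * V (0 + t (φ k) • 0)| ≤ |V 0|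
      rw [smul_zero, zero_add, abs_mul, abs_of_pos (inv_pos.2 (ht0 _))]
      have : (t (φ k))⁻¹ ≤ 1 := inv_le_one_of_one_le₀ (by linarith [ht1 (φ k), Nat.cast_nonneg (α := ℝ) (φ k)])
      exact mul_le_of_le_one_left (abs_nonneg _) this)
  have hWU := main (fun k => t (φ (ψ k))) W (htt.comp (hφ.comp hψ).tendsto_atTop) (fun k => ht0 _) hW
  have c1 : Tendsto (fun k => x (φ (ψ k))) atTop (𝓝 a) := hxa.comp hψ.tendsto_atTop
  have c2 : Tendsto (fun k => U (x (φ (ψ k)))) atTop (𝓝 (U a)) := (hU.2.1.continuous.tendsto a).comp c1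
  have c3 : Tendsto (fun k => us V 0 (t (φ (ψ k))) a) atTop (𝓝 (U a)) := by rw [← hWU]; exact hW a
  have c4 : Tendsto (fun k => dist (U (x (φ (ψ k)))) (us V 0 (t (φ (ψ k))) a) + (LC E : ℝ≥0) * dist a (x (φ (ψ k)))) atTop
      (𝓝 (dist (U a) (U a) + (LC E : ℝ≥0) * dist a a)) :=
    (c2.dist c3).add ((tendsto_const_nhds.dist c1).const_mul _)
  rw [dist_self, dist_self, mul_zero, add_zero] at c4
  obtain ⟨k, hk⟩ := (c4.eventually_lt_const hε).exists
  have h1 := hx (φ (ψ k))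
  have h2 : V (t (φ (ψ k)) • x (φ (ψ k))) / t (φ (ψ k)) = us V 0 (t (φ (ψ k))) (x (φ (ψ k))) := by
    simp only [us]; rw [zero_add, div_eq_inv_mul]
  rw [h2] at h1
  have h3 := (us_lip hL (ht0 (φ (ψ k)))).dist_le_mul a (x (φ (ψ k)))
  have h4 := dist_triangle (U (x (φ (ψ k)))) (us V 0 (t (φ (ψ k))) a) (us V 0 (t (φ (ψ k))) (x (φ (ψ k))))
  linarith

end
end AC

open scoped Gradient in
theorem toMz {n : ℕ} {u : EuclideanSpace ℝ (Fin n) → ℝ} (h : IsMinimizer (Set.univ : Set (EuclideanSpace ℝ (Fin n))) u) :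
    AC.Mz u := by
  have hJ : ∀ w : EuclideanSpace ℝ (Fin n) → ℝ, LocallyLipschitz w → ∀ c r,
      JE (Set.univ ∩ Metric.ball c r) w = ENNReal.ofReal (∫ x in ball c r, AC.q w x) := by
    intro w hw c r
    rw [univ_inter, ofReal_integral_eq_lintegral_ofReal ((AC.LB.q hw).int c r) (Eventually.of_forall fun x => AC.q_nonneg w x)]
    unfold JE
    refine lintegral_congr fun x => ?_
    unfold AC.q
    rw [ENNReal.ofReal_add (by positivity) (by split_ifs <;> simp), ENNReal.ofReal_pow (norm_nonneg _)]
    congr 1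
    · rw [ofReal_norm]; rfl
    · split_ifs <;> simp
  refine ⟨h.1, h.2.1, fun v hv0 hv c R hvu => ?_⟩
  have hsub : {x | v x ≠ u x} ⊆ Metric.ball c R := by
    intro x hx
    by_contra hn
    exact hx (hvu x hn)
  have h1 := h.2.2 v hv0 hv (Metric.isBounded_ball.subset hsub) (subset_univ _) c R hsub
  rw [hJ u h.2.1, hJ v hv] at h1
  exact (ENNReal.ofReal_le_ofReal_iff (integral_nonneg fun x => AC.q_nonneg v x)).1 h1

/-- blow-down asymptotics (Lemma 3.1): a one-sided global minimizer is
asymptotic to `U₀` at infinity, uniformly on compact sets. -/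
theorem stmt11 {n : ℕ} (hn : 2 ≤ n) (U₀ : EuclideanSpace ℝ (Fin n) → ℝ)
    (hU₀min : IsMinimizer (Set.univ : Set (EuclideanSpace ℝ (Fin n))) U₀)
    (hU₀ne : U₀ ≠ 0)
    (hU₀hom : ∀ t : ℝ, 0 < t → ∀ x, U₀ (t • x) = t * U₀ x)
    (hconn : IsConnected {x | 0 < U₀ x})
    (V : EuclideanSpace ℝ (Fin n) → ℝ)
    (hV : IsMinimizer (Set.univ : Set (EuclideanSpace ℝ (Fin n))) V)
    (hcase : (∀ x, U₀ x ≤ V x) ∨ ((∀ x, V x ≤ U₀ x) ∧ V ≠ 0)) :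
    ∀ K : Set (EuclideanSpace ℝ (Fin n)), IsCompact K →
      TendstoUniformlyOn (fun (t : ℝ) x => V (t • x) / t) U₀ atTop K := by
  haveI : Nontrivial (EuclideanSpace ℝ (Fin n)) := by
    apply Module.nontrivial_of_finrank_pos (R := ℝ)
    rw [finrank_euclideanSpace_fin]; omega
  exact AC.core (toMz hU₀min) hU₀hom hconn (toMz hV) hcase
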